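/- arXiv:1804.07499 — 6 statements merged into one kernel-verified Lean document; each statement's English description precedes it below -/
import Mathlib

section
/- Let n ≥ 2 be an integer, let m = (n, n, …, n) ∈ ℤ^d, and let 𝓖 = [0,1)^d ⊕ T be a cube tiling of the torus T^d_m. Then Σ_{i=1}^d |p_i(T)| = (n^d − 1)/(n − 1) if and only if 𝓖 is a multipile with respect to the system of d-boxes in which X_i = [0,n) and Π_i consists of the trivial partition {X_i} together with the unit-segment partitions π_t = {[0,1) ⊕ t ⊕ k : k ∈ {0,…,n−1}} for t ∈ [0,1). -/
open Set

/-- A partition of a type `α`: a family of nonempty pairwise disjoint subsets whose union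
is everything. -/
def IsPartition {α : Type*} (π : Set (Set α)) : Prop :=
  (∀ A ∈ π, A.Nonempty) ∧ π.PairwiseDisjoint id ∧ ⋃₀ π = Set.univ

/-- `Coarser π ρ` means `ρ` is coarser than `π`: every part of `π` lies in a part of `ρ`. -/
def Coarser {α : Type*} (π ρ : Set (Set α)) : Prop :=
  ∀ A ∈ π, ∃ B ∈ ρ, A ⊆ B

/-- Two partitions are independent if the only partition coarser than both is the trivial
partition `{univ}`. -/
def IndepPartitions {α : Type*} (π π' : Set (Set α)) : Prop :=
  ∀ ρ : Set (Set α), IsPartition ρ → Coarser π ρ → Coarser π' ρ → ρ = {Set.univ}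

/-- A system of `d`-boxes: each `X i` has at least two elements, and `P i` is a finite
family of pairwise independent finite partitions of `X i`. -/
def IsBoxSystem {d : ℕ} (X : Fin d → Type*) (P : ∀ i, Set (Set (Set (X i)))) : Prop :=
  (∀ i, Nontrivial (X i)) ∧ (∀ i, (P i).Finite) ∧ (∀ i, ∀ π ∈ P i, π.Finite) ∧
    (∀ i, ∀ π ∈ P i, IsPartition π) ∧
    (∀ i, ∀ π ∈ P i, ∀ π' ∈ P i, π ≠ π' → IndepPartitions π π')

/-- `K` is a box: every factor `K i` is a part of some partition in `P i`. -/
def IsBox {d : ℕ} {X : Fin d → Type*} (P : ∀ i, Set (Set (Set (X i))))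
    (K : ∀ i, Set (X i)) : Prop :=
  ∀ i, ∃ π ∈ P i, K i ∈ π

/-- The subset of `X` determined by the box `K`. -/
def boxSet {d : ℕ} {X : Fin d → Type*} (K : ∀ i, Set (X i)) : Set (∀ i, X i) :=
  Set.univ.pi K

/-- Keller's condition for a pair of boxes: in some coordinate the factors are distinct
parts of one partition. -/
def KellerPair {d : ℕ} {X : Fin d → Type*} (P : ∀ i, Set (Set (Set (X i))))
    (K L : ∀ i, Set (X i)) : Prop :=
  ∃ i, ∃ π ∈ P i, K i ∈ π ∧ L i ∈ π ∧ K i ≠ L i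

/-- A Keller family: a nonempty family of boxes any two distinct members of which satisfy
Keller's condition. -/
def IsKellerFamily {d : ℕ} {X : Fin d → Type*} (P : ∀ i, Set (Set (Set (X i))))
    (G : Set (∀ i, Set (X i))) : Prop :=
  G.Nonempty ∧ (∀ K ∈ G, IsBox P K) ∧ ∀ K ∈ G, ∀ L ∈ G, K ≠ L → KellerPair P K L

/-- The union (polybox) of a family of boxes. -/
def polyUnion {d : ℕ} {X : Fin d → Type*} (G : Set (∀ i, Set (X i))) : Set (∀ i, X i) :=
  ⋃ K ∈ G, boxSet K

/-- The restriction `𝓖|𝓥 = {K ∈ 𝓖 : K i ∈ 𝓥}`. -/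
def restrictFam {d : ℕ} {X : Fin d → Type*} (G : Set (∀ i, Set (X i))) (i : Fin d)
    (V : Set (Set (X i))) : Set (∀ i, Set (X i)) :=
  {K ∈ G | K i ∈ V}

/-- An `i`-cylinder: together with any point it contains the whole line through that point
in direction `i`. -/
def IsCylinder {d : ℕ} {X : Fin d → Type*} (i : Fin d) (W : Set (∀ j, X j)) : Prop :=
  ∀ x ∈ W, ∀ y : X i, Function.update x i y ∈ W

/-- `π` is present in `𝓖` if some box of `𝓖` has its `i`-th factor in `π`. -/
def PresentIn {d : ℕ} {X : Fin d → Type*} (G : Set (∀ i, Set (X i))) (i : Fin d)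
    (π : Set (Set (X i))) : Prop :=
  ∃ K ∈ G, K i ∈ π

/-- A nontrivial partition `π ∈ P i` is hidden in `𝓖` if `𝓖|π` is a suit for an
`i`-cylinder. -/
def HiddenIn {d : ℕ} {X : Fin d → Type*} (P : ∀ i, Set (Set (Set (X i))))
    (G : Set (∀ i, Set (X i))) (i : Fin d) (π : Set (Set (X i))) : Prop :=
  π ∈ P i ∧ π ≠ {Set.univ} ∧ IsKellerFamily P (restrictFam G i π) ∧
    IsCylinder i (polyUnion (restrictFam G i π))

/-- A nontrivial partition `π ∈ P i` is exposed in `𝓖` if it is present and not hidden. -/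
def ExposedIn {d : ℕ} {X : Fin d → Type*} (P : ∀ i, Set (Set (Set (X i))))
    (G : Set (∀ i, Set (X i))) (i : Fin d) (π : Set (Set (X i))) : Prop :=
  π ∈ P i ∧ π ≠ {Set.univ} ∧ PresentIn G i π ∧ ¬ HiddenIn P G i π

/-- Multipiles, defined recursively: either a single box, or an `i`-pile laminated with
respect to a nontrivial `π ∈ P i` whose restrictions `𝓖|A`, `A ∈ π`, are multipiles with
pairwise disjoint families of hidden partitions in every direction `k ≠ i`. -/
inductive IsMultipile {d : ℕ} {X : Fin d → Type*} (P : ∀ i, Set (Set (Set (X i)))) :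
    Set (∀ i, Set (X i)) → Prop
  | single (K : ∀ i, Set (X i)) (hK : IsBox P K) : IsMultipile P {K}
  | pile (G : Set (∀ i, Set (X i))) (i : Fin d) (π : Set (Set (X i)))
      (hπ : π ∈ P i) (hnt : π ≠ {Set.univ})
      (hK : IsKellerFamily P G)
      (hlam : restrictFam G i π = G)
      (hcyl : IsCylinder i (polyUnion G))
      (hsub : ∀ A ∈ π, IsMultipile P (restrictFam G i {A}))
      (hdis : ∀ k, k ≠ i → ∀ A ∈ π, ∀ B ∈ π, A ≠ B → ∀ ρ,
          ¬ (HiddenIn P (restrictFam G i {A}) k ρ ∧ HiddenIn P (restrictFam G i {B}) k ρ)) :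
      IsMultipile P G

/-- `amod r m` is the representative of `r` modulo `m` in `[0, m)`. -/
noncomputable def amod (r : ℝ) (m : ℕ) : ℝ := r - (m : ℝ) * (⌊r / (m : ℝ)⌋ : ℝ)

/-- The torus `T^d_m = [0,m_1) × ⋯ × [0,m_d)`. -/
def torus {d : ℕ} (m : Fin d → ℕ) : Set (Fin d → ℝ) :=
  {x | ∀ i, x i ∈ Set.Ico (0 : ℝ) (m i)}

/-- The translated unit cube `[0,1)^d ⊕ t` inside the torus. -/
def cube {d : ℕ} (m : Fin d → ℕ) (t : Fin d → ℝ) : Set (Fin d → ℝ) :=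
  {x ∈ torus m | ∀ i, amod (x i - t i) (m i) < 1}

/-- `[0,1)^d ⊕ T` is a cube tiling of the torus: a partition of `T^d_m` into translated
unit cubes. -/
def IsCubeTiling {d : ℕ} (m : Fin d → ℕ) (T : Set (Fin d → ℝ)) : Prop :=
  T ⊆ torus m ∧ (∀ s ∈ T, ∀ t ∈ T, s ≠ t → Disjoint (cube m s) (cube m t)) ∧
    ⋃ t ∈ T, cube m t = torus m

/-- `p_i(T) = {t_i mod 1 : t ∈ T}`. -/
def pset {d : ℕ} (T : Set (Fin d → ℝ)) (i : Fin d) : Set ℝ :=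
  (fun t => Int.fract (t i)) '' T

/-- The unit segment `[0,1) ⊕ c` inside `[0,m)`, as a subset of the subtype. -/
def segPart (m : ℕ) (c : ℝ) : Set ↥(Set.Ico (0 : ℝ) (m : ℝ)) :=
  {x | amod ((x : ℝ) - c) m < 1}

/-- The unit-segment partition `π_t = {[0,1) ⊕ t ⊕ k : k ∈ {0,…,m-1}}` of `[0,m)`. -/
def segPartition (m : ℕ) (t : ℝ) : Set (Set ↥(Set.Ico (0 : ℝ) (m : ℝ))) :=
  {A | ∃ k : ℕ, k < m ∧ A = segPart m (t + (k : ℝ))}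

/-- The family of partitions of `[0,m)` consisting of the trivial partition together with
all unit-segment partitions `π_t`, `t ∈ [0,1)`. -/
def segSystem (m : ℕ) : Set (Set (Set ↥(Set.Ico (0 : ℝ) (m : ℝ)))) :=
  insert {Set.univ} {π | ∃ t ∈ Set.Ico (0 : ℝ) 1, π = segPartition m t}

/-! ### Abstract part -/

/-- The multilinear tiling property. -/
def MM {d : ℕ} {ι A : Type*} (n : ℕ) [NeZero n] (cl : ι → Fin d → A) (ly : ι → Fin d → ZMod n)
    (S : Finset (Fin d)) (T : Finset ι) : Prop :=
  ∀ (φ : Fin d → A → ZMod n → ℝ) (c : Fin d → ℝ),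
    (∀ k ∈ S, ∀ a, ∑ s, φ k a s = c k) →
    ∑ t ∈ T, ∏ k ∈ S, φ k (cl t k) (ly t k) = ∏ k ∈ S, c k

section Abstract

open Classical

variable {d : ℕ} {ι A : Type*} {n : ℕ} [NeZero n] {cl : ι → Fin d → A}
  {ly : ι → Fin d → ZMod n} {S : Finset (Fin d)} {T : Finset ι}

lemma MM.card (h : MM n cl ly S T) : T.card = n ^ S.card := by
  have := h (fun _ _ _ => 1) (fun _ => n) (by intros; simp)
  simp at this
  exact_mod_cast this

lemma MM.exists_match (h : MM n cl ly S T) (x : Fin d → A → ZMod n) :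
    ∃ t ∈ T, ∀ k ∈ S, x k (cl t k) = ly t k := by
  have := h (fun k a s => if x k a = s then 1 else 0) (fun _ => 1) (by intros; simp)
  by_contra hc
  push Not at hc
  rw [Finset.sum_eq_zero] at this
  · simp at this
  · intro t ht
    obtain ⟨k, hk, hne⟩ := hc t ht
    exact Finset.prod_eq_zero hk (by simp [hne])

lemma MM.unique_match (h : MM n cl ly S T) (x : Fin d → A → ZMod n) {t u : ι}
    (ht : t ∈ T) (hu : u ∈ T) (h1 : ∀ k ∈ S, x k (cl t k) = ly t k)
    (h2 : ∀ k ∈ S, x k (cl u k) = ly u k) : t = u := by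
  have := h (fun k a s => if x k a = s then 1 else 0) (fun _ => 1) (by intros; simp)
  by_contra hne
  have hle : ∑ v ∈ ({t, u} : Finset ι), ∏ k ∈ S, (if x k (cl v k) = ly v k then (1:ℝ) else 0) ≤
      ∑ v ∈ T, ∏ k ∈ S, (if x k (cl v k) = ly v k then (1:ℝ) else 0) := by
    apply Finset.sum_le_sum_of_subset_of_nonneg
    · intro v hv
      simp at hv
      rcases hv with rfl | rfl <;> assumption
    · intro v _ _
      apply Finset.prod_nonneg
      intro k _
      split_ifs <;> norm_num
  rw [this, Finset.sum_pair hne, Finset.prod_congr rfl (fun k hk => if_pos (h1 k hk)),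
    Finset.prod_congr rfl (fun k hk => if_pos (h2 k hk))] at hle
  norm_num at hle

lemma MM.keller (h : MM n cl ly S T) {t u : ι} (ht : t ∈ T) (hu : u ∈ T) (hne : t ≠ u) :
    ∃ k ∈ S, cl t k = cl u k ∧ ly t k ≠ ly u k := by
  by_contra hc
  push Not at hc
  apply hne
  apply h.unique_match (fun k a => if a = cl t k then ly t k else ly u k) ht hu
  · intro k _; simp
  · intro k hk
    by_cases he : cl u k = cl t k
    · simp [he, hc k hk he.symm]
    · simp [he]

/-- sums for the kernel -/
noncomputable def gk (n : ℕ) (cl : ι → Fin d → A) (ly : ι → Fin d → ZMod n) (k : Fin d)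
    (t u : ι) : ℝ :=
  if cl u k = cl t k then (if ly u k = ly t k then (n : ℝ) - 1 else -1) else 0

lemma gk_sum_zero (t : ι) (k : Fin d) (a : A) :
    ∑ s : ZMod n, (if a = cl t k then (if s = ly t k then (n : ℝ) - 1 else -1) else 0) = 0 := by
  by_cases ha : a = cl t k
  · simp only [ha, if_true]
    have : ∀ s : ZMod n, (if s = ly t k then (n : ℝ) - 1 else -1) =
      (if s = ly t k then (n : ℝ) else 0) - 1 := by intro s; split_ifs <;> ring
    simp [this]
  · simp [ha]

lemma MM.sum_gk (h : MM n cl ly S T) (t : ι) {k : Fin d} (hk : k ∈ S) :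
    ∑ u ∈ T, gk n cl ly k t u = 0 := by
  have := h (fun l a s => if l = k then
    (if a = cl t k then (if s = ly t k then (n : ℝ) - 1 else -1) else 0) else 1 )
    (fun l => if l = k then 0 else n) (by
      intro l _ a
      by_cases hl : l = k
      · simpa [hl] using gk_sum_zero (n := n) (cl := cl) (ly := ly) t k a
      · simp [hl])
  rw [Finset.prod_eq_zero hk (by simp)] at this
  rw [← this]
  apply Finset.sum_congr rfl
  intro u _
  rw [← Finset.mul_prod_erase S _ hk, Finset.prod_eq_one]
  · simp [gk]
  · intro l hl
    simp [Finset.ne_of_mem_erase hl]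

lemma MM.sum_gk_mul (h : MM n cl ly S T) (t : ι) {k l : Fin d} (hk : k ∈ S) (hl : l ∈ S)
    (hkl : k ≠ l) : ∑ u ∈ T, gk n cl ly k t u * gk n cl ly l t u = 0 := by
  have := h (fun j a s => if j = k ∨ j = l then
    (if a = cl t j then (if s = ly t j then (n : ℝ) - 1 else -1) else 0) else 1 )
    (fun j => if j = k ∨ j = l then 0 else n) (by
      intro j _ a
      by_cases hj : j = k ∨ j = l
      · simpa [hj] using gk_sum_zero (n := n) (cl := cl) (ly := ly) t j a
      · simp [hj])
  rw [Finset.prod_eq_zero hk (by simp)] at this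
  rw [← this]
  apply Finset.sum_congr rfl
  intro u _
  rw [← Finset.mul_prod_erase S _ hk,
    ← Finset.mul_prod_erase (S.erase k) _ (Finset.mem_erase.2 ⟨hkl.symm, hl⟩), Finset.prod_eq_one]
  · simp [gk]
  · intro j hj
    have h1 := Finset.ne_of_mem_erase hj
    have h2 := Finset.ne_of_mem_erase (Finset.mem_of_mem_erase hj)
    simp [h1, h2]

lemma MM.sum_gk_sq (h : MM n cl ly S T) (t : ι) {k : Fin d} (hk : k ∈ S) :
    ∑ u ∈ T, gk n cl ly k t u * gk n cl ly k t u =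
      ((n : ℝ) - 1) * (T.filter (fun u => cl u k = cl t k)).card := by
  have e : ∀ u, gk n cl ly k t u * gk n cl ly k t u =
      ((n : ℝ) - 1) * (if cl u k = cl t k then 1 else 0) + ((n : ℝ) - 2) * gk n cl ly k t u := by
    intro u
    unfold gk
    split_ifs <;> ring
  simp only [e, Finset.sum_add_distrib, ← Finset.mul_sum, h.sum_gk t hk]
  simp

/-- the number of tiles in the class of `t` -/
noncomputable def Dk (cl : ι → Fin d → A) (T : Finset ι) (k : Fin d) (t : ι) : ℝ :=
  (T.filter (fun u => cl u k = cl t k)).card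

lemma Dk_pos (k : Fin d) {t : ι} (ht : t ∈ T) : 0 < Dk cl T k t := by
  unfold Dk
  exact_mod_cast Finset.card_pos.2 ⟨t, by simp [ht]⟩

noncomputable def Rk (n : ℕ) (cl : ι → Fin d → A) (ly : ι → Fin d → ZMod n) (S : Finset (Fin d))
    (T : Finset ι) (t u : ι) : ℝ :=
  1 + ∑ k ∈ S, ((T.card : ℝ) / Dk cl T k t) * gk n cl ly k t u

lemma Rk_self (t : ι) : Rk n cl ly S T t t =
    1 + ((n : ℝ) - 1) * ∑ k ∈ S, ((T.card : ℝ) / Dk cl T k t) := by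
  unfold Rk gk
  simp [Finset.mul_sum, mul_comm]

lemma MM.sum_Rk_sq (h : MM n cl ly S T) {t : ι} (ht : t ∈ T) :
    ∑ u ∈ T, Rk n cl ly S T t u * Rk n cl ly S T t u = T.card * Rk n cl ly S T t t := by
  rw [Rk_self]
  unfold Rk
  have e : ∀ u, (1 + ∑ k ∈ S, ((T.card : ℝ) / Dk cl T k t) * gk n cl ly k t u) *
      (1 + ∑ k ∈ S, ((T.card : ℝ) / Dk cl T k t) * gk n cl ly k t u) =
      1 + 2 * (∑ k ∈ S, ((T.card : ℝ) / Dk cl T k t) * gk n cl ly k t u) +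
      ∑ k ∈ S, ∑ l ∈ S, ((T.card : ℝ) / Dk cl T k t) * ((T.card : ℝ) / Dk cl T l t) *
        (gk n cl ly k t u * gk n cl ly l t u) := by
    intro u
    have : (∑ k ∈ S, ((T.card : ℝ) / Dk cl T k t) * gk n cl ly k t u) *
       (∑ k ∈ S, ((T.card : ℝ) / Dk cl T k t) * gk n cl ly k t u) =
      ∑ k ∈ S, ∑ l ∈ S, ((T.card : ℝ) / Dk cl T k t) * ((T.card : ℝ) / Dk cl T l t) *
        (gk n cl ly k t u * gk n cl ly l t u) := by
      rw [Finset.sum_mul_sum]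
      refine Finset.sum_congr rfl fun k _ => Finset.sum_congr rfl fun l _ => by ring
    rw [← this]; ring
  simp only [e, Finset.sum_add_distrib, ← Finset.mul_sum]
  have h1 : ∑ u ∈ T, ∑ k ∈ S, ((T.card : ℝ) / Dk cl T k t) * gk n cl ly k t u = 0 := by
    rw [Finset.sum_comm]
    refine Finset.sum_eq_zero fun k hk => ?_
    rw [← Finset.mul_sum, h.sum_gk t hk, mul_zero]
  have h2 : ∑ u ∈ T, ∑ k ∈ S, ∑ l ∈ S, ((T.card : ℝ) / Dk cl T k t) *
      ((T.card : ℝ) / Dk cl T l t) * (gk n cl ly k t u * gk n cl ly l t u) =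
      ∑ k ∈ S, (T.card : ℝ) * (((n : ℝ) - 1) * ((T.card : ℝ) / Dk cl T k t)) := by
    rw [Finset.sum_comm]
    refine Finset.sum_congr rfl fun k hk => ?_
    rw [Finset.sum_comm, Finset.sum_eq_single k]
    · rw [← Finset.mul_sum, h.sum_gk_sq t hk]
      have := Dk_pos (cl := cl) k ht
      change _ * (((n : ℝ) - 1) * Dk cl T k t) = _
      field_simp
    · intro l hl hlk
      rw [← Finset.mul_sum, h.sum_gk_mul t hk hl hlk.symm, mul_zero]
    · exact fun hh => absurd hk hh
  rw [h1, h2, ← Finset.mul_sum, ← Finset.mul_sum]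
  simp
  ring

lemma sum_inv_Dk (k : Fin d) : ∑ t ∈ T, (1 / Dk cl T k t) = (T.image (fun t => cl t k)).card := by
  rw [← Finset.sum_fiberwise_of_maps_to (t := T.image (fun t => cl t k)) (g := fun t => cl t k)
    (fun t ht => Finset.mem_image_of_mem _ ht)]
  rw [Finset.cast_card]
  refine Finset.sum_congr rfl fun a ha => ?_
  obtain ⟨t, ht, rfl⟩ := Finset.mem_image.1 ha
  have : ∀ u ∈ T.filter (fun u => cl u k = cl t k), 1 / Dk cl T k u = 1 / Dk cl T k t := by
    intro u hu
    simp only [Finset.mem_filter] at hu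
    unfold Dk
    rw [hu.2]
  rw [Finset.sum_congr rfl this, Finset.sum_const, nsmul_eq_mul]
  have := Dk_pos (cl := cl) k ht
  change Dk cl T k t * _ = _
  field_simp

lemma MM.total (h : MM n cl ly S T) :
    ∑ t ∈ T, ∑ u ∈ T, ((if t = u then (T.card : ℝ) else 0) - Rk n cl ly S T t u) ^ 2 =
    (T.card : ℝ) ^ 2 * (T.card - (1 + ((n : ℝ) - 1) *
      ∑ k ∈ S, ((T.image (fun t => cl t k)).card : ℝ))) := by
  have h1 : ∀ t ∈ T, ∑ u ∈ T, ((if t = u then (T.card : ℝ) else 0) - Rk n cl ly S T t u) ^ 2 =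
      T.card * (T.card - Rk n cl ly S T t t) := by
    intro t ht
    have e : ∀ u, ((if t = u then (T.card : ℝ) else 0) - Rk n cl ly S T t u) ^ 2 =
      (if t = u then (T.card : ℝ) * (T.card - 2 * Rk n cl ly S T t u) else 0) +
        Rk n cl ly S T t u * Rk n cl ly S T t u := by
      intro u
      split_ifs <;> ring
    simp only [e, Finset.sum_add_distrib, h.sum_Rk_sq ht]
    rw [Finset.sum_ite_eq, if_pos ht]
    ring
  rw [Finset.sum_congr rfl h1, ← Finset.mul_sum]
  simp only [Rk_self, Finset.sum_sub_distrib, Finset.sum_add_distrib, ← Finset.mul_sum]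
  rw [Finset.sum_comm]
  have h2 : ∀ k ∈ S, ∑ t ∈ T, (T.card : ℝ) / Dk cl T k t =
      T.card * ((T.image (fun t => cl t k)).card : ℝ) := by
    intro k _
    rw [← sum_inv_Dk, Finset.mul_sum]
    exact Finset.sum_congr rfl fun t _ => by ring
  rw [Finset.sum_congr rfl h2, ← Finset.mul_sum]
  simp
  ring

/-- number of classes -/
noncomputable def NC (cl : ι → Fin d → A) (S : Finset (Fin d)) (T : Finset ι) : ℕ :=
  ∑ k ∈ S, (T.image (fun t => cl t k)).card

lemma MM.card_pos (h : MM n cl ly S T) : 0 < T.card := by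
  rw [h.card]; exact pow_pos (Nat.pos_of_ne_zero (NeZero.ne n)) _

lemma MM.bound (h : MM n cl ly S T) : (n - 1) * NC cl S T + 1 ≤ n ^ S.card := by
  have h0 := h.total
  have hp : (0 : ℝ) < T.card := by exact_mod_cast h.card_pos
  have h1 : 0 ≤ (T.card : ℝ) ^ 2 * (T.card - (1 + ((n : ℝ) - 1) *
      ∑ k ∈ S, ((T.image (fun t => cl t k)).card : ℝ))) := by
    rw [← h0]; positivity
  have h2 := nonneg_of_mul_nonneg_right h1 (by positivity)
  rw [← h.card]
  have hn : 1 ≤ n := Nat.pos_of_ne_zero (NeZero.ne n)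
  have : (((n - 1) * NC cl S T + 1 : ℕ) : ℝ) ≤ T.card := by
    unfold NC
    push_cast [Nat.cast_sub hn]
    linarith
  exact_mod_cast this

lemma MM.exists_const (hn : 2 ≤ n) (h : MM n cl ly S T) (hS : S.Nonempty)
    (he : (n - 1) * NC cl S T + 1 = n ^ S.card) : ∃ i ∈ S, ∃ a, ∀ t ∈ T, cl t i = a := by
  have h0 := h.total
  have hp : (0 : ℝ) < T.card := by exact_mod_cast h.card_pos
  have he' : (((n - 1) * NC cl S T + 1 : ℕ) : ℝ) = T.card := by
    rw [he, h.card]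
  unfold NC at he'
  push_cast [Nat.cast_sub (show 1 ≤ n by omega)] at he'
  rw [← he', add_comm (1 : ℝ), sub_self, mul_zero, he'] at h0
  obtain ⟨t, ht⟩ := Finset.card_pos.1 h.card_pos
  obtain ⟨u, hu, hm⟩ := h.exists_match (fun k _ => ly t k + 1)
  have : Fact (1 < n) := ⟨by omega⟩
  have hly : ∀ k ∈ S, ly u k ≠ ly t k := by
    intro k hk hh
    have := hm k hk
    rw [hh] at this
    simp at this
  have hne : t ≠ u := by
    rintro rfl
    obtain ⟨k, hk⟩ := hS
    exact hly k hk rfl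
  rw [Finset.sum_eq_zero_iff_of_nonneg (fun t _ => Finset.sum_nonneg fun u _ => sq_nonneg _)] at h0
  have h1 := h0 t ht
  rw [Finset.sum_eq_zero_iff_of_nonneg (fun u _ => sq_nonneg _)] at h1
  have h2 := h1 u hu
  rw [if_neg hne] at h2
  have h3 : Rk n cl ly S T t u = 0 := by nlinarith
  unfold Rk at h3
  have h4 : ∃ k ∈ S, gk n cl ly k t u ≠ 0 := by
    by_contra hc
    push Not at hc
    rw [Finset.sum_eq_zero (fun k hk => by rw [hc k hk, mul_zero])] at h3
    norm_num at h3
  obtain ⟨i, hi, hg⟩ := h4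
  have hgn : ∀ k ∈ S, 0 ≤ (T.card : ℝ) / Dk cl T k t * (-gk n cl ly k t u) := by
    intro k hk
    have := Dk_pos (cl := cl) k ht
    have : 0 ≤ -gk n cl ly k t u := by
      unfold gk; rw [if_neg (hly k hk)]; split_ifs <;> norm_num
    positivity
  have hgi : gk n cl ly i t u = -1 := by
    unfold gk at hg ⊢
    rw [if_neg (hly i hi)] at hg ⊢
    split_ifs at hg ⊢ <;> simp_all
  have h5 := Finset.single_le_sum hgn hi
  simp only [mul_neg, Finset.sum_neg_distrib] at h5
  rw [hgi] at h5
  have hD := Dk_pos (cl := cl) i ht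
  have h6 : (T.card : ℝ) / Dk cl T i t ≤ 1 := by linarith
  rw [div_le_one hD] at h6
  unfold Dk at h6
  have h7 : T.filter (fun u => cl u i = cl t i) = T :=
    Finset.eq_of_subset_of_card_le (Finset.filter_subset _ _) (by exact_mod_cast h6)
  refine ⟨i, hi, cl t i, fun v hv => ?_⟩
  rw [← h7] at hv
  exact (Finset.mem_filter.1 hv).2

lemma MM.layer (h : MM n cl ly S T) {i : Fin d} (hi : i ∈ S) (s : ZMod n) :
    MM n cl ly (S.erase i) (T.filter (fun t => ly t i = s)) := by
  intro φ c hc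
  have := h (fun k a r => if k = i then (if r = s then 1 else 0) else φ k a r)
    (fun k => if k = i then 1 else c k) (by
      intro k hk a
      by_cases hki : k = i
      · simp [hki]
      · simpa [hki] using hc k (Finset.mem_erase.2 ⟨hki, hk⟩) a)
  rw [← Finset.mul_prod_erase S _ hi] at this
  simp only [if_true, one_mul] at this
  rw [Finset.prod_congr rfl (g := c) (fun k hk => if_neg (Finset.ne_of_mem_erase hk))] at this
  rw [← this, Finset.sum_filter]
  refine Finset.sum_congr rfl fun t _ => ?_
  rw [← Finset.mul_prod_erase S _ hi]
  rw [Finset.prod_congr (s₁ := S.erase i) rfl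
    (g := fun k => φ k (cl t k) (ly t k)) (fun k hk => if_neg (Finset.ne_of_mem_erase hk))]
  simp

lemma layer_image (i k : Fin d) : T.image (fun t => cl t k) =
    Finset.univ.biUnion (fun s : ZMod n =>
      (T.filter (fun t => ly t i = s)).image (fun t => cl t k)) := by
  ext a
  simp

lemma NC_split {i : Fin d} (hi : i ∈ S) {a : A} (hT : T.Nonempty) (ha : ∀ t ∈ T, cl t i = a) :
    NC cl S T = 1 + NC cl (S.erase i) T := by
  unfold NC
  rw [← Finset.add_sum_erase S _ hi]
  congr 1
  rw [Finset.card_eq_one]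
  refine ⟨a, ?_⟩
  ext b
  simp only [Finset.mem_image, Finset.mem_singleton]
  constructor
  · rintro ⟨t, ht, rfl⟩; exact ha t ht
  · rintro rfl
    obtain ⟨t, ht⟩ := hT
    exact ⟨t, ht, ha t ht⟩

lemma NC_le (i : Fin d) (S' : Finset (Fin d)) :
    NC cl S' T ≤ ∑ s : ZMod n, NC cl S' (T.filter (fun t => ly t i = s)) := by
  unfold NC
  rw [Finset.sum_comm]
  refine Finset.sum_le_sum fun k _ => ?_
  rw [layer_image (ly := ly) i k]
  exact Finset.card_biUnion_le

lemma card_biUnion_eq_iff {σ β : Type*} (s : Finset σ) (f : σ → Finset β) :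
    (s.biUnion f).card = ∑ x ∈ s, (f x).card ↔ (s : Set σ).PairwiseDisjoint f := by
  constructor
  · intro h
    have e : s.biUnion f = (s.sigma f).image Sigma.snd := by
      ext b; simp
    rw [e, ← Finset.card_sigma, Finset.card_image_iff] at h
    intro x hx y hy hxy
    refine Finset.disjoint_left.2 fun b hb hb' => hxy ?_
    have h1 : (⟨x, b⟩ : Sigma fun _ : σ => β) ∈ ((s.sigma f : Finset _) : Set _) :=
      Finset.mem_coe.2 (Finset.mem_sigma.2 ⟨hx, hb⟩)
    have h2 : (⟨y, b⟩ : Sigma fun _ : σ => β) ∈ ((s.sigma f : Finset _) : Set _) :=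
      Finset.mem_coe.2 (Finset.mem_sigma.2 ⟨hy, hb'⟩)
    have := h h1 h2 rfl
    exact congrArg Sigma.fst this
  · exact Finset.card_biUnion

lemma NC_eq_iff (i : Fin d) (S' : Finset (Fin d)) :
    NC cl S' T = ∑ s : ZMod n, NC cl S' (T.filter (fun t => ly t i = s)) ↔
    ∀ k ∈ S', ∀ t ∈ T, ∀ u ∈ T, cl t k = cl u k → ly t i = ly u i := by
  unfold NC
  rw [Finset.sum_comm]
  rw [Finset.sum_eq_sum_iff_of_le (fun k _ => by
    rw [layer_image (ly := ly) i k]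
    exact Finset.card_biUnion_le)]
  refine forall₂_congr fun k _ => ?_
  rw [layer_image (ly := ly) i k, card_biUnion_eq_iff]
  constructor
  · intro h t ht u hu he
    by_contra hne
    have := h (Finset.mem_coe.2 (Finset.mem_univ (ly t i)))
      (Finset.mem_coe.2 (Finset.mem_univ (ly u i))) hne
    have h1 : cl t k ∈ (T.filter (fun v => ly v i = ly t i)).image (fun t => cl t k) :=
      Finset.mem_image.2 ⟨t, by simp [ht], rfl⟩
    have h2 : cl t k ∈ (T.filter (fun v => ly v i = ly u i)).image (fun t => cl t k) :=
      Finset.mem_image.2 ⟨u, by simp [hu], he.symm⟩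
    exact Finset.disjoint_left.1 this h1 h2
  · intro h s _ r _ hsr
    refine Finset.disjoint_left.2 ?_
    intro a ha hb
    simp only [Finset.mem_image, Finset.mem_filter] at ha hb
    obtain ⟨t, ⟨ht, rfl⟩, rfl⟩ := ha
    obtain ⟨u, ⟨hu, rfl⟩, he⟩ := hb
    exact hsr (h t ht u hu he.symm)

lemma MM.equality_iff (hn : 2 ≤ n) (h : MM n cl ly S T) {i : Fin d} (hi : i ∈ S) {a : A}
    (ha : ∀ t ∈ T, cl t i = a) :
    (n - 1) * NC cl S T + 1 = n ^ S.card ↔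
    (∀ s : ZMod n, (n - 1) * NC cl (S.erase i) (T.filter (fun t => ly t i = s)) + 1 =
      n ^ (S.erase i).card) ∧
    ∀ k ∈ S.erase i, ∀ t ∈ T, ∀ u ∈ T, cl t k = cl u k → ly t i = ly u i := by
  rw [← NC_eq_iff, NC_split hi (Finset.card_pos.1 h.card_pos) ha]
  have hb : ∀ s ∈ (Finset.univ : Finset (ZMod n)),
      (n - 1) * NC cl (S.erase i) (T.filter (fun t => ly t i = s)) + 1 ≤
      n ^ (S.erase i).card := fun s _ => (h.layer hi s).bound
  have hle := NC_le (cl := cl) (ly := ly) (T := T) i (S.erase i)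
  have hsum := Finset.sum_le_sum hb
  have hiff := Finset.sum_eq_sum_iff_of_le hb
  have hc : S.card = (S.erase i).card + 1 := (Finset.card_erase_add_one hi).symm
  rw [hc, pow_succ]
  simp only [Finset.mem_univ, true_imp_iff] at hiff
  rw [← hiff]
  simp only [Finset.sum_add_distrib, ← Finset.mul_sum, Finset.sum_const, Finset.card_univ,
    ZMod.card, smul_eq_mul, mul_one] at hsum ⊢
  obtain ⟨m, rfl⟩ : ∃ m, n = m + 2 := ⟨n - 2, by omega⟩
  simp only [show m + 2 - 1 = m + 1 by omega] at *
  rw [mul_comm ((m + 2) ^ (S.erase i).card)]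
  generalize (m + 2) * (m + 2) ^ (S.erase i).card = Q at *
  generalize ∑ s : ZMod (m + 2), NC cl (S.erase i) (T.filter (fun t => ly t i = s)) = B at *
  generalize NC cl (S.erase i) T = C at *
  constructor
  · intro hh
    have : B ≤ C := by
      by_contra hcon
      have : (m + 1) * (C + 1) ≤ (m + 1) * B := Nat.mul_le_mul_left _ (by omega)
      nlinarith
    have : C = B := le_antisymm hle this
    subst this
    exact ⟨by linarith, rfl⟩
  · rintro ⟨h1, rfl⟩
    linarith

end Abstract
/-! ### Segments -/

lemma amod_lt_one_iff {n : ℕ} (hn : 2 ≤ n) (r : ℝ) :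
    amod r n < 1 ↔ ((⌊r⌋ : ℤ) : ZMod n) = 0 := by
  have hn0 : (0 : ℝ) < n := by positivity
  rw [ZMod.intCast_zmod_eq_zero_iff_dvd]
  unfold amod
  constructor
  · intro h
    refine ⟨⌊r / n⌋, ?_⟩
    rw [Int.floor_eq_iff]
    have h1 := Int.floor_le (r / n)
    rw [le_div_iff₀ hn0] at h1
    push_cast
    constructor <;> linarith
  · rintro ⟨q, hq⟩
    have h1 := Int.floor_le r
    have h2 := Int.lt_floor_add_one r
    have h3 : ⌊r / n⌋ = q := by
      rw [Int.floor_eq_iff, le_div_iff₀ hn0, div_lt_iff₀ hn0]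
      rw [hq] at h1 h2
      push_cast at h1 h2
      have : (2 : ℝ) ≤ n := by exact_mod_cast hn
      constructor
      · linarith
      · nlinarith
    rw [h3]
    rw [hq] at h2
    push_cast at h2
    linarith

lemma mem_segPart {n : ℕ} (hn : 2 ≤ n) (c : ℝ) (x : ↥(Set.Ico (0 : ℝ) (n : ℝ))) :
    x ∈ segPart n c ↔ ((⌊(x : ℝ) - Int.fract c⌋ : ℤ) : ZMod n) = ((⌊c⌋ : ℤ) : ZMod n) := by
  unfold segPart
  rw [Set.mem_ofPred_eq, amod_lt_one_iff hn]
  have : (x : ℝ) - c = ((x : ℝ) - Int.fract c) - (⌊c⌋ : ℤ) := by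
    rw [← Int.self_sub_floor]; ring
  rw [this, Int.floor_sub_intCast, Int.cast_sub, sub_eq_zero]

lemma exists_rep {n : ℕ} (hn : 2 ≤ n) (p : ℝ) : ∃ x : ↥(Set.Ico (0 : ℝ) (n : ℝ)),
    ∀ a : ℝ, ((⌊(x : ℝ) - a⌋ : ℤ) : ZMod n) = ((⌊p - a⌋ : ℤ) : ZMod n) := by
  have hn0 : (0 : ℝ) < n := by positivity
  have h1 := Int.floor_le (p / n)
  have h2 := Int.lt_floor_add_one (p / n)
  rw [le_div_iff₀ hn0] at h1
  rw [div_lt_iff₀ hn0] at h2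
  refine ⟨⟨p - n * ⌊p / n⌋, by constructor <;> linarith⟩, fun a => ?_⟩
  have : (p - n * ⌊p / n⌋ : ℝ) - a = (p - a) - ((n * ⌊p / n⌋ : ℤ) : ℝ) := by push_cast; ring
  simp only []
  rw [this, Int.floor_sub_intCast]
  simp

lemma segPart_eq_iff {n : ℕ} (hn : 2 ≤ n) (c e : ℝ) : segPart n c = segPart n e ↔
    Int.fract c = Int.fract e ∧ ((⌊c⌋ : ℤ) : ZMod n) = ((⌊e⌋ : ℤ) : ZMod n) := by
  constructor
  · intro h
    have key : ∀ c e : ℝ, segPart n c = segPart n e → ((⌊c - e⌋ : ℤ) : ZMod n) = 0 := by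
      intro c e h
      obtain ⟨x, hx⟩ := exists_rep hn c
      have h1 : x ∈ segPart n c := by
        rw [mem_segPart hn, hx]
        simp [Int.self_sub_fract]
      rw [h, mem_segPart hn, hx] at h1
      have : c - e = (c - Int.fract e) - (⌊e⌋ : ℤ) := by
        rw [← Int.self_sub_floor]; ring
      rw [this, Int.floor_sub_intCast, Int.cast_sub, sub_eq_zero, h1]
    have h1 := key c e h
    have h2 := key e c h.symm
    have hf : Int.fract c = Int.fract e := by
      by_contra hne
      have h3 : ⌊e - c⌋ = -⌊c - e⌋ - 1 := by
        have ha := Int.floor_le (c - e)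
        have hb := Int.lt_floor_add_one (c - e)
        rw [Int.floor_eq_iff]
        push_cast
        refine ⟨by linarith, ?_⟩
        have : (⌊c - e⌋ : ℝ) ≠ c - e := by
          intro hh
          apply hne
          rw [Int.fract_eq_fract]
          exact ⟨_, hh.symm⟩
        have := lt_of_le_of_ne ha this
        linarith
      rw [h3] at h2
      push_cast at h2
      rw [h1] at h2
      have : Fact (1 < n) := ⟨by omega⟩
      simp at h2
    refine ⟨hf, ?_⟩
    have : c - e = ((⌊c⌋ - ⌊e⌋ : ℤ) : ℝ) := by
      have := Int.floor_add_fract c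
      have := Int.floor_add_fract e
      push_cast
      linarith
    rw [this, Int.floor_intCast, Int.cast_sub, sub_eq_zero] at h1
    exact h1
  · rintro ⟨h1, h2⟩
    ext x
    rw [mem_segPart hn, mem_segPart hn, h1, h2]

lemma segPart_nonempty {n : ℕ} (hn : 2 ≤ n) (c : ℝ) : (segPart n c).Nonempty := by
  obtain ⟨x, hx⟩ := exists_rep hn c
  refine ⟨x, ?_⟩
  rw [mem_segPart hn, hx]
  simp [Int.self_sub_fract]

lemma exists_not_mem_segPart {n : ℕ} (hn : 2 ≤ n) (c : ℝ) : ∃ x, x ∉ segPart n c := by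
  obtain ⟨x, hx⟩ := exists_rep hn (c + 1)
  refine ⟨x, ?_⟩
  rw [mem_segPart hn, hx]
  have : Fact (1 < n) := ⟨by omega⟩
  have : c + 1 - Int.fract c = ((⌊c⌋ + 1 : ℤ) : ℝ) := by
    rw [← Int.self_sub_floor]; push_cast; ring
  rw [this, Int.floor_intCast]
  simp

lemma segPart_mem_segPartition {n : ℕ} (hn : 2 ≤ n) (c : ℝ) {a : ℝ} (ha : a ∈ Set.Ico (0 : ℝ) 1) :
    segPart n c ∈ segPartition n a ↔ Int.fract c = a := by
  have hfa : Int.fract a = a := Int.fract_eq_self.2 ha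
  have hfl : ⌊a⌋ = 0 := Int.floor_eq_zero_iff.2 ha
  have : NeZero n := ⟨by omega⟩
  constructor
  · rintro ⟨k, _, hk⟩
    rw [segPart_eq_iff hn] at hk
    rw [hk.1, Int.fract_add_natCast, hfa]
  · intro h
    refine ⟨((⌊c⌋ : ℤ) : ZMod n).val, ZMod.val_lt _, ?_⟩
    rw [segPart_eq_iff hn, Int.fract_add_natCast, hfa, Int.floor_add_natCast, hfl]
    simp [h]

lemma segPartition_ne {n : ℕ} (hn : 2 ≤ n) (a : ℝ) : segPartition n a ≠ {Set.univ} := by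
  intro h
  have : segPart n (a + (0 : ℕ)) ∈ segPartition n a := ⟨0, by omega, rfl⟩
  rw [h] at this
  obtain ⟨x, hx⟩ := exists_not_mem_segPart hn (a + (0 : ℕ))
  rw [Set.mem_singleton_iff.1 this] at hx
  exact hx trivial

lemma mem_segSystem (n : ℕ) {a : ℝ} (ha : a ∈ Set.Ico (0 : ℝ) 1) :
    segPartition n a ∈ segSystem n := Or.inr ⟨a, ha, rfl⟩

lemma exists_of_mem_segSystem {n : ℕ} {π} (h : π ∈ segSystem n) (hne : π ≠ {Set.univ}) :
    ∃ a ∈ Set.Ico (0 : ℝ) 1, π = segPartition n a := by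
  rcases h with h | h
  · exact absurd h hne
  · exact h

lemma fract_mem (c : ℝ) : Int.fract c ∈ Set.Ico (0 : ℝ) 1 :=
  ⟨Int.fract_nonneg c, Int.fract_lt_one c⟩

/-! ### From cube tilings to the multilinear property -/

/-- class of a tile -/
noncomputable def rcl {d : ℕ} (t : Fin d → ℝ) (k : Fin d) : ℝ := Int.fract (t k)

/-- layer of a tile -/
noncomputable def rly {d : ℕ} (n : ℕ) (t : Fin d → ℝ) (k : Fin d) : ZMod n := ((⌊t k⌋ : ℤ) : ZMod n)

section OneDim

open Classical

variable {ι : Type*} {n : ℕ} [NeZero n]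

lemma exists_eps (F : Finset ℝ) (hF : ∀ y ∈ F, 0 < y) : ∃ ε : ℝ, 0 < ε ∧ ε ≤ 1 ∧ ∀ y ∈ F, ε ≤ y := by
  induction F using Finset.induction_on with
  | empty => exact ⟨1, by norm_num, le_rfl, by simp⟩
  | insert y F _ ih =>
    obtain ⟨ε, h0, h1, h2⟩ := ih (fun z hz => hF z (Finset.mem_insert_of_mem hz))
    refine ⟨min ε y, lt_min h0 (hF y (Finset.mem_insert_self _ _)), (min_le_left _ _).trans h1, ?_⟩
    intro z hz
    rcases Finset.mem_insert.1 hz with rfl | hz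
    · exact min_le_right _ _
    · exact (min_le_left _ _).trans (h2 z hz)

lemma jump (T : Finset ι) (cl : ι → ℝ) (ly : ι → ZMod n) (w : ι → ℝ) (C : ℝ)
    (hcl : ∀ t, cl t ∈ Set.Ico (0 : ℝ) 1)
    (h : ∀ p : ℝ, ∑ t ∈ T, (if ((⌊p - cl t⌋ : ℤ) : ZMod n) = ly t then 1 else 0) * w t = C)
    (a : ℝ) (ha : a ∈ Set.Ico (0 : ℝ) 1) (s : ZMod n) :
    ∑ t ∈ T, (if cl t = a ∧ ly t = s + 1 then w t else 0) =
      ∑ t ∈ T, (if cl t = a ∧ ly t = s then w t else 0) := by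
  obtain ⟨ε, h0, h1, h2⟩ := exists_eps (((T.image cl).erase a).image (fun b => Int.fract (a - b)))
    (by
      intro y hy
      simp only [Finset.mem_image, Finset.mem_erase] at hy
      obtain ⟨b, ⟨hb, t, ht, rfl⟩, rfl⟩ := hy
      have hb' := hcl t
      refine lt_of_le_of_ne (Int.fract_nonneg _) fun hh => hb ?_
      obtain ⟨z, hz⟩ := Int.fract_eq_zero_iff.1 hh.symm
      have e1 : (z : ℝ) < 1 := by linarith [ha.2, hb'.1]
      have e2 : (-1 : ℝ) < z := by linarith [ha.1, hb'.2]
      have e3 : z < 1 := by exact_mod_cast e1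
      have e4 : -1 < z := by exact_mod_cast e2
      have : z = 0 := by omega
      rw [this] at hz
      push_cast at hz
      linarith)
  obtain ⟨m, hm⟩ := ZMod.intCast_surjective (n := n) (s + 1)
  have hd := (h (a + m)).trans (h (a - ε + m)).symm
  rw [← sub_eq_zero, ← Finset.sum_sub_distrib] at hd ⊢
  refine Eq.trans ?_ hd
  refine Finset.sum_congr rfl fun t ht => ?_
  by_cases hc : cl t = a
  · have e1 : ⌊a + (m : ℝ) - cl t⌋ = m := by
      rw [hc, add_sub_cancel_left, Int.floor_intCast]
    have e2 : ⌊a - ε + (m : ℝ) - cl t⌋ = m - 1 := by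
      rw [hc, Int.floor_eq_iff]
      push_cast
      constructor <;> linarith
    rw [e1, e2]
    push_cast
    rw [hm]
    simp only [hc, true_and, add_sub_cancel_right, eq_comm (a := ly t), ite_mul, one_mul, zero_mul]
  · have e1 : ⌊a + (m : ℝ) - cl t⌋ = ⌊a - ε + (m : ℝ) - cl t⌋ := by
      have hε := h2 (Int.fract (a - cl t)) (Finset.mem_image_of_mem _
        (Finset.mem_erase.2 ⟨hc, Finset.mem_image_of_mem _ ht⟩))
      have : a + (m : ℝ) - cl t = (a - cl t) + (m : ℤ) := by ring
      rw [this, Int.floor_add_intCast]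
      have : a - ε + (m : ℝ) - cl t = (a - cl t - ε) + (m : ℤ) := by ring
      rw [this, Int.floor_add_intCast]
      congr 1
      symm
      rw [Int.floor_eq_iff]
      have := Int.floor_add_fract (a - cl t)
      have := Int.fract_lt_one (a - cl t)
      constructor <;> linarith
    rw [e1]
    simp [hc]

lemma oneDim (T : Finset ι) (cl : ι → ℝ) (ly : ι → ZMod n) (w : ι → ℝ) (C : ℝ)
    (hcl : ∀ t, cl t ∈ Set.Ico (0 : ℝ) 1)
    (h : ∀ p : ℝ, ∑ t ∈ T, (if ((⌊p - cl t⌋ : ℤ) : ZMod n) = ly t then 1 else 0) * w t = C)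
    (φ : ℝ → ZMod n → ℝ) (c : ℝ) (hφ : ∀ a, ∑ s, φ a s = c) :
    ∑ t ∈ T, φ (cl t) (ly t) * w t = c * C := by
  set G : ℝ → ZMod n → ℝ := fun a s => ∑ t ∈ T, (if cl t = a ∧ ly t = s then w t else 0) with hG
  have hconst : ∀ a ∈ T.image cl, ∀ s, G a s = G a 0 := by
    intro a ha s
    obtain ⟨t, _, rfl⟩ := Finset.mem_image.1 ha
    obtain ⟨m, rfl⟩ := ZMod.natCast_zmod_surjective s
    induction m with
    | zero => simp
    | succ m ih =>
      rw [← ih]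
      push_cast
      exact jump T cl ly w C hcl h _ (hcl t) m
  have key : ∀ (ψ : ℝ → ZMod n → ℝ) (e : ℝ), (∀ a, ∑ s, ψ a s = e) →
      ∑ t ∈ T, ψ (cl t) (ly t) * w t = e * ∑ a ∈ T.image cl, G a 0 := by
    intro ψ e hψ
    have e1 : ∀ t ∈ T, ψ (cl t) (ly t) * w t =
        ∑ a ∈ T.image cl, ∑ s, ψ a s * (if cl t = a ∧ ly t = s then w t else 0) := by
      intro t ht
      rw [Finset.sum_eq_single (cl t), Finset.sum_eq_single (ly t)]
      · simp
      · intro s _ hs; simp [hs.symm]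
      · simp
      · intro a _ ha; simp [ha.symm]
      · intro hh; exact absurd (Finset.mem_image_of_mem _ ht) hh
    rw [Finset.sum_congr rfl e1, Finset.sum_comm, Finset.mul_sum]
    refine Finset.sum_congr rfl fun a ha => ?_
    rw [Finset.sum_comm, ← hψ a, Finset.sum_mul]
    refine Finset.sum_congr rfl fun s _ => ?_
    rw [← Finset.mul_sum, ← hconst a ha s]
  rw [key φ c hφ]
  have := key (fun a s => if ((⌊(0:ℝ) - a⌋ : ℤ) : ZMod n) = s then 1 else 0) 1 (by intro a; simp)
  rw [h 0, one_mul] at this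
  rw [this]

end OneDim

section Tiling

open Classical

lemma cover_unique {d n : ℕ} (hn : 2 ≤ n) {T : Set (Fin d → ℝ)}
    (hT : IsCubeTiling (fun _ : Fin d => n) T) (p : Fin d → ℝ) :
    ∃! t, t ∈ T ∧ ∀ k, ((⌊p k - rcl t k⌋ : ℤ) : ZMod n) = rly n t k := by
  choose x hx using fun k => exists_rep hn (p k)
  have hmem : ∀ t : Fin d → ℝ, (fun k => (x k : ℝ)) ∈ cube (fun _ => n) t ↔
      ∀ k, ((⌊p k - rcl t k⌋ : ℤ) : ZMod n) = rly n t k := by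
    intro t
    have : ∀ k, ((⌊p k - rcl t k⌋ : ℤ) : ZMod n) = rly n t k ↔ x k ∈ segPart n (t k) := by
      intro k
      rw [mem_segPart hn, hx]; rfl
    simp only [this]
    constructor
    · exact fun h k => h.2 k
    · exact fun h => ⟨fun k => (x k).2, fun k => h k⟩
  have hxt : (fun k => (x k : ℝ)) ∈ torus (fun _ : Fin d => n) := fun k => (x k).2
  rw [← hT.2.2] at hxt
  simp only [Set.mem_iUnion] at hxt
  obtain ⟨t, ht, hc⟩ := hxt
  refine ⟨t, ⟨ht, (hmem t).1 hc⟩, ?_⟩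
  rintro u ⟨hu, hcu⟩
  by_contra hne
  exact Set.disjoint_left.1 (hT.2.1 u hu t ht hne) ((hmem u).2 hcu) hc

lemma tiling_finite {d n : ℕ} (hn : 2 ≤ n) {T : Set (Fin d → ℝ)}
    (hT : IsCubeTiling (fun _ : Fin d => n) T) : T.Finite := by
  have : NeZero n := ⟨by omega⟩
  have hu := fun z : Fin d → ZMod n => cover_unique hn hT (fun k => (((z k).val : ℤ) : ℝ))
  choose f hf hf' using hu
  refine (Set.finite_range f).subset ?_
  intro t ht
  refine ⟨fun k => ((⌈t k⌉ : ℤ) : ZMod n), ?_⟩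
  refine (hf' _ t ⟨ht, fun k => ?_⟩).symm
  rw [sub_eq_add_neg, Int.floor_intCast_add]
  push_cast
  rw [ZMod.natCast_val, ZMod.cast_id]
  unfold rcl rly
  rw [← Int.cast_add]
  congr 1
  rw [Int.floor_neg]
  have h1 : ⌈t k⌉ = ⌊t k⌋ + ⌈Int.fract (t k)⌉ := by
    conv_lhs => rw [← Int.floor_add_fract (t k), Int.ceil_intCast_add]
  omega

lemma tiling_MM {d n : ℕ} [NeZero n] (hn : 2 ≤ n) {T : Finset (Fin d → ℝ)}
    (hT : IsCubeTiling (fun _ : Fin d => n) (T : Set (Fin d → ℝ))) :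
    MM n rcl (rly n) Finset.univ T := by
  have key : ∀ S : Finset (Fin d), ∀ (φ : Fin d → ℝ → ZMod n → ℝ) (c : Fin d → ℝ),
      (∀ k ∈ S, ∀ a, ∑ s, φ k a s = c k) →
      (∀ k, k ∉ S → c k = 1 ∧ ∃ p : ℝ, φ k = fun a s =>
        if ((⌊p - a⌋ : ℤ) : ZMod n) = s then 1 else 0) →
      ∑ t ∈ T, ∏ k, φ k (rcl t k) (rly n t k) = ∏ k, c k := by
    intro S
    induction S using Finset.induction_on with
    | empty =>
      intro φ c _ h
      simp only [Finset.notMem_empty, not_false_eq_true, true_imp_iff] at h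
      choose hc p hp using h
      simp only [hp, hc, Finset.prod_const_one]
      obtain ⟨t, ⟨ht, hm⟩, hu⟩ := cover_unique hn hT p
      rw [Finset.sum_eq_single t]
      · simp [hm]
      · intro u hu' hne
        rw [Finset.prod_eq_zero_iff]
        by_contra hcon
        apply hne
        apply hu
        refine ⟨hu', fun k => ?_⟩
        by_contra hk
        exact hcon ⟨k, Finset.mem_univ _, by simp [hk]⟩
      · intro hh; exact absurd ht hh
    | insert i S hi ih =>
      intro φ c hc h
      have := oneDim T (fun t => rcl t i) (fun t => rly n t i)
        (fun t => ∏ k ∈ Finset.univ.erase i, φ k (rcl t k) (rly n t k))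
        (∏ k ∈ Finset.univ.erase i, c k) (fun t => fract_mem _) (by
          intro p
          have := ih (Function.update φ i (fun a s =>
            if ((⌊p - a⌋ : ℤ) : ZMod n) = s then 1 else 0)) (Function.update c i 1) (by
              intro k hk a
              have hki : k ≠ i := by rintro rfl; exact hi hk
              simp only [Function.update_of_ne hki]
              exact hc k (Finset.mem_insert_of_mem hk) a) (by
              intro k hk
              by_cases hki : k = i
              · subst hki
                simp only [Function.update_self]
                exact ⟨trivial, p, rfl⟩
              · simp only [Function.update_of_ne hki]
                exact h k (by simp [hki, hk]))
          rw [← Finset.mul_prod_erase Finset.univ _ (Finset.mem_univ i), Function.update_self,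
            one_mul, Finset.prod_congr (s₁ := Finset.univ.erase i) (g := c) rfl
              (fun k hk => Function.update_of_ne (Finset.ne_of_mem_erase hk) _ _)] at this
          rw [← this]
          refine Finset.sum_congr rfl fun t _ => ?_
          rw [← Finset.mul_prod_erase Finset.univ _ (Finset.mem_univ i), Function.update_self]
          congr 1
          refine Finset.prod_congr rfl fun k hk => ?_
          rw [Function.update_of_ne (Finset.ne_of_mem_erase hk)])
        (φ i) (c i) (hc i (Finset.mem_insert_self _ _))
      rw [← Finset.mul_prod_erase Finset.univ c (Finset.mem_univ i), ← this]
      refine Finset.sum_congr rfl fun t _ => ?_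
      rw [← Finset.mul_prod_erase Finset.univ _ (Finset.mem_univ i)]
  intro φ c hc
  exact key Finset.univ φ c hc (by simp)

end Tiling
/-! ### Families of boxes -/

section Boxes

open Classical

/-- The box of a tile. -/
def bx {d : ℕ} (n : ℕ) (t : Fin d → ℝ) :
    ∀ i : Fin d, Set ((fun _ : Fin d => ↥(Set.Ico (0 : ℝ) (n : ℝ))) i) :=
  fun i => segPart n (t i)

/-- The box system. -/
def PP (d n : ℕ) : ∀ i : Fin d,
    Set (Set (Set ((fun _ : Fin d => ↥(Set.Ico (0 : ℝ) (n : ℝ))) i))) :=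
  fun _ => segSystem n

/-- Tilings of a face in the directions `S`. -/
def Face {d : ℕ} (n : ℕ) [NeZero n] (S : Finset (Fin d)) (T : Finset (Fin d → ℝ)) : Prop :=
  MM n rcl (rly n) S T ∧
    ∀ t ∈ T, ∀ u ∈ T, ∀ k, k ∉ S → rcl t k = rcl u k ∧ rly n t k = rly n u k

variable {d n : ℕ} [NeZero n] {S : Finset (Fin d)} {T : Finset (Fin d → ℝ)}

lemma bx_isBox (hn : 2 ≤ n) (t : Fin d → ℝ) : IsBox (PP d n) (bx n t) := fun k =>
  ⟨segPartition n (rcl t k), mem_segSystem n (fract_mem _),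
    (segPart_mem_segPartition hn _ (fract_mem _)).2 rfl⟩

lemma bx_apply_eq_iff (hn : 2 ≤ n) (t u : Fin d → ℝ) (k : Fin d) :
    bx n t k = bx n u k ↔ rcl t k = rcl u k ∧ rly n t k = rly n u k :=
  segPart_eq_iff hn _ _

lemma mem_bx (hn : 2 ≤ n) (t : Fin d → ℝ)
    (x : ∀ i : Fin d, (fun _ : Fin d => ↥(Set.Ico (0 : ℝ) (n : ℝ))) i) :
    x ∈ boxSet (bx n t) ↔ ∀ k, ((⌊(x k : ℝ) - rcl t k⌋ : ℤ) : ZMod n) = rly n t k := by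
  unfold boxSet
  simp only [Set.mem_pi, Set.mem_univ, true_imp_iff]
  exact forall_congr' fun k => mem_segPart hn _ _

lemma Face.bx_inj (hn : 2 ≤ n) (h : Face n S T) {t u : Fin d → ℝ} (ht : t ∈ T) (hu : u ∈ T)
    (he : bx n t = bx n u) : t = u := by
  by_contra hne
  obtain ⟨k, _, _, h2⟩ := h.1.keller ht hu hne
  exact h2 ((bx_apply_eq_iff hn t u k).1 (congrFun he k)).2

lemma Face.kellerFam (hn : 2 ≤ n) (h : Face n S T) {U : Set (Fin d → ℝ)}
    (hU : ∀ t ∈ U, t ∈ T) (hne : U.Nonempty) : IsKellerFamily (PP d n) (bx n '' U) := by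
  refine ⟨hne.image _, ?_, ?_⟩
  · rintro _ ⟨t, _, rfl⟩
    exact bx_isBox hn t
  · rintro _ ⟨t, ht, rfl⟩ _ ⟨u, hu, rfl⟩ hne
    obtain ⟨k, _, h1, h2⟩ := h.1.keller (hU t ht) (hU u hu) (fun hh => hne (by rw [hh]))
    refine ⟨k, segPartition n (rcl t k), mem_segSystem n (fract_mem _),
      (segPart_mem_segPartition hn _ (fract_mem _)).2 rfl,
      (segPart_mem_segPartition hn _ (fract_mem _)).2 h1.symm, fun hh => h2 ?_⟩
    exact ((bx_apply_eq_iff hn t u k).1 hh).2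

lemma restrict_image (U : Set (Fin d → ℝ)) (i : Fin d)
    (V : Set (Set ↥(Set.Ico (0 : ℝ) (n : ℝ)))) :
    restrictFam (bx n '' U) i V = bx n '' {t ∈ U | segPart n (t i) ∈ V} := by
  ext K
  constructor
  · rintro ⟨⟨t, ht, rfl⟩, hV⟩
    exact ⟨t, ⟨ht, hV⟩, rfl⟩
  · rintro ⟨t, ⟨ht, hV⟩, rfl⟩
    exact ⟨⟨t, ht, rfl⟩, hV⟩

lemma mem_polyUnion (U : Set (Fin d → ℝ))
    (x : ∀ i : Fin d, (fun _ : Fin d => ↥(Set.Ico (0 : ℝ) (n : ℝ))) i) :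
    x ∈ polyUnion (bx n '' U) ↔ ∃ t ∈ U, x ∈ boxSet (bx n t) := by
  unfold polyUnion
  simp

lemma restrict_layer (hn : 2 ≤ n) {i : Fin d} {c : ℝ} (hT : ∀ t ∈ T, rcl t i = Int.fract c) :
    restrictFam (bx n '' (T : Set (Fin d → ℝ))) i {segPart n c} =
      bx n '' ((T.filter (fun t => rly n t i = ((⌊c⌋ : ℤ) : ZMod n)) : Finset (Fin d → ℝ)) :
        Set (Fin d → ℝ)) := by
  rw [restrict_image]
  congr 1
  ext t
  simp only [Set.mem_singleton_iff, Finset.coe_filter]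
  refine and_congr_right fun ht => ?_
  rw [segPart_eq_iff hn]
  exact ⟨fun h => h.2, fun h => ⟨hT t ht, h⟩⟩

lemma Face.layer (h : Face n S T) {i : Fin d} (hi : i ∈ S) {a : ℝ} (ha : ∀ t ∈ T, rcl t i = a)
    (s : ZMod n) : Face n (S.erase i) (T.filter (fun t => rly n t i = s)) := by
  refine ⟨h.1.layer hi s, ?_⟩
  intro t ht u hu k hk
  rw [Finset.mem_filter] at ht hu
  by_cases hki : k = i
  · subst hki
    exact ⟨(ha t ht.1).trans (ha u hu.1).symm, ht.2.trans hu.2.symm⟩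
  · exact h.2 t ht.1 u hu.1 k (fun hh => hk (Finset.mem_erase.2 ⟨hki, hh⟩))

lemma Face.mem_of_match (hn : 2 ≤ n) (h : Face n S T) {t u : Fin d → ℝ} (ht : t ∈ T) (hu : u ∈ T)
    {x y : ∀ i : Fin d, (fun _ : Fin d => ↥(Set.Ico (0 : ℝ) (n : ℝ))) i}
    (hx : x ∈ boxSet (bx n t)) (hxy : ∀ k, k ∉ S → y k = x k)
    (hm : ∀ k ∈ S, ((⌊(y k : ℝ) - rcl u k⌋ : ℤ) : ZMod n) = rly n u k) :
    y ∈ boxSet (bx n u) := by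
  rw [mem_bx hn] at hx ⊢
  intro k
  by_cases hk : k ∈ S
  · exact hm k hk
  · rw [hxy k hk, ← (h.2 t ht u hu k hk).1, ← (h.2 t ht u hu k hk).2]
    exact hx k

lemma Face.cyl (hn : 2 ≤ n) (h : Face n S T) {i : Fin d} (hi : i ∈ S) :
    IsCylinder i (polyUnion (bx n '' (T : Set (Fin d → ℝ)))) := by
  intro x hx y
  rw [mem_polyUnion] at hx ⊢
  obtain ⟨t, ht, hx⟩ := hx
  obtain ⟨u, hu, hm⟩ := h.1.exists_match
    (fun k a => ((⌊((Function.update x i y k : ↥(Set.Ico (0 : ℝ) (n : ℝ))) : ℝ) - a⌋ : ℤ) : ZMod n))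
  refine ⟨u, hu, h.mem_of_match hn ht hu hx ?_ hm⟩
  intro k hk
  exact Function.update_of_ne (fun hh => hk (by rw [hh]; exact hi)) _ _

lemma Face.hidden (hn : 2 ≤ n) (h : Face n S T) {k : Fin d} (hk : k ∈ S) {t : Fin d → ℝ}
    (ht : t ∈ T) : HiddenIn (PP d n) (bx n '' (T : Set (Fin d → ℝ))) k
      (segPartition n (rcl t k)) := by
  have hset : restrictFam (bx n '' (T : Set (Fin d → ℝ))) k (segPartition n (rcl t k)) =
      bx n '' {u | u ∈ T ∧ rcl u k = rcl t k} := by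
    rw [restrict_image]
    congr 1
    ext u
    exact and_congr_right fun _ => segPart_mem_segPartition hn _ (fract_mem _)
  refine ⟨mem_segSystem n (fract_mem _), segPartition_ne hn _, ?_, ?_⟩
  · rw [hset]
    exact h.kellerFam hn (fun u hu => hu.1) ⟨t, ht, rfl⟩
  · rw [hset]
    intro x hx y
    rw [mem_polyUnion] at hx ⊢
    obtain ⟨u, ⟨hu, huc⟩, hx⟩ := hx
    set x' : ∀ i : Fin d, (fun _ : Fin d => ↥(Set.Ico (0 : ℝ) (n : ℝ))) i :=
      Function.update x k y with hx'
    obtain ⟨v, hv, hm⟩ := h.1.exists_match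
      (fun l a => if a = rcl t k then ((⌊(x' l : ℝ) - a⌋ : ℤ) : ZMod n) else
        ((⌊(x l : ℝ) - a⌋ : ℤ) : ZMod n))
    have hne : ∀ l, l ≠ k → x' l = x l := fun l hl => Function.update_of_ne hl _ _
    have hxu := (mem_bx hn u x).1 hx
    have hvc : rcl v k = rcl t k := by
      by_contra hcon
      apply hcon
      have huv : u = v := by
        refine h.1.unique_match (fun l a => ((⌊(x l : ℝ) - a⌋ : ℤ) : ZMod n)) hu hv
          (fun l _ => hxu l) (fun l hl => ?_)
        have := hm l hl
        by_cases hlk : l = k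
        · subst hlk
          rw [if_neg hcon] at this
          exact this
        · rw [hne l hlk, ite_self] at this
          exact this
      rw [← huv, huc]
    refine ⟨v, ⟨hv, hvc⟩, h.mem_of_match hn hu hv hx (fun l hl => hne l ?_) (fun l hl => ?_)⟩
    · rintro rfl; exact hl hk
    · have := hm l hl
      by_cases hlk : l = k
      · subst hlk
        rw [if_pos hvc] at this
        exact this
      · rw [hne l hlk, ite_self] at this
        rw [hne l hlk]
        exact this

lemma Face.not_cyl (hn : 2 ≤ n) (h : Face n S T) {k : Fin d} (hk : k ∉ S) {U : Set (Fin d → ℝ)}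
    (hU : ∀ t ∈ U, t ∈ T) (hne : U.Nonempty) : ¬ IsCylinder k (polyUnion (bx n '' U)) := by
  intro hc
  obtain ⟨t, ht⟩ := hne
  choose x hx using fun i => segPart_nonempty hn (t i)
  obtain ⟨y, hy⟩ := exists_not_mem_segPart hn (t k)
  have h1 := hc x ((mem_polyUnion U x).2 ⟨t, ht, fun i _ => hx i⟩) y
  rw [mem_polyUnion] at h1
  obtain ⟨u, hu, h1⟩ := h1
  have h2 := h1 k trivial
  rw [Function.update_self, ← (bx_apply_eq_iff hn t u k).2 (h.2 t (hU t ht) u (hU u hu) k hk)] at h2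
  exact hy h2

theorem forward (hn : 2 ≤ n) : ∀ (m : ℕ) (S : Finset (Fin d)) (T : Finset (Fin d → ℝ)),
    S.card = m → Face n S T → (n - 1) * NC rcl S T + 1 = n ^ S.card →
    IsMultipile (PP d n) (bx n '' (T : Set (Fin d → ℝ))) := by
  intro m
  induction m with
  | zero =>
    intro S T hS h _
    have hc := h.1.card
    rw [hS, pow_zero, Finset.card_eq_one] at hc
    obtain ⟨t, rfl⟩ := hc
    rw [Finset.coe_singleton, Set.image_singleton]
    exact IsMultipile.single _ (bx_isBox hn t)
  | succ m ih =>
    intro S T hS h he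
    obtain ⟨i, hi, a, ha⟩ := h.1.exists_const hn (Finset.card_pos.1 (by omega)) he
    obtain ⟨t₀, ht₀⟩ := Finset.card_pos.1 h.1.card_pos
    have haI : a ∈ Set.Ico (0 : ℝ) 1 := by rw [← ha t₀ ht₀]; exact fract_mem _
    obtain ⟨he1, he2⟩ := (h.1.equality_iff hn hi ha).1 he
    have hfr : ∀ j : ℕ, Int.fract (a + (j : ℝ)) = a := fun j => by
      rw [Int.fract_add_natCast, Int.fract_eq_self.2 haI]
    have hres : ∀ j : ℕ, restrictFam (bx n '' (T : Set (Fin d → ℝ))) i {segPart n (a + (j : ℝ))} = _ :=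
      fun j => restrict_layer hn (fun t ht => (ha t ht).trans (hfr j).symm)
    refine IsMultipile.pile _ i (segPartition n a) (mem_segSystem n haI) (segPartition_ne hn a)
      (h.kellerFam hn (fun t ht => ht) ⟨t₀, ht₀⟩) ?_ (h.cyl hn hi) ?_ ?_
    · rw [restrict_image]
      congr 1
      ext t
      refine ⟨fun hh => hh.1, fun hh => ⟨hh, (segPart_mem_segPartition hn _ haI).2 (ha t hh)⟩⟩
    · rintro A ⟨j, _, rfl⟩
      rw [hres]
      exact ih _ _ (by rw [Finset.card_erase_of_mem hi]; omega) (h.layer hi ha _) (he1 _)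
    · rintro k hki A ⟨j, _, rfl⟩ B ⟨l, _, rfl⟩ hAB ρ ⟨h1, h2⟩
      rw [hres] at h1 h2
      obtain ⟨b, hb, rfl⟩ := exists_of_mem_segSystem h1.1 h1.2.1
      obtain ⟨_, _, hk1, hc1⟩ := h1
      obtain ⟨_, _, hk2, _⟩ := h2
      rw [restrict_image] at hk1 hk2 hc1
      obtain ⟨_, t, ⟨ht, htb⟩, _⟩ := hk1.1
      obtain ⟨_, u, ⟨hu, hub⟩, _⟩ := hk2.1
      have ht' := Finset.mem_filter.1 (Finset.mem_coe.1 ht)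
      have hu' := Finset.mem_filter.1 (Finset.mem_coe.1 hu)
      by_cases hk : k ∈ S
      · rw [segPart_mem_segPartition hn _ hb] at htb hub
        have := he2 k (Finset.mem_erase.2 ⟨hki, hk⟩) t ht'.1 u hu'.1 (htb.trans hub.symm)
        apply hAB
        rw [segPart_eq_iff hn]
        exact ⟨(hfr j).trans (hfr l).symm, ht'.2.symm.trans (this.trans hu'.2)⟩
      · refine h.not_cyl hn hk ?_ (Set.nonempty_of_mem (x := t) ?_) hc1
        rotate_left
        · exact ⟨ht, htb⟩
        intro v hv
        exact (Finset.mem_filter.1 (Finset.mem_coe.1 hv.1)).1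

theorem backward (hn : 2 ≤ n)
    (G : Set (∀ i : Fin d, Set ((fun _ : Fin d => ↥(Set.Ico (0 : ℝ) (n : ℝ))) i)))
    (hG : IsMultipile (PP d n) G) : ∀ (S : Finset (Fin d)) (T : Finset (Fin d → ℝ)),
    Face n S T → bx n '' (T : Set (Fin d → ℝ)) = G → (n - 1) * NC rcl S T + 1 = n ^ S.card := by
  induction hG with
  | single K hK =>
    intro S T h he
    have hc : T.card ≤ 1 := by
      rw [Finset.card_le_one]
      intro t ht u hu
      have h1 : bx n t ∈ bx n '' (T : Set (Fin d → ℝ)) := ⟨t, ht, rfl⟩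
      have h2 : bx n u ∈ bx n '' (T : Set (Fin d → ℝ)) := ⟨u, hu, rfl⟩
      rw [he] at h1 h2
      exact h.bx_inj hn ht hu (h1.trans h2.symm)
    rw [h.1.card] at hc
    have hS : S.card = 0 := by
      by_contra hne
      have := Nat.one_lt_pow hne (show 1 < n by omega)
      omega
    rw [Finset.card_eq_zero] at hS
    subst hS
    simp [NC]
  | pile G i π hπ hnt hK hlam hcyl hsub hdis ih =>
    intro S T h he
    obtain ⟨t₀, ht₀⟩ := Finset.card_pos.1 h.1.card_pos
    have hi : i ∈ S := by
      by_contra hi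
      rw [← he] at hcyl
      exact h.not_cyl hn hi (U := (T : Set (Fin d → ℝ))) (fun t ht => ht) ⟨t₀, ht₀⟩ hcyl
    obtain ⟨a, haI, rfl⟩ := exists_of_mem_segSystem hπ hnt
    have ha : ∀ t ∈ T, rcl t i = a := by
      intro t ht
      have h1 : bx n t ∈ G := by rw [← he]; exact ⟨t, ht, rfl⟩
      rw [← hlam] at h1
      exact (segPart_mem_segPartition hn _ haI).1 h1.2
    subst he
    have hfr : ∀ j : ℕ, Int.fract (a + (j : ℝ)) = a := fun j => by
      rw [Int.fract_add_natCast, Int.fract_eq_self.2 haI]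
    rw [h.1.equality_iff hn hi ha]
    constructor
    · intro s
      have hmem : segPart n (a + (s.val : ℝ)) ∈ segPartition n a := ⟨s.val, ZMod.val_lt s, rfl⟩
      refine ih (segPart n (a + (s.val : ℝ))) hmem _ _ (h.layer hi ha s) ?_
      rw [restrict_layer hn (fun t ht => (ha t ht).trans (hfr _).symm)]
      rw [Int.floor_add_natCast, Int.floor_eq_zero_iff.2 haI]
      simp
    · intro k hk t ht u hu htu
      by_contra hne
      refine hdis k (Finset.ne_of_mem_erase hk) (segPart n (t i))
        ((segPart_mem_segPartition hn _ haI).2 (ha t ht)) (segPart n (u i))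
        ((segPart_mem_segPartition hn _ haI).2 (ha u hu))
        (fun hh => hne ((segPart_eq_iff hn _ _).1 hh).2) (segPartition n (rcl t k)) ⟨?_, ?_⟩
      · rw [restrict_layer hn (fun v hv => (ha v hv).trans (ha t ht).symm)]
        exact (h.layer hi ha _).hidden hn hk (Finset.mem_filter.2 ⟨ht, rfl⟩)
      · rw [restrict_layer hn (fun v hv => (ha v hv).trans (ha u hu).symm), htu]
        exact (h.layer hi ha _).hidden hn hk (Finset.mem_filter.2 ⟨hu, rfl⟩)

end Boxes

theorem stmt_9 {d : ℕ} (n : ℕ) (hn : 2 ≤ n) (T : Set (Fin d → ℝ))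
    (hT : IsCubeTiling (fun _ : Fin d => n) T) :
    ∑ i : Fin d, (pset T i).ncard = (n ^ d - 1) / (n - 1) ↔
      IsMultipile (X := fun _ : Fin d => ↥(Set.Ico (0 : ℝ) (n : ℝ)))
        (fun _ => segSystem n)
        ((fun t => fun i : Fin d => segPart n (t i)) '' T) := by
  classical
  have : NeZero n := ⟨by omega⟩
  lift T to Finset (Fin d → ℝ) using tiling_finite hn hT
  have hF : Face n Finset.univ T := ⟨tiling_MM hn hT, fun _ _ _ _ k hk => absurd (Finset.mem_univ k) hk⟩
  have hsum : ∑ i : Fin d, (pset (T : Set (Fin d → ℝ)) i).ncard = NC rcl Finset.univ T := by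
    unfold NC pset
    refine Finset.sum_congr rfl fun k _ => ?_
    rw [← Set.ncard_coe_finset, Finset.coe_image]
    rfl
  have hnum : ∑ i : Fin d, (pset (T : Set (Fin d → ℝ)) i).ncard = (n ^ d - 1) / (n - 1) ↔
      (n - 1) * NC rcl Finset.univ T + 1 = n ^ (Finset.univ : Finset (Fin d)).card := by
    rw [hsum, Finset.card_univ, Fintype.card_fin]
    have h1 : n - 1 ∣ n ^ d - 1 := by simpa only [one_pow] using Nat.sub_dvd_pow_sub_pow n 1 d
    have h2 : 0 < n ^ d := pow_pos (by omega) _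
    rw [eq_comm, Nat.div_eq_iff_eq_mul_right (by omega) h1]
    omega
  rw [hnum]
  constructor
  · intro h
    exact forward hn _ _ _ rfl hF h
  · intro h
    exact backward hn _ h _ _ hF rfl
end

section
/- Let (X, Π, 𝓑) be a system of d-boxes and suppose there is an integer n ≥ 2 such that for every i ∈ {1,…,d} every nontrivial partition belonging to Π_i has exactly n parts. If 𝓖 ⊆ 𝓑 is a Keller family that is a partition of X and consists of proper boxes, then Σ_{i=1}^d |C_i(𝓖)| ≤ (n^d − 1)/(n − 1), with equality if and only if 𝓖 is a multipile. -/
open Set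

/-- `C i (𝓖)`: the set of partitions in `P i` hidden in `𝓖`. -/
def hiddenSet {d : ℕ} {X : Fin d → Type*} (P : ∀ i, Set (Set (Set (X i))))
    (G : Set (∀ i, Set (X i))) (i : Fin d) : Set (Set (Set (X i))) :=
  {π | HiddenIn P G i π}

/-- `c_i(𝓖) = Σ_{π ∈ C_i(𝓖)} (|π| - 1)`. -/
noncomputable def cIdx {d : ℕ} {X : Fin d → Type*} (P : ∀ i, Set (Set (Set (X i))))
    (G : Set (∀ i, Set (X i))) (i : Fin d) : ℕ :=
  ∑ᶠ π ∈ hiddenSet P G i, (π.ncard - 1)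

/-- `c(𝓖) = Σ_i c_i(𝓖)`. -/
noncomputable def cTotal {d : ℕ} {X : Fin d → Type*} (P : ∀ i, Set (Set (Set (X i))))
    (G : Set (∀ i, Set (X i))) : ℕ :=
  ∑ i, cIdx P G i

namespace HidPf

open scoped Classical

lemma eq_triv {α : Type*} {π : Set (Set α)} (h : IsPartition π) (hu : Set.univ ∈ π) :
    π = {Set.univ} := by
  ext B
  constructor
  · intro hB
    by_contra hne
    have hd := h.2.1 hB hu hne
    obtain ⟨x, hx⟩ := h.1 B hB
    exact Set.disjoint_left.1 hd hx (Set.mem_univ x)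
  · rintro rfl
    exact hu

lemma part_eq {α : Type*} {π : Set (Set α)} (h : IsPartition π) {A B : Set α} (hA : A ∈ π)
    (hB : B ∈ π) {x : α} (hxA : x ∈ A) (hxB : x ∈ B) : A = B := by
  by_contra hne
  exact Set.disjoint_left.1 (h.2.1 hA hB hne) hxA hxB

lemma two_part {α : Type*} {π π' : Set (Set α)} (h : IndepPartitions π π') {D : Set α}
    (hne : D.Nonempty) (h1 : ∀ B ∈ π, B ⊆ D ∨ B ⊆ Dᶜ) (h2 : ∀ B ∈ π', B ⊆ D ∨ B ⊆ Dᶜ) :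
    D = Set.univ := by
  by_contra hD
  have hpart : IsPartition ({D, Dᶜ} : Set (Set α)) := by
    refine ⟨?_, ?_, ?_⟩
    · rintro A (rfl | rfl)
      · exact hne
      · exact Set.nonempty_compl.2 hD
    · rintro A (rfl | rfl) B (rfl | rfl) hAB
      · exact absurd rfl hAB
      · exact disjoint_compl_right
      · exact disjoint_compl_left
      · exact absurd rfl hAB
    · simp
  have hc : ∀ σ : Set (Set α), (∀ B ∈ σ, B ⊆ D ∨ B ⊆ Dᶜ) → Coarser σ {D, Dᶜ} := by
    intro σ hσ B hB
    rcases hσ B hB with h | h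
    · exact ⟨D, by simp, h⟩
    · exact ⟨Dᶜ, by simp, h⟩
  have := h _ hpart (hc π h1) (hc π' h2)
  have hm : D ∈ ({D, Dᶜ} : Set (Set α)) := by simp
  rw [this] at hm
  exact hD hm

lemma sub_or {α : Type*} {π : Set (Set α)} (h : IsPartition π) {𝓐 : Set (Set α)} (h𝓐 : 𝓐 ⊆ π) :
    ∀ B ∈ π, B ⊆ ⋃₀ 𝓐 ∨ B ⊆ (⋃₀ 𝓐)ᶜ := by
  intro B hB
  by_cases hm : B ∈ 𝓐
  · exact Or.inl (Set.subset_sUnion_of_mem hm)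
  · right
    rintro x hx ⟨A, hA, hxA⟩
    exact hm (part_eq h hB (h𝓐 hA) hx hxA ▸ hA)

section sys

variable {d : ℕ} {X : Fin d → Type*} {P : ∀ i, Set (Set (Set (X i)))}

lemma part_unique (hsys : IsBoxSystem X P) {i : Fin d} {π π' : Set (Set (X i))}
    (hπ : π ∈ P i) (hπ' : π' ∈ P i) {A : Set (X i)} (hA : A ∈ π) (hA' : A ∈ π') : π = π' := by
  by_contra hne
  have ind := hsys.2.2.2.2 i π hπ π' hπ' hne
  have p1 := hsys.2.2.2.1 i π hπ
  have p2 := hsys.2.2.2.1 i π' hπ'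
  have hu : A = Set.univ := by
    have e : ⋃₀ ({A} : Set (Set (X i))) = A := by simp
    have s1 := sub_or p1 (Set.singleton_subset_iff.2 hA)
    have s2 := sub_or p2 (Set.singleton_subset_iff.2 hA')
    rw [e] at s1 s2
    exact two_part ind (p1.1 A hA) s1 s2
  subst hu
  exact hne ((eq_triv p1 hA).trans (eq_triv p2 hA').symm)

abbrev JJ (P : ∀ i, Set (Set (Set (X i)))) := Σ i, ↥(P i)

abbrev Om (P : ∀ i, Set (Set (Set (X i)))) := ∀ j : JJ P, ↥(j.2.1)

def Sel (ω : Om P) (i : Fin d) (A : Set (X i)) : Prop :=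
  ∀ p : ↥(P i), A ∈ p.1 → (ω ⟨i, p⟩).1 = A

def Lift (ω : Om P) (K : ∀ i, Set (X i)) : Prop := ∀ i, Sel ω i (K i)

lemma one_dim (hsys : IsBoxSystem X P) {i : Fin d} (ω : Om P) {𝓐 𝓐' : Set (Set (X i))}
    (hb : ∀ A ∈ 𝓐, ∃ π ∈ P i, A ∈ π) (hb' : ∀ A ∈ 𝓐', ∃ π ∈ P i, A ∈ π)
    (hk : ∀ A ∈ 𝓐, ∀ B ∈ 𝓐, A ≠ B → ∃ π ∈ P i, A ∈ π ∧ B ∈ π)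
    (hk' : ∀ A ∈ 𝓐', ∀ B ∈ 𝓐', A ≠ B → ∃ π ∈ P i, A ∈ π ∧ B ∈ π)
    (hU : ⋃₀ 𝓐 = ⋃₀ 𝓐') (h : ∃ A ∈ 𝓐, Sel ω i A) : ∃ A ∈ 𝓐', Sel ω i A := by
  obtain ⟨A, hA, hs⟩ := h
  have key : ∀ 𝓒 : Set (Set (X i)), (∀ A ∈ 𝓒, ∀ B ∈ 𝓒, A ≠ B → ∃ π ∈ P i, A ∈ π ∧ B ∈ π) →
      ∀ A ∈ 𝓒, ∀ π ∈ P i, A ∈ π → 𝓒 ⊆ π := by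
    intro 𝓒 h𝓒 A hA π hπ hAπ B hB
    by_cases hAB : A = B
    · exact hAB ▸ hAπ
    · obtain ⟨σ, hσ, h1, h2⟩ := h𝓒 A hA B hB hAB
      rw [part_unique hsys hπ hσ hAπ h1]
      exact h2
  obtain ⟨π, hπ, hAπ⟩ := hb A hA
  have hsub := key 𝓐 hk A hA π hπ hAπ
  have p1 := hsys.2.2.2.1 i π hπ
  obtain ⟨x, hx⟩ := p1.1 A hAπ
  have hxU : x ∈ ⋃₀ 𝓐' := hU ▸ ⟨A, hA, hx⟩
  obtain ⟨A', hA', hxA'⟩ := hxU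
  obtain ⟨π', hπ', hAπ'⟩ := hb' A' hA'
  have hsub' := key 𝓐' hk' A' hA' π' hπ' hAπ'
  have p2 := hsys.2.2.2.1 i π' hπ'
  by_cases hpp : π = π'
  · subst hpp
    have : A = A' := part_eq p1 hAπ hAπ' hx hxA'
    exact ⟨A', hA', this ▸ hs⟩
  · have ind := hsys.2.2.2.2 i π hπ π' hπ' hpp
    have hD := two_part ind (D := ⋃₀ 𝓐) ⟨x, A, hA, hx⟩ (sub_or p1 hsub) (hU ▸ sub_or p2 hsub')
    refine ⟨(ω ⟨i, ⟨π', hπ'⟩⟩).1, ?_, ?_⟩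
    · have hm := (ω ⟨i, ⟨π', hπ'⟩⟩).2
      obtain ⟨y, hy⟩ := p2.1 _ hm
      have : y ∈ ⋃₀ 𝓐' := by rw [← hU, hD]; trivial
      obtain ⟨B, hB, hyB⟩ := this
      rw [part_eq p2 hm (hsub' hB) hy hyB]
      exact hB
    · rintro ⟨σ, hσ⟩ hm
      have : π' = σ := part_unique hsys hπ' hσ (ω ⟨i, ⟨π', hπ'⟩⟩).2 hm
      subst this
      rfl

def Mix (S : Finset (Fin d)) (x : ∀ i, X i) (ω : Om P) (K : ∀ i, Set (X i)) (j : Fin d) : Prop :=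
  (j ∈ S → Sel ω j (K j)) ∧ (j ∉ S → x j ∈ K j)

lemma mix_inv (hsys : IsBoxSystem X P) {H : Set (∀ i, Set (X i))}
    (hbox : ∀ K ∈ H, IsBox P K) (hk : ∀ K ∈ H, ∀ L ∈ H, K ≠ L → KellerPair P K L)
    (i : Fin d) (hcyl : IsCylinder i (polyUnion H)) (ω : Om P) (S : Finset (Fin d)) :
    i ∉ S → ∀ (x : ∀ i, X i) (y : X i), (∃ K ∈ H, ∀ j, Mix S x ω K j) →
      ∃ K ∈ H, ∀ j, Mix S (Function.update x i y) ω K j := by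
  induction S using Finset.induction_on with
  | empty =>
    rintro - x y ⟨K, hK, hm⟩
    have hx : x ∈ polyUnion H := by
      simp only [polyUnion, Set.mem_iUnion]
      exact ⟨K, hK, fun j _ => (hm j).2 (by simp)⟩
    have := hcyl x hx y
    simp only [polyUnion, Set.mem_iUnion] at this
    obtain ⟨L, hL, hl⟩ := this
    exact ⟨L, hL, fun j => ⟨by simp, fun _ => hl j trivial⟩⟩
  | insert k S hkS ih =>
    intro hi x y ⟨K, hK, hm⟩
    have hik : i ≠ k := fun h => hi (by simp [h])
    have hiS : i ∉ S := fun h => hi (by simp [h])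
    specialize ih hiS
    let 𝓐 : (∀ i, X i) → Set (Set (X k)) := fun x =>
      {A | ∃ K ∈ H, K k = A ∧ ∀ j, j ≠ k → Mix S x ω K j}
    have hb : ∀ x, ∀ A ∈ 𝓐 x, ∃ π ∈ P k, A ∈ π := by
      rintro x A ⟨K, hK, rfl, -⟩
      exact hbox K hK k
    have hkk : ∀ x, ∀ A ∈ 𝓐 x, ∀ B ∈ 𝓐 x, A ≠ B → ∃ π ∈ P k, A ∈ π ∧ B ∈ π := by
      rintro x A ⟨K, hK, rfl, hmK⟩ B ⟨L, hL, rfl, hmL⟩ hne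
      have hKL : K ≠ L := fun h => hne (h ▸ rfl)
      obtain ⟨j, π, hπ, h1, h2, h3⟩ := hk K hK L hL hKL
      by_cases hjk : j = k
      · subst hjk
        exact ⟨π, hπ, h1, h2⟩
      · exfalso
        apply h3
        by_cases hjS : j ∈ S
        · rw [← (hmK j hjk).1 hjS ⟨π, hπ⟩ h1, ← (hmL j hjk).1 hjS ⟨π, hπ⟩ h2]
        · exact part_eq (hsys.2.2.2.1 j π hπ) h1 h2 ((hmK j hjk).2 hjS) ((hmL j hjk).2 hjS)
    have hsub : ∀ x y, ⋃₀ 𝓐 x ⊆ ⋃₀ 𝓐 (Function.update x i y) := by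
      rintro x y t ⟨_, ⟨K, hK, rfl, hmK⟩, ht⟩
      have := ih (Function.update x k t) y ⟨K, hK, fun j => by
        by_cases hjk : j = k
        · subst hjk
          exact ⟨fun h => absurd h hkS, fun _ => by simpa using ht⟩
        · refine ⟨(hmK j hjk).1, fun h => ?_⟩
          simpa [hjk] using (hmK j hjk).2 h⟩
      obtain ⟨L, hL, hmL⟩ := this
      refine ⟨L k, ⟨L, hL, rfl, fun j hjk => ⟨(hmL j).1, fun h => ?_⟩⟩, ?_⟩
      · have := (hmL j).2 h
        rw [Function.update_comm hik.symm] at this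
        simpa [hjk] using this
      · have := (hmL k).2 hkS
        simpa [hik.symm] using this
    have hU : ⋃₀ 𝓐 x = ⋃₀ 𝓐 (Function.update x i y) := by
      apply Set.Subset.antisymm (hsub x y)
      have := hsub (Function.update x i y) (x i)
      simpa using this
    obtain ⟨_, ⟨L, hL, rfl, hmL⟩, hs⟩ := one_dim hsys ω (hb x) (hb _) (hkk x) (hkk _) hU
      ⟨K k, ⟨K, hK, rfl, fun j hjk => ⟨fun h => (hm j).1 (by simp [h]),
        fun h => (hm j).2 (by simp [h, hjk])⟩⟩, (hm k).1 (by simp)⟩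
    refine ⟨L, hL, fun j => ?_⟩
    by_cases hjk : j = k
    · subst hjk
      exact ⟨fun _ => hs, fun h => absurd (by simp) h⟩
    · refine ⟨fun h => (hmL j hjk).1 ?_, fun h => (hmL j hjk).2 ?_⟩
      · simpa [hjk] using h
      · exact fun h' => h (by simp [h'])

lemma lift_inv_of_notMem {ω : Om P} {K : ∀ i, Set (X i)} (h : Lift ω K) (j : JJ P)
    (hj : K j.1 ∉ j.2.1) (B : ↥(j.2.1)) : Lift (Function.update ω j B) K := by
  intro i p hp
  have hne : (⟨i, p⟩ : JJ P) ≠ j := by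
    rintro rfl
    exact hj hp
  rw [Function.update_of_ne hne]
  exact h i p hp

lemma hidden_inv (hsys : IsBoxSystem X P) {G : Set (∀ i, Set (X i))}
    (j : JJ P) (hh : HiddenIn P G j.1 j.2.1) (ω : Om P) (B : ↥(j.2.1))
    (h : ∃ K ∈ restrictFam G j.1 j.2.1, Lift ω K) :
    ∃ K ∈ restrictFam G j.1 j.2.1, Lift (Function.update ω j B) K := by
  obtain ⟨K, hK, hl⟩ := h
  obtain ⟨i, ⟨π, hπ⟩⟩ := j
  obtain ⟨-, -, hkel, hcyl⟩ := hh
  have hx : ∀ k, ∃ x, x ∈ K k := by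
    intro k
    obtain ⟨σ, hσ, hm⟩ := hkel.2.1 K hK k
    exact (hsys.2.2.2.1 k σ hσ).1 _ hm
  choose x hx using hx
  have hp := hsys.2.2.2.1 i π hπ
  obtain ⟨y, hy⟩ := hp.1 _ B.2
  obtain ⟨L, hL, hm⟩ := mix_inv hsys hkel.2.1 hkel.2.2 i hcyl ω (Finset.univ.erase i) (by simp)
    x y ⟨K, hK, fun k => ⟨fun _ => hl k, fun _ => hx k⟩⟩
  have hLi : L i = B.1 := by
    have := (hm i).2 (by simp)
    simp only [Function.update_self] at this
    exact part_eq hp hL.2 B.2 this hy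
  refine ⟨L, hL, fun k p hkp => ?_⟩
  by_cases hki : k = i
  · subst hki
    have e : p = ⟨π, hπ⟩ := Subtype.ext (part_unique hsys p.2 hπ hkp hL.2)
    subst e
    rw [Function.update_self, hLi]
  · have hne : (⟨k, p⟩ : JJ P) ≠ ⟨i, ⟨π, hπ⟩⟩ := by
      intro h
      exact hki (congrArg Sigma.fst h)
    rw [Function.update_of_ne hne]
    exact (hm k).1 (by simp [hki]) p hkp

lemma union_inv (hsys : IsBoxSystem X P) {G : Set (∀ i, Set (X i))}
    (j : JJ P) (hh : HiddenIn P G j.1 j.2.1) (ω : Om P) (B : ↥(j.2.1))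
    (h : ∃ K ∈ G, Lift ω K) : ∃ K ∈ G, Lift (Function.update ω j B) K := by
  obtain ⟨K, hK, hl⟩ := h
  by_cases hm : K j.1 ∈ j.2.1
  · obtain ⟨L, hL, hl'⟩ := hidden_inv hsys j hh ω B ⟨K, ⟨hK, hm⟩, hl⟩
    exact ⟨L, hL.1, hl'⟩
  · exact ⟨K, hK, lift_inv_of_notMem hl j hm B⟩

lemma union_inv_many (hsys : IsBoxSystem X P) {G : Set (∀ i, Set (X i))} (T : Finset (JJ P))
    (hT : ∀ j ∈ T, HiddenIn P G j.1 j.2.1) (ω ω' : Om P)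
    (h : ∃ K ∈ G, Lift ω K) :
    ∃ K ∈ G, Lift (fun j => if j ∈ T then ω' j else ω j) K := by
  induction T using Finset.induction_on with
  | empty => simpa using h
  | insert j T hj ih =>
    have := union_inv hsys j (hT j (by simp)) _ (ω' j) (ih fun k hk => hT k (by simp [hk]))
    convert this using 4 with K
    ext k : 1
    by_cases hkj : k = j
    · subst hkj; simp
    · simp [hkj]

end sys
end HidPf
namespace HidPf

open scoped Classical

lemma bessel {γ τ : Type*} [DecidableEq γ] (G : Finset γ) (T : Finset τ) (w : γ → ℚ) (φ : τ → γ → ℚ)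
    (β N : τ → ℚ) (K : γ) (hK : K ∈ G)
    (horth : ∀ s ∈ T, ∀ t ∈ T, s ≠ t → ∑ L ∈ G, w L * (φ s L * φ t L) = 0)
    (hN : ∀ t ∈ T, ∑ L ∈ G, w L * (φ t L * φ t L) = N t)
    (hβ : ∀ t ∈ T, β t * φ t K = β t ^ 2 * N t) :
    ∑ L ∈ G, w L * ((if L = K then 1 else 0) - w K * ∑ t ∈ T, β t * φ t L) ^ 2
      = w K * (1 - w K * ∑ t ∈ T, β t * φ t K) := by
  have h1 : ∑ L ∈ G, w L * (if L = K then (1:ℚ) else 0) = w K := by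
    simp [Finset.sum_ite_eq', hK]
  have h2 : ∑ L ∈ G, w L * ((if L = K then (1:ℚ) else 0) * ∑ t ∈ T, β t * φ t L)
      = w K * ∑ t ∈ T, β t * φ t K := by
    rw [Finset.sum_eq_single K]
    · simp
    · intro L _ hL; simp [hL]
    · intro h; exact absurd hK h
  have h3 : ∑ L ∈ G, w L * ((∑ t ∈ T, β t * φ t L) * ∑ t ∈ T, β t * φ t L)
      = ∑ t ∈ T, β t * φ t K := by
    have e : ∀ L ∈ G, w L * ((∑ t ∈ T, β t * φ t L) * ∑ t ∈ T, β t * φ t L)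
        = ∑ s ∈ T, ∑ t ∈ T, β s * β t * (w L * (φ s L * φ t L)) := by
      intro L _
      rw [Finset.sum_mul_sum, Finset.mul_sum]
      refine Finset.sum_congr rfl fun s _ => ?_
      rw [Finset.mul_sum]
      refine Finset.sum_congr rfl fun t _ => ?_
      ring
    rw [Finset.sum_congr rfl e, Finset.sum_comm]
    refine Finset.sum_congr rfl fun s hs => ?_
    rw [Finset.sum_comm, Finset.sum_eq_single s]
    · rw [← Finset.mul_sum, hN s hs, hβ s hs]; ring
    · intro t ht hts
      rw [← Finset.mul_sum, horth s hs t ht hts.symm, mul_zero]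
    · intro h; exact absurd hs h
  have e : ∀ L ∈ G, w L * ((if L = K then 1 else 0) - w K * ∑ t ∈ T, β t * φ t L) ^ 2
      = w L * (if L = K then (1:ℚ) else 0)
        - 2 * w K * (w L * ((if L = K then (1:ℚ) else 0) * ∑ t ∈ T, β t * φ t L))
        + w K ^ 2 * (w L * ((∑ t ∈ T, β t * φ t L) * ∑ t ∈ T, β t * φ t L)) := by
    intro L _
    split_ifs <;> ring
  rw [Finset.sum_congr rfl e, Finset.sum_add_distrib, Finset.sum_sub_distrib, ← Finset.mul_sum,
    ← Finset.mul_sum, h1, h2, h3]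
  ring

section sys

variable {d : ℕ} {X : Fin d → Type*} {P : ∀ i, Set (Set (Set (X i)))}

lemma sum_chi [Fintype (Om P)] (n : ℕ) (g : Om P → ℚ) (j : JJ P) (hn : j.2.1.ncard = n)
    (hf : j.2.1.Finite) (A : ↥(j.2.1))
    (hg : ∀ ω B, g (Function.update ω j B) = g ω) :
    ∑ ω, g ω * (n * (if ω j = A then 1 else 0) - 1) = 0 := by
  have sw : ∀ B, ∑ ω, g ω * (if ω j = B then 1 else 0) = ∑ ω, g ω * (if ω j = A then 1 else 0) := by
    intro B
    let σ : Om P → Om P := fun ω => Function.update ω j (Equiv.swap A B (ω j))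
    have hσ : Function.Involutive σ := by
      intro ω
      simp [σ]
    refine Fintype.sum_equiv hσ.toPerm _ _ fun ω => ?_
    change _ = g (σ ω) * (if σ ω j = A then 1 else 0)
    simp only [σ, hg, Function.update_self]
    congr 1
    have : Equiv.swap A B (ω j) = A ↔ ω j = B := by
      constructor
      · intro h
        have := congrArg (Equiv.swap A B) h
        simpa using this
      · rintro h; simp [h]
    simp [this]
  have : Fintype ↥(j.2.1) := hf.fintype
  have hc : (Fintype.card ↥(j.2.1) : ℚ) = n := by
    rw [← hn, ← Nat.card_coe_set_eq, Nat.card_eq_fintype_card]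
  have tot : ∑ B, ∑ ω, g ω * (if ω j = B then 1 else 0) = ∑ ω, g ω := by
    rw [Finset.sum_comm]
    refine Finset.sum_congr rfl fun ω _ => ?_
    simp
  rw [Finset.sum_congr rfl fun B _ => sw B, Finset.sum_const, Finset.card_univ, nsmul_eq_mul,
    hc] at tot
  have : ∀ ω, g ω * (n * (if ω j = A then 1 else 0) - 1)
      = n * (g ω * (if ω j = A then 1 else 0)) - g ω := by
    intro ω; ring
  rw [Finset.sum_congr rfl fun ω _ => this ω, Finset.sum_sub_distrib, ← Finset.mul_sum, tot,
    sub_self]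

noncomputable def ind (ω : Om P) (K : ∀ i, Set (X i)) : ℚ := if Lift ω K then 1 else 0

noncomputable def wt [Fintype (Om P)] (K : ∀ i, Set (X i)) : ℚ :=
  ∑ ω : Om P, ind ω K

lemma exists_lift (hsys : IsBoxSystem X P) (K : ∀ i, Set (X i)) : ∃ ω : Om P, Lift ω K := by
  have hne : ∀ j : JJ P, ∃ A : ↥(j.2.1), K j.1 ∈ j.2.1 → A.1 = K j.1 := by
    rintro ⟨i, ⟨π, hπ⟩⟩
    by_cases h : K i ∈ π
    · exact ⟨⟨_, h⟩, fun _ => rfl⟩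
    · have hp := hsys.2.2.2.1 i π hπ
      obtain ⟨x, -⟩ := (hsys.1 i).exists_pair_ne
      have : x ∈ ⋃₀ π := by rw [hp.2.2]; trivial
      obtain ⟨A, hA, -⟩ := this
      exact ⟨⟨A, hA⟩, fun h' => absurd h' h⟩
  choose f hf using hne
  exact ⟨f, fun i p hp => hf ⟨i, p⟩ hp⟩

lemma wt_pos [Fintype (Om P)] (hsys : IsBoxSystem X P) (K : ∀ i, Set (X i)) :
    0 < wt (P := P) K := by
  obtain ⟨ω, hω⟩ := exists_lift hsys K
  refine Finset.sum_pos' (fun ω _ => ?_) ⟨ω, Finset.mem_univ _, ?_⟩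
  · unfold ind; split_ifs <;> norm_num
  · simp [ind, hω]

/-- `y_{j,K}(L)`. -/
noncomputable def yy (n : ℕ) (j : JJ P) (A : Set (X j.1)) (L : ∀ i, Set (X i)) : ℚ :=
  if L j.1 ∈ j.2.1 then n * (if L j.1 = A then 1 else 0) - 1 else 0

lemma wt_chi [Fintype (Om P)] (hsys : IsBoxSystem X P) (n : ℕ) (j : JJ P)
    (hn : j.2.1.ncard = n) (A : ↥(j.2.1)) (K : ∀ i, Set (X i)) :
    ∑ ω : Om P, ind ω K * (n * (if ω j = A then 1 else 0) - 1) = wt (P := P) K * yy n j A.1 K := by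
  unfold yy
  by_cases h : K j.1 ∈ j.2.1
  · rw [if_pos h, wt, Finset.sum_mul]
    refine Finset.sum_congr rfl fun ω _ => ?_
    unfold ind
    by_cases hl : Lift ω K
    · have e : (ω j).1 = K j.1 := hl j.1 j.2 h
      have : ω j = A ↔ K j.1 = A.1 := by rw [← e]; exact Subtype.ext_iff
      simp [this]
    · simp [hl]
  · rw [if_neg h, mul_zero]
    apply sum_chi n _ j hn (hsys.2.2.1 j.1 j.2.1 j.2.2)
    intro ω B
    unfold ind
    have : Lift (Function.update ω j B) K ↔ Lift ω K := by
      refine ⟨fun hl => ?_, fun hl => lift_inv_of_notMem hl j h B⟩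
      have := lift_inv_of_notMem hl j h (ω j)
      simpa using this
    simp [this]

lemma lift_unique {G : Set (∀ i, Set (X i))} (hG : IsKellerFamily P G) {ω : Om P}
    {K L : ∀ i, Set (X i)} (hK : K ∈ G) (hL : L ∈ G) (h1 : Lift ω K) (h2 : Lift ω L) : K = L := by
  by_contra hne
  obtain ⟨i, π, hπ, a, b, c⟩ := hG.2.2 K hK L hL hne
  apply c
  rw [← h1 i ⟨π, hπ⟩ a, ← h2 i ⟨π, hπ⟩ b]

lemma sum_ind {G : Finset (∀ i, Set (X i))} (hG : IsKellerFamily P (G : Set (∀ i, Set (X i))))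
    (ω : Om P) (f : (∀ i, Set (X i)) → ℚ) (c : ℚ)
    (hc : ∀ K ∈ G, Lift ω K → f K = c) (h0 : (¬ ∃ K ∈ G, Lift ω K) → c = 0) :
    ∑ K ∈ G, f K * ind ω K = c := by
  by_cases h : ∃ K ∈ G, Lift ω K
  · obtain ⟨K, hK, hl⟩ := h
    rw [Finset.sum_eq_single K]
    · simp [ind, hl, hc K hK hl]
    · intro L hL hne
      have : ¬ Lift ω L := fun hl' => hne (lift_unique hG hL hK hl' hl)
      simp [ind, this]
    · intro h; exact absurd hK h
  · rw [h0 h]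
    push Not at h
    exact Finset.sum_eq_zero fun K hK => by simp [ind, h K hK]

/-- lifted indicator of the hidden cylinder -/
noncomputable def cylInd (G : Finset (∀ i, Set (X i))) (j : JJ P) (ω : Om P) : ℚ :=
  if ∃ K ∈ restrictFam (G : Set (∀ i, Set (X i))) j.1 j.2.1, Lift ω K then 1 else 0

lemma cylInd_inv (hsys : IsBoxSystem X P) {G : Finset (∀ i, Set (X i))} (j : JJ P)
    (hh : HiddenIn P (G : Set (∀ i, Set (X i))) j.1 j.2.1) (ω : Om P) (B : ↥(j.2.1)) :
    cylInd G j (Function.update ω j B) = cylInd G j ω := by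
  unfold cylInd
  have : (∃ K ∈ restrictFam (G : Set (∀ i, Set (X i))) j.1 j.2.1, Lift (Function.update ω j B) K) ↔
      (∃ K ∈ restrictFam (G : Set (∀ i, Set (X i))) j.1 j.2.1, Lift ω K) := by
    refine ⟨fun hl => ?_, hidden_inv hsys j hh ω B⟩
    have := hidden_inv hsys j hh _ (ω j) hl
    simpa using this
  simp [this]

lemma sum_yy_ind {G : Finset (∀ i, Set (X i))} (hG : IsKellerFamily P (G : Set (∀ i, Set (X i))))
    (n : ℕ) (j : JJ P) (A : ↥(j.2.1)) (ω : Om P) :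
    ∑ K ∈ G, yy n j A.1 K * ind ω K
      = cylInd G j ω * (n * (if ω j = A then 1 else 0) - 1) := by
  by_cases h : ∃ K ∈ restrictFam (G : Set (∀ i, Set (X i))) j.1 j.2.1, Lift ω K
  · obtain ⟨K, hK, hl⟩ := h
    have h' : cylInd G j ω = 1 := by
      unfold cylInd; rw [if_pos ⟨K, hK, hl⟩]
    rw [h', one_mul]
    apply sum_ind hG
    · intro L hL hl'
      have : K = L := lift_unique hG hK.1 hL hl hl'
      subst this
      have e : (ω j).1 = K j.1 := hl j.1 j.2 hK.2
      have : ω j = A ↔ K j.1 = A.1 := by rw [← e]; exact Subtype.ext_iff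
      simp [yy, this, hK.2]
    · intro hne
      exact absurd ⟨K, hK.1, hl⟩ hne
  · have h' : cylInd G j ω = 0 := by
      unfold cylInd; rw [if_neg h]
    rw [h', zero_mul]
    apply sum_ind hG
    · intro L hL hl'
      have : L j.1 ∉ j.2.1 := fun hm => h ⟨L, ⟨hL, hm⟩, hl'⟩
      simp [yy, this]
    · intro _; rfl

lemma sum_wt_yy [Fintype (Om P)] (hsys : IsBoxSystem X P) {G : Finset (∀ i, Set (X i))}
    (hG : IsKellerFamily P (G : Set (∀ i, Set (X i))))
    (n : ℕ) (j : JJ P) (hn : j.2.1.ncard = n) (A : ↥(j.2.1))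
    (hh : HiddenIn P (G : Set (∀ i, Set (X i))) j.1 j.2.1) :
    ∑ K ∈ G, wt (P := P) K * yy n j A.1 K = 0 := by
  have : ∀ K ∈ G, wt (P := P) K * yy n j A.1 K = ∑ ω : Om P, yy n j A.1 K * ind ω K := by
    intro K _
    rw [wt, Finset.sum_mul]
    exact Finset.sum_congr rfl fun ω _ => mul_comm _ _
  rw [Finset.sum_congr rfl this, Finset.sum_comm, Finset.sum_congr rfl fun ω _ =>
    sum_yy_ind hG n j A ω]
  exact sum_chi n _ j hn (hsys.2.2.1 j.1 j.2.1 j.2.2) A (cylInd_inv hsys j hh)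

lemma sum_wt_yy_yy [Fintype (Om P)] (hsys : IsBoxSystem X P) {G : Finset (∀ i, Set (X i))}
    (hG : IsKellerFamily P (G : Set (∀ i, Set (X i))))
    (n : ℕ) (j k : JJ P) (hn : j.2.1.ncard = n) (hnk : k.2.1.ncard = n) (hjk : j ≠ k)
    (A : ↥(j.2.1)) (B : ↥(k.2.1))
    (hh : HiddenIn P (G : Set (∀ i, Set (X i))) j.1 j.2.1) :
    ∑ K ∈ G, wt (P := P) K * (yy n j A.1 K * yy n k B.1 K) = 0 := by
  have : ∀ K ∈ G, wt (P := P) K * (yy n j A.1 K * yy n k B.1 K)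
      = ∑ ω : Om P, yy n j A.1 K * ind ω K * (n * (if ω k = B then 1 else 0) - 1) := by
    intro K _
    have := wt_chi hsys n k hnk B K
    calc _ = yy n j A.1 K * (wt (P := P) K * yy n k B.1 K) := by ring
      _ = _ := by
        rw [← this, Finset.mul_sum]
        exact Finset.sum_congr rfl fun ω _ => by ring
  rw [Finset.sum_congr rfl this, Finset.sum_comm]
  have e : ∀ ω : Om P, ∑ K ∈ G, yy n j A.1 K * ind ω K * (n * (if ω k = B then 1 else 0) - 1)
      = (cylInd G j ω * (n * (if ω k = B then 1 else 0) - 1))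
        * (n * (if ω j = A then 1 else 0) - 1) := by
    intro ω
    rw [← Finset.sum_mul, sum_yy_ind hG]
    ring
  rw [Finset.sum_congr rfl fun ω _ => e ω]
  refine sum_chi n _ j hn (hsys.2.2.1 j.1 j.2.1 j.2.2) A fun ω B' => ?_
  rw [cylInd_inv hsys j hh, Function.update_of_ne hjk.symm]

lemma wt_le [Fintype (Om P)] {G : Finset (∀ i, Set (X i))}
    (hG : IsKellerFamily P (G : Set (∀ i, Set (X i)))) :
    ∑ K ∈ G, wt (P := P) K ≤ Fintype.card (Om P) := by
  unfold wt
  rw [Finset.sum_comm]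
  have : ∀ ω : Om P, ∑ K ∈ G, ind ω K ≤ 1 := by
    intro ω
    have := sum_ind hG ω (fun _ => 1) (if ∃ K ∈ G, Lift ω K then 1 else 0)
      (fun K hK hl => by rw [if_pos ⟨K, hK, hl⟩]) (fun h => by rw [if_neg h])
    simp only [one_mul] at this
    rw [this]
    split_ifs <;> norm_num
  calc _ ≤ ∑ ω : Om P, (1:ℚ) := Finset.sum_le_sum fun ω _ => this ω
    _ = _ := by simp

lemma wt_proper [Fintype (Om P)] (hsys : IsBoxSystem X P) (n : ℕ)
    (hcard : ∀ i, ∀ π ∈ P i, π ≠ {Set.univ} → π.ncard = n) {K : ∀ i, Set (X i)}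
    (hK : IsBox P K) (hp : ∀ i, K i ≠ Set.univ) :
    (n : ℚ) ^ d * wt (P := P) K = Fintype.card (Om P) := by
  choose π hπ hm using hK
  have hn : ∀ i, (π i).ncard = n := by
    intro i
    refine hcard i _ (hπ i) fun h => ?_
    have := hm i
    rw [h] at this
    exact hp i this
  let q : ∀ i, JJ P := fun i => ⟨i, ⟨π i, hπ i⟩⟩
  have key : ∀ S : Finset (Fin d), (n : ℚ) ^ S.card *
      ∑ ω : Om P, (if ∀ i ∈ S, (ω (q i)).1 = K i then 1 else 0) = Fintype.card (Om P) := by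
    intro S
    induction S using Finset.induction_on with
    | empty => simp
    | insert i S hi ih =>
      rw [← ih, Finset.card_insert_of_notMem hi, pow_succ, mul_assoc]
      congr 1
      have := sum_chi n (fun ω : Om P => if ∀ i ∈ S, (ω (q i)).1 = K i then (1:ℚ) else 0) (q i)
        (hn i) (hsys.2.2.1 i _ (hπ i)) ⟨K i, hm i⟩ (by
          intro ω B
          have : ∀ k ∈ S, Function.update ω (q i) B (q k) = ω (q k) := by
            intro k hk
            apply Function.update_of_ne
            intro h
            have : k = i := congrArg Sigma.fst h
            exact hi (this ▸ hk)
          have e : (∀ k ∈ S, (Function.update ω (q i) B (q k)).1 = K k) ↔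
              (∀ k ∈ S, (ω (q k)).1 = K k) :=
            forall₂_congr fun k hk => by rw [this k hk]
          simp only [e])
      rw [Finset.mul_sum, ← sub_eq_zero, ← Finset.sum_sub_distrib]
      refine Eq.trans ?_ this
      refine Finset.sum_congr rfl fun ω _ => ?_
      by_cases h1 : ∀ k ∈ S, (ω (q k)).1 = K k
      · by_cases h2 : (ω (q i)).1 = K i
        · have h3 : ω (q i) = ⟨K i, hm i⟩ := Subtype.ext h2
          have h4 : ∀ k ∈ insert i S, (ω (q k)).1 = K k := (Finset.forall_mem_insert _ _ _).2 ⟨h2, h1⟩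
          rw [if_pos h1, if_pos h4, if_pos h3]; ring
        · have h3 : ω (q i) ≠ ⟨K i, hm i⟩ := fun h => h2 (congrArg Subtype.val h)
          have h4 : ¬ ∀ k ∈ insert i S, (ω (q k)).1 = K k :=
            fun h => h2 (h i (Finset.mem_insert_self _ _))
          rw [if_pos h1, if_neg h4, if_neg h3]; ring
      · have h4 : ¬ ∀ k ∈ insert i S, (ω (q k)).1 = K k :=
          fun h => h1 fun k hk => h k (Finset.mem_insert_of_mem hk)
        rw [if_neg h1, if_neg h4]; ring
  have := key Finset.univ
  rw [Finset.card_univ, Fintype.card_fin] at this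
  rw [← this, wt]
  congr 1
  refine Finset.sum_congr rfl fun ω _ => ?_
  unfold ind
  congr 1
  apply propext
  constructor
  · intro h i _
    exact h i ⟨π i, hπ i⟩ (hm i)
  · intro h i p hp
    have e : p = ⟨π i, hπ i⟩ := Subtype.ext (part_unique hsys p.2 (hπ i) hp (hm i))
    subst e
    exact h i (Finset.mem_univ _)

end sys
end HidPf
namespace HidPf

open scoped Classical

section sys

variable {d : ℕ} {X : Fin d → Type*} {P : ∀ i, Set (Set (Set (X i)))}

/-- total number of hidden partitions -/
noncomputable def hc (P : ∀ i, Set (Set (Set (X i)))) (G : Set (∀ i, Set (X i))) : ℕ :=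
  ∑ i, (hiddenSet P G i).ncard

noncomputable def hidF (P : ∀ i, Set (Set (Set (X i)))) [Fintype (JJ P)]
    (G : Set (∀ i, Set (X i))) : Finset (JJ P) :=
  Finset.univ.filter fun j => HiddenIn P G j.1 j.2.1

lemma card_hidF [Fintype (JJ P)] (hsys : IsBoxSystem X P) (G : Set (∀ i, Set (X i))) :
    (hidF P G).card = hc P G := by
  have : ∀ i, Fintype ↥(P i) := fun i => (hsys.2.1 i).fintype
  have e : hidF P G = Finset.univ.sigma fun i =>
      Finset.univ.filter fun p : ↥(P i) => HiddenIn P G i p.1 := by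
    ext ⟨i, p⟩
    simp [hidF]
  rw [e, Finset.card_sigma, hc]
  refine Finset.sum_congr rfl fun i _ => ?_
  rw [← Set.ncard_coe_finset, ← Set.ncard_image_of_injective _ Subtype.val_injective]
  congr 1
  ext π
  simp only [Finset.coe_filter, Finset.mem_univ, true_and, Set.mem_image, Set.mem_ofPred_eq,
    hiddenSet]
  constructor
  · rintro ⟨p, hp, rfl⟩; exact hp
  · intro h; exact ⟨⟨π, h.1⟩, h, rfl⟩

noncomputable def wj [Fintype (Om P)] (G : Finset (∀ i, Set (X i))) (j : JJ P) : ℚ :=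
  ∑ L ∈ G, if L j.1 ∈ j.2.1 then wt (P := P) L else 0

noncomputable def phi (n : ℕ) (K : ∀ i, Set (X i)) : Option (JJ P) → (∀ i, Set (X i)) → ℚ
  | none, _ => 1
  | some j, L => if K j.1 ∈ j.2.1 then yy n j (K j.1) L else 0

noncomputable def bet [Fintype (Om P)] (G : Finset (∀ i, Set (X i))) : Option (JJ P) → ℚ
  | none => 1 / ∑ L ∈ G, wt (P := P) L
  | some j => 1 / wj G j

noncomputable def NN [Fintype (Om P)] (n : ℕ) (G : Finset (∀ i, Set (X i)))
    (K : ∀ i, Set (X i)) : Option (JJ P) → ℚ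
  | none => ∑ L ∈ G, wt (P := P) L
  | some j => if K j.1 ∈ j.2.1 then (n - 1) * wj G j else 0

lemma wj_pos [Fintype (Om P)] (hsys : IsBoxSystem X P) {G : Finset (∀ i, Set (X i))} {j : JJ P}
    (hh : HiddenIn P (G : Set (∀ i, Set (X i))) j.1 j.2.1) : 0 < wj G j := by
  obtain ⟨K, hK⟩ := hh.2.2.1.1
  refine Finset.sum_pos' (fun L _ => ?_) ⟨K, hK.1, ?_⟩
  · split_ifs
    · exact (wt_pos hsys L).le
    · exact le_rfl
  · rw [if_pos hK.2]; exact wt_pos hsys K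

lemma bessel_app [Fintype (Om P)] [Fintype (JJ P)] (hsys : IsBoxSystem X P) (n : ℕ)
    (hcard : ∀ i, ∀ π ∈ P i, π ≠ {Set.univ} → π.ncard = n)
    {G : Finset (∀ i, Set (X i))} (hG : IsKellerFamily P (G : Set (∀ i, Set (X i))))
    {K : ∀ i, Set (X i)} (hK : K ∈ G) :
    ∑ L ∈ G, wt (P := P) L * ((if L = K then 1 else 0) - wt (P := P) K *
        ∑ t ∈ Finset.insertNone (hidF P (G : Set (∀ i, Set (X i)))), bet G t * phi n K t L) ^ 2
      = wt (P := P) K * (1 - wt (P := P) K *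
        ∑ t ∈ Finset.insertNone (hidF P (G : Set (∀ i, Set (X i)))), bet G t * phi n K t K) := by
  have hid : ∀ j, some j ∈ Finset.insertNone (hidF P (G : Set (∀ i, Set (X i)))) →
      HiddenIn P (G : Set (∀ i, Set (X i))) j.1 j.2.1 := by
    intro j hj
    simpa [hidF] using hj
  have hnn : ∀ j : JJ P, HiddenIn P (G : Set (∀ i, Set (X i))) j.1 j.2.1 → j.2.1.ncard = n :=
    fun j hh => hcard _ _ hh.1 hh.2.1
  have hWpos : 0 < ∑ L ∈ G, wt (P := P) L :=
    Finset.sum_pos (fun L _ => wt_pos hsys L) ⟨K, hK⟩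
  have h0 : ∀ j : JJ P, HiddenIn P (G : Set (∀ i, Set (X i))) j.1 j.2.1 →
      ∑ L ∈ G, wt (P := P) L * phi n K (some j) L = 0 := by
    intro j hj
    simp only [phi]
    by_cases hm : K j.1 ∈ j.2.1
    · simp only [if_pos hm]
      exact sum_wt_yy hsys hG n j (hnn j hj) ⟨_, hm⟩ hj
    · simp [hm]
  apply bessel G _ (wt (P := P)) (phi n K) (bet G) (NN n G K) K hK
  · rintro (_ | j) hs (_ | k) ht hne
    · exact absurd rfl hne
    · have := h0 k (hid k ht)
      simpa only [phi, one_mul] using this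
    · have := h0 j (hid j hs)
      simpa only [phi, mul_one] using this
    · simp only [phi]
      by_cases h1 : K j.1 ∈ j.2.1
      · by_cases h2 : K k.1 ∈ k.2.1
        · simp only [if_pos h1, if_pos h2]
          exact sum_wt_yy_yy hsys hG n j k (hnn j (hid j hs)) (hnn k (hid k ht))
            (fun h => hne (congrArg some h)) ⟨_, h1⟩ ⟨_, h2⟩ (hid j hs)
        · simp [h2]
      · simp [h1]
  · rintro (_ | j) ht
    · simp [phi, NN]
    · have h00 := h0 j (hid j ht)
      simp only [phi, NN] at h00 ⊢
      by_cases h1 : K j.1 ∈ j.2.1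
      · simp only [if_pos h1] at h00 ⊢
        have e : ∀ L ∈ G, wt (P := P) L * (yy n j (K j.1) L * yy n j (K j.1) L)
            = ((n:ℚ) - 2) * (wt (P := P) L * yy n j (K j.1) L)
              + ((n:ℚ) - 1) * (if L j.1 ∈ j.2.1 then wt (P := P) L else 0) := by
          intro L _
          unfold yy
          split_ifs <;> ring
        rw [Finset.sum_congr rfl e, Finset.sum_add_distrib, ← Finset.mul_sum, ← Finset.mul_sum, h00,
          wj]
        ring
      · simp [h1]
  · rintro (_ | j) ht
    · simp only [phi, NN, bet]
      field_simp
    · have := wj_pos hsys (hid j ht)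
      simp only [phi, NN, bet]
      by_cases h1 : K j.1 ∈ j.2.1
      · simp only [if_pos h1, yy]
        field_simp
        simp
      · simp [h1]

lemma sum_bessel [Fintype (Om P)] [Fintype (JJ P)] (hsys : IsBoxSystem X P) (n : ℕ)
    {G : Finset (∀ i, Set (X i))} (hG : IsKellerFamily P (G : Set (∀ i, Set (X i)))) :
    ∑ K ∈ G, (1 - wt (P := P) K *
        ∑ t ∈ Finset.insertNone (hidF P (G : Set (∀ i, Set (X i)))), bet G t * phi n K t K)
      = G.card - (1 + (n - 1) * hc P (G : Set (∀ i, Set (X i)))) := by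
  have hne : G.Nonempty := by simpa using hG.1
  have hWpos : 0 < ∑ L ∈ G, wt (P := P) L :=
    Finset.sum_pos (fun L _ => wt_pos hsys L) hne
  rw [Finset.sum_sub_distrib]
  congr 1
  · simp
  simp_rw [Finset.mul_sum]
  rw [Finset.sum_comm, Finset.sum_insertNone]
  congr 1
  · simp only [bet, phi, mul_one]
    rw [← Finset.sum_mul]
    field_simp
  · rw [← card_hidF hsys]
    rw [Finset.sum_congr rfl (g := fun _ => (n:ℚ) - 1)]
    · simp only [Finset.sum_const, nsmul_eq_mul]; ring
    · intro j hj
      have hh : HiddenIn P (G : Set (∀ i, Set (X i))) j.1 j.2.1 := by simpa [hidF] using hj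
      have hp := wj_pos hsys hh
      have e : ∀ K ∈ G, wt (P := P) K * (bet G (some j) * phi n K (some j) K)
          = (1 / wj G j * (n - 1)) * (if K j.1 ∈ j.2.1 then wt (P := P) K else 0) := by
        intro K _
        simp only [bet, phi, yy]
        split_ifs
        · ring
        · ring
      rw [Finset.sum_congr rfl e, ← Finset.mul_sum]
      change 1 / wj G j * (n - 1) * wj G j = n - 1
      field_simp

lemma mainA [Fintype (Om P)] [Fintype (JJ P)] (hsys : IsBoxSystem X P) (n : ℕ) (hn : 2 ≤ n)
    (hcard : ∀ i, ∀ π ∈ P i, π ≠ {Set.univ} → π.ncard = n)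
    {G : Finset (∀ i, Set (X i))} (hG : IsKellerFamily P (G : Set (∀ i, Set (X i)))) :
    ((n:ℚ) - 1) * hc P (G : Set (∀ i, Set (X i))) + 1 ≤ G.card ∧
    (((n:ℚ) - 1) * hc P (G : Set (∀ i, Set (X i))) + 1 = G.card →
      (∃ K, G = {K}) ∨ ∃ j : JJ P, HiddenIn P (G : Set (∀ i, Set (X i))) j.1 j.2.1 ∧
        ∀ K ∈ G, K j.1 ∈ j.2.1) := by
  have hsum := sum_bessel hsys n hG
  have hterm : ∀ K ∈ G, 0 ≤ 1 - wt (P := P) K *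
      ∑ t ∈ Finset.insertNone (hidF P (G : Set (∀ i, Set (X i)))), bet G t * phi n K t K := by
    intro K hK
    have hb := bessel_app hsys n hcard hG hK
    have hp := wt_pos (P := P) hsys K
    have : 0 ≤ wt (P := P) K * (1 - wt (P := P) K *
        ∑ t ∈ Finset.insertNone (hidF P (G : Set (∀ i, Set (X i)))), bet G t * phi n K t K) := by
      rw [← hb]
      exact Finset.sum_nonneg fun L _ => mul_nonneg (wt_pos hsys L).le (sq_nonneg _)
    exact nonneg_of_mul_nonneg_right this hp
  constructor
  · have := Finset.sum_nonneg hterm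
    linarith
  intro heq
  rw [← heq] at hsum
  have hz := (Finset.sum_eq_zero_iff_of_nonneg hterm).1 (by rw [hsum]; ring)
  obtain ⟨K, hK⟩ := hG.1
  have hK : K ∈ G := hK
  have hr : ∀ L ∈ G, (if L = K then (1:ℚ) else 0) = wt (P := P) K *
        ∑ t ∈ Finset.insertNone (hidF P (G : Set (∀ i, Set (X i)))), bet G t * phi n K t L := by
    intro L hL
    have hb := bessel_app hsys n hcard hG hK
    rw [hz K hK, mul_zero, Finset.sum_eq_zero_iff_of_nonneg
      (fun L _ => mul_nonneg (wt_pos hsys L).le (sq_nonneg _))] at hb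
    have := hb L hL
    have hp := wt_pos (P := P) hsys L
    rcases mul_eq_zero.1 this with h | h
    · exact absurd h hp.ne'
    · exact sub_eq_zero.1 (pow_eq_zero_iff (by norm_num) |>.1 h)
  obtain ⟨ω, hω⟩ := exists_lift (P := P) hsys K
  have hω' : ∀ j : JJ P, ∃ A : ↥(j.2.1), j ∈ hidF P (G : Set (∀ i, Set (X i))) → A.1 ≠ K j.1 := by
    intro j
    by_cases hj : j ∈ hidF P (G : Set (∀ i, Set (X i)))
    · have hh : HiddenIn P (G : Set (∀ i, Set (X i))) j.1 j.2.1 := by simpa [hidF] using hj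
      have hc := hcard _ _ hh.1 hh.2.1
      obtain ⟨A, hA, hne⟩ := Set.exists_ne_of_one_lt_ncard (s := j.2.1) (by omega) (K j.1)
      exact ⟨⟨A, hA⟩, fun _ => hne⟩
    · exact ⟨ω j, fun h => absurd h hj⟩
  choose ω' hω' using hω'
  obtain ⟨L, hL, hlift⟩ := union_inv_many hsys (G := (G : Set (∀ i, Set (X i)))) (hidF P (G : Set (∀ i, Set (X i))))
    (fun j hj => by simpa [hidF] using hj) ω ω' ⟨K, hK, hω⟩
  have hL : L ∈ G := hL
  have hphi : ∀ j ∈ hidF P (G : Set (∀ i, Set (X i))), phi n K (some j) L = 0 ∨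
      phi n K (some j) L = -1 := by
    intro j hj
    simp only [phi, yy]
    by_cases h1 : K j.1 ∈ j.2.1
    · by_cases h2 : L j.1 ∈ j.2.1
      · right
        have := hlift j.1 j.2 h2
        simp only [Sigma.eta, if_pos hj] at this
        have hne : L j.1 ≠ K j.1 := this ▸ hω' j hj
        simp [h1, h2, hne]
      · left; simp [h2]
    · left; simp [h1]
  have hWpos : 0 < ∑ L ∈ G, wt (P := P) L :=
    Finset.sum_pos (fun L _ => wt_pos hsys L) ⟨K, hK⟩
  by_cases hex : ∃ j ∈ hidF P (G : Set (∀ i, Set (X i))), ∀ M ∈ G, M j.1 ∈ j.2.1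
  · obtain ⟨j, hj, hM⟩ := hex
    exact Or.inr ⟨j, by simpa [hidF] using hj, hM⟩
  left
  push Not at hex
  have hlt : ∀ j ∈ hidF P (G : Set (∀ i, Set (X i))), wj G j < ∑ L ∈ G, wt (P := P) L := by
    intro j hj
    obtain ⟨M, hM, hMj⟩ := hex j hj
    refine Finset.sum_lt_sum (fun L _ => ?_) ⟨M, hM, ?_⟩
    · split_ifs
      · exact le_rfl
      · exact (wt_pos hsys L).le
    · rw [if_neg hMj]; exact wt_pos hsys M
  have hrL := hr L hL
  rw [Finset.sum_insertNone] at hrL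
  have hKpos := wt_pos (P := P) hsys K
  by_cases hall : ∀ j ∈ hidF P (G : Set (∀ i, Set (X i))), phi n K (some j) L = 0
  · rw [Finset.sum_eq_zero (fun j hj => by rw [hall j hj, mul_zero])] at hrL
    simp only [bet, phi, mul_one, add_zero] at hrL
    by_cases hLK : L = K
    · rw [if_pos hLK] at hrL
      have hw : ∑ M ∈ G, wt (P := P) M = wt (P := P) K := by
        field_simp at hrL
        exact hrL
      refine ⟨K, ?_⟩
      rw [Finset.eq_singleton_iff_unique_mem]
      refine ⟨hK, fun M hM => ?_⟩
      by_contra hne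
      have : ∑ M' ∈ ({K, M} : Finset _), wt (P := P) M' ≤ ∑ M ∈ G, wt (P := P) M := by
        apply Finset.sum_le_sum_of_subset_of_nonneg
        · intro x hx
          simp only [Finset.mem_insert, Finset.mem_singleton] at hx
          rcases hx with rfl | rfl <;> assumption
        · intro M _ _; exact (wt_pos hsys M).le
      rw [Finset.sum_pair (Ne.symm hne), hw] at this
      have := wt_pos (P := P) hsys M
      linarith
    · rw [if_neg hLK] at hrL
      have : 0 < wt (P := P) K * (1 / ∑ L ∈ G, wt (P := P) L) := by positivity
      linarith
  · exfalso
    push Not at hall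
    obtain ⟨j, hj, hjne⟩ := hall
    have hj1 : phi n K (some j) L = -1 := (hphi j hj).resolve_left hjne
    have hle : ∑ t ∈ hidF P (G : Set (∀ i, Set (X i))), bet G (some t) * phi n K (some t) L
        ≤ bet G (some j) * phi n K (some j) L := by
      rw [← Finset.add_sum_erase _ _ hj]
      have : ∑ t ∈ (hidF P (G : Set (∀ i, Set (X i)))).erase j,
          bet G (some t) * phi n K (some t) L ≤ 0 := by
        apply Finset.sum_nonpos
        intro t ht
        have ht := Finset.mem_of_mem_erase ht
        have hp : 0 < wj G t := wj_pos hsys (by simpa [hidF] using ht)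
        have hb : 0 < bet G (some t) := by simp only [bet]; positivity
        rcases hphi t ht with h | h <;> rw [h] <;> linarith
      linarith
    rw [hj1] at hle
    have hp : 0 < wj G j := wj_pos hsys (by simpa [hidF] using hj)
    have hbb : bet G (none : Option (JJ P)) * phi n K (none : Option (JJ P)) L < bet G (some j) := by
      simp only [bet, phi, mul_one]
      exact one_div_lt_one_div_of_lt hp (hlt j hj)
    have hneg : wt (P := P) K * (bet G (none : Option (JJ P)) * phi n K (none : Option (JJ P)) L +
        ∑ t ∈ hidF P (G : Set (∀ i, Set (X i))), bet G (some t) * phi n K (some t) L) < 0 :=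
      mul_neg_of_pos_of_neg hKpos (by linarith)
    have : (0:ℚ) ≤ if L = K then 1 else 0 := by split_ifs <;> norm_num
    linarith

end sys
end HidPf
namespace HidPf

open scoped Classical

lemma card_biUnion_lt {α β : Type*} [DecidableEq β] (T : Finset α) (C : α → Finset β) {A B : α} (hA : A ∈ T)
    (hB : B ∈ T) (hne : A ≠ B) {ρ : β} (h1 : ρ ∈ C A) (h2 : ρ ∈ C B) :
    (T.biUnion C).card < ∑ A ∈ T, (C A).card := by
  have hsub : T.biUnion C ⊆ (T.erase A).biUnion C ∪ (C A).erase ρ := by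
    intro σ hσ
    obtain ⟨D, hD, hσD⟩ := Finset.mem_biUnion.1 hσ
    rw [Finset.mem_union]
    by_cases hDA : D = A
    · subst hDA
      by_cases hs : σ = ρ
      · subst hs
        exact Or.inl (Finset.mem_biUnion.2 ⟨B, Finset.mem_erase.2 ⟨hne.symm, hB⟩, h2⟩)
      · exact Or.inr (Finset.mem_erase.2 ⟨hs, hσD⟩)
    · exact Or.inl (Finset.mem_biUnion.2 ⟨D, Finset.mem_erase.2 ⟨hDA, hD⟩, hσD⟩)
  have c1 := Finset.card_le_card hsub
  have c2 := Finset.card_union_le ((T.erase A).biUnion C) ((C A).erase ρ)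
  have c3 : ((T.erase A).biUnion C).card ≤ ∑ D ∈ T.erase A, (C D).card := Finset.card_biUnion_le
  have c4 := Finset.card_erase_lt_of_mem h1
  have c5 : (C A).card + ∑ D ∈ T.erase A, (C D).card = ∑ D ∈ T, (C D).card :=
    Finset.add_sum_erase T (fun D => (C D).card) hA
  omega

section sys

variable {d : ℕ} {X : Fin d → Type*} {P : ∀ i, Set (Set (Set (X i)))}

lemma fin_of_boxes (hsys : IsBoxSystem X P) {G : Set (∀ i, Set (X i))}
    (h : ∀ K ∈ G, IsBox P K) : G.Finite := by
  have hf : (Set.univ.pi fun i => ⋃₀ (P i)).Finite := by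
    apply Set.Finite.pi
    intro i
    exact (hsys.2.1 i).sUnion (hsys.2.2.1 i)
  refine hf.subset fun K hK i _ => ?_
  obtain ⟨π, hπ, hm⟩ := h K hK i
  exact ⟨π, hπ, hm⟩

lemma finJ (hsys : IsBoxSystem X P) : Finite (JJ P) := by
  have : ∀ i, Finite ↥(P i) := fun i => hsys.2.1 i
  infer_instance

lemma finOm (hsys : IsBoxSystem X P) : Finite (Om P) := by
  have := finJ hsys
  have : ∀ j : JJ P, Finite ↥(j.2.1) := fun j => hsys.2.2.1 j.1 j.2.1 j.2.2
  infer_instance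

lemma mainS (hsys : IsBoxSystem X P) (n : ℕ) (hn : 2 ≤ n)
    (hcard : ∀ i, ∀ π ∈ P i, π ≠ {Set.univ} → π.ncard = n)
    {G : Set (∀ i, Set (X i))} (hG : IsKellerFamily P G) :
    (n - 1) * hc P G + 1 ≤ G.ncard ∧ ((n - 1) * hc P G + 1 = G.ncard →
      (∃ K, G = {K}) ∨ ∃ i π, HiddenIn P G i π ∧ restrictFam G i π = G) := by
  have := finJ hsys
  have := finOm hsys
  have : Fintype (JJ P) := Fintype.ofFinite _
  have : Fintype (Om P) := Fintype.ofFinite _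
  obtain ⟨F, rfl⟩ := (fin_of_boxes hsys hG.2.1).exists_finset_coe
  obtain ⟨h1, h2⟩ := mainA hsys n hn hcard hG
  have e : (((n - 1) * hc P (F : Set (∀ i, Set (X i))) + 1 : ℕ) : ℚ)
      = ((n:ℚ) - 1) * hc P (F : Set (∀ i, Set (X i))) + 1 := by
    push_cast [Nat.cast_sub (show 1 ≤ n by omega)]
    ring
  rw [← e] at h1 h2
  rw [Set.ncard_coe_finset]
  refine ⟨by exact_mod_cast h1, fun heq => ?_⟩
  rcases h2 (by exact_mod_cast heq) with ⟨K, hK⟩ | ⟨j, hj, hK⟩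
  · exact Or.inl ⟨K, by simp [hK]⟩
  · refine Or.inr ⟨j.1, j.2.1, hj, ?_⟩
    ext K
    exact ⟨fun h => h.1, fun h => ⟨h, hK K h⟩⟩

lemma card_le (hsys : IsBoxSystem X P) (n : ℕ) (hn : 2 ≤ n)
    (hcard : ∀ i, ∀ π ∈ P i, π ≠ {Set.univ} → π.ncard = n)
    {G : Set (∀ i, Set (X i))} (hG : IsKellerFamily P G)
    (hproper : ∀ K ∈ G, ∀ i, K i ≠ Set.univ) : G.ncard ≤ n ^ d := by
  have := finJ hsys
  have := finOm hsys
  have : Fintype (Om P) := Fintype.ofFinite _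
  obtain ⟨F, rfl⟩ := (fin_of_boxes hsys hG.2.1).exists_finset_coe
  rw [Set.ncard_coe_finset]
  have h1 := wt_le hG
  have h2 : ∀ K ∈ F, wt (P := P) K = (Fintype.card (Om P) : ℚ) / (n:ℚ) ^ d := by
    intro K hK
    rw [← wt_proper hsys n hcard (hG.2.1 K hK) (hproper K hK)]
    have : (n:ℚ) ≠ 0 := by positivity
    field_simp
  rw [Finset.sum_congr rfl h2, Finset.sum_const, nsmul_eq_mul] at h1
  have hpos : (0:ℚ) < Fintype.card (Om P) := by
    obtain ⟨ω, -⟩ := exists_lift (P := P) hsys (fun _ => Set.univ)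
    exact_mod_cast Fintype.card_pos_iff.2 ⟨ω⟩
  have hnp : (0:ℚ) < (n:ℚ) ^ d := by positivity
  rw [mul_div_assoc', div_le_iff₀ hnp, mul_comm] at h1
  have := le_of_mul_le_mul_left h1 hpos
  exact_mod_cast this

lemma mem_poly {G : Set (∀ i, Set (X i))} {x : ∀ i, X i} :
    x ∈ polyUnion G ↔ ∃ K ∈ G, ∀ i, x i ∈ K i := by
  simp [polyUnion, boxSet, Set.mem_pi]

lemma box_point (hsys : IsBoxSystem X P) {K : ∀ i, Set (X i)} (hK : IsBox P K) :
    ∃ x : ∀ i, X i, ∀ i, x i ∈ K i := by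
  have : ∀ i, ∃ x, x ∈ K i := by
    intro i
    obtain ⟨π, hπ, hm⟩ := hK i
    exact (hsys.2.2.2.1 i π hπ).1 _ hm
  choose x hx using this
  exact ⟨x, hx⟩

lemma keller_sub {G H : Set (∀ i, Set (X i))} (hG : IsKellerFamily P G) (hH : H ⊆ G)
    (hne : H.Nonempty) : IsKellerFamily P H :=
  ⟨hne, fun K hK => hG.2.1 K (hH hK), fun K hK L hL => hG.2.2 K (hH hK) L (hH hL)⟩

lemma restrict_sub (G : Set (∀ i, Set (X i))) (i : Fin d) (V : Set (Set (X i))) :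
    restrictFam G i V ⊆ G := fun _ h => h.1

/-- data of a pile -/
structure Pile (P : ∀ i, Set (Set (Set (X i)))) (G : Set (∀ i, Set (X i))) (i : Fin d)
    (π : Set (Set (X i))) : Prop where
  hπ : π ∈ P i
  hnt : π ≠ {Set.univ}
  hK : IsKellerFamily P G
  hlam : restrictFam G i π = G
  hcyl : IsCylinder i (polyUnion G)

namespace Pile

variable {G : Set (∀ i, Set (X i))} {i : Fin d} {π : Set (Set (X i))}

lemma mem (h : Pile P G i π) {K : ∀ i, Set (X i)} (hK : K ∈ G) : K i ∈ π := by
  rw [← h.hlam] at hK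
  exact hK.2

lemma hidden (h : Pile P G i π) : HiddenIn P G i π :=
  ⟨h.hπ, h.hnt, by rw [h.hlam]; exact h.hK, by rw [h.hlam]; exact h.hcyl⟩

lemma ne (h : Pile P G i π) (hsys : IsBoxSystem X P) {A : Set (X i)} (hA : A ∈ π) :
    (restrictFam G i {A}).Nonempty := by
  have hp := hsys.2.2.2.1 i π h.hπ
  obtain ⟨K, hK⟩ := h.hK.1
  obtain ⟨x, hx⟩ := box_point hsys (h.hK.2.1 K hK)
  obtain ⟨y, hy⟩ := hp.1 A hA
  obtain ⟨L, hL, hl⟩ := mem_poly.1 (h.hcyl x (mem_poly.2 ⟨K, hK, hx⟩) y)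
  have := hl i
  rw [Function.update_self] at this
  exact ⟨L, hL, part_eq hp (h.mem hL) hA this hy⟩

lemma sub_keller (h : Pile P G i π) (hsys : IsBoxSystem X P) {A : Set (X i)} (hA : A ∈ π) :
    IsKellerFamily P (restrictFam G i {A}) :=
  keller_sub h.hK (restrict_sub _ _ _) (h.ne hsys hA)

lemma hid_i (h : Pile P G i π) (hsys : IsBoxSystem X P) : hiddenSet P G i = {π} := by
  ext ρ
  constructor
  · intro hρ
    obtain ⟨K, hK⟩ := hρ.2.2.1.1
    exact part_unique hsys hρ.1 h.hπ hK.2 (h.mem hK.1)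
  · rintro rfl
    exact h.hidden

lemma ne_univ (h : Pile P G i π) (hsys : IsBoxSystem X P) {A : Set (X i)} (hA : A ∈ π) :
    A ≠ Set.univ := by
  rintro rfl
  exact h.hnt (eq_triv (hsys.2.2.2.1 i π h.hπ) hA)

lemma hid_i_sub (h : Pile P G i π) (hsys : IsBoxSystem X P) {A : Set (X i)} (hA : A ∈ π) :
    hiddenSet P (restrictFam G i {A}) i = ∅ := by
  rw [Set.eq_empty_iff_forall_notMem]
  intro ρ hρ
  obtain ⟨K, hK⟩ := hρ.2.2.1.1
  obtain ⟨x, hx⟩ := box_point hsys (h.hK.2.1 K hK.1.1)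
  obtain ⟨y, hy⟩ := (Set.ne_univ_iff_exists_notMem A).1 (h.ne_univ hsys hA)
  obtain ⟨L, hL, hl⟩ := mem_poly.1 (hρ.2.2.2 x (mem_poly.2 ⟨K, hK, hx⟩) y)
  have := hl i
  rw [Function.update_self] at this
  have e : L i = A := hL.1.2
  exact hy (e ▸ this)

lemma hid_k (h : Pile P G i π) (hsys : IsBoxSystem X P) {k : Fin d} (hk : k ≠ i)
    {ρ : Set (Set (X k))} (hρ : HiddenIn P G k ρ) :
    ∃ A ∈ π, HiddenIn P (restrictFam G i {A}) k ρ := by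
  obtain ⟨K, hK⟩ := hρ.2.2.1.1
  have hp := hsys.2.2.2.1 i π h.hπ
  refine ⟨K i, h.mem hK.1, hρ.1, hρ.2.1, keller_sub h.hK
    ((restrict_sub _ _ _).trans (restrict_sub _ _ _)) ⟨K, ⟨hK.1, rfl⟩, hK.2⟩, ?_⟩
  intro x hx y
  obtain ⟨L, hL, hl⟩ := mem_poly.1 hx
  obtain ⟨M, hM, hm⟩ := mem_poly.1 (hρ.2.2.2 x (mem_poly.2 ⟨L, ⟨hL.1.1, hL.2⟩, hl⟩) y)
  refine mem_poly.2 ⟨M, ⟨⟨hM.1, ?_⟩, hM.2⟩, hm⟩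
  have h1 := hm i
  rw [Function.update_of_ne hk.symm] at h1
  have e : L i = K i := hL.1.2
  exact part_eq hp (h.mem hM.1) (h.mem hK.1) h1 (e ▸ hl i)

lemma hid_of_sub (h : Pile P G i π) {k : Fin d}
    {ρ : Set (Set (X k))} (hρ : ρ ∈ P k) (hnt : ρ ≠ {Set.univ}) (hpres : PresentIn G k ρ)
    (hA : ∀ A ∈ π, PresentIn (restrictFam G i {A}) k ρ → HiddenIn P (restrictFam G i {A}) k ρ) :
    HiddenIn P G k ρ := by
  obtain ⟨K, hK, hKρ⟩ := hpres
  refine ⟨hρ, hnt, keller_sub h.hK (restrict_sub _ _ _) ⟨K, hK, hKρ⟩, ?_⟩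
  intro x hx y
  obtain ⟨L, hL, hl⟩ := mem_poly.1 hx
  have hh := hA (L i) (h.mem hL.1) ⟨L, ⟨hL.1, rfl⟩, hL.2⟩
  obtain ⟨M, hM, hm⟩ := mem_poly.1 (hh.2.2.2 x (mem_poly.2 ⟨L, ⟨⟨hL.1, rfl⟩, hL.2⟩, hl⟩) y)
  exact mem_poly.2 ⟨M, ⟨hM.1.1, hM.2⟩, hm⟩

lemma ncard_eq (h : Pile P G i π) (hsys : IsBoxSystem X P) :
    G.ncard = ∑ A ∈ (hsys.2.2.1 i π h.hπ).toFinset, (restrictFam G i {A}).ncard := by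
  have hf := fin_of_boxes hsys h.hK.2.1
  rw [Set.ncard_eq_toFinset_card G hf,
    Finset.card_eq_sum_card_fiberwise (f := fun K => K i) (t := (hsys.2.2.1 i π h.hπ).toFinset)]
  · refine Finset.sum_congr rfl fun A _ => ?_
    rw [← Set.ncard_coe_finset]
    congr 1
    ext K
    simp [restrictFam]
  · intro K hK
    have : K ∈ G := by simpa using hK
    simpa using h.mem this

lemma hc_eq (h : Pile P G i π) (hsys : IsBoxSystem X P) :
    hc P G = 1 + ∑ k ∈ Finset.univ.erase i, (hiddenSet P G k).ncard := by
  rw [hc, ← Finset.add_sum_erase _ _ (Finset.mem_univ i), h.hid_i hsys, Set.ncard_singleton]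

lemma hc_sub (h : Pile P G i π) (hsys : IsBoxSystem X P) {A : Set (X i)} (hA : A ∈ π) :
    hc P (restrictFam G i {A})
      = ∑ k ∈ Finset.univ.erase i, (hiddenSet P (restrictFam G i {A}) k).ncard := by
  rw [hc, ← Finset.add_sum_erase _ _ (Finset.mem_univ i), h.hid_i_sub hsys hA, Set.ncard_empty,
    zero_add]

lemma sum_hc_sub (h : Pile P G i π) (hsys : IsBoxSystem X P) :
    ∑ A ∈ (hsys.2.2.1 i π h.hπ).toFinset, hc P (restrictFam G i {A})
      = ∑ k ∈ Finset.univ.erase i, ∑ A ∈ (hsys.2.2.1 i π h.hπ).toFinset,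
        (hiddenSet P (restrictFam G i {A}) k).ncard := by
  rw [Finset.sum_comm]
  refine Finset.sum_congr rfl fun A hA => h.hc_sub hsys (by simpa using hA)

end Pile

lemma hid_finite (hsys : IsBoxSystem X P) (G : Set (∀ i, Set (X i))) (k : Fin d) :
    (hiddenSet P G k).Finite := (hsys.2.1 k).subset fun _ h => h.1

noncomputable def hidFin (hsys : IsBoxSystem X P) (G : Set (∀ i, Set (X i))) (k : Fin d) :
    Finset (Set (Set (X k))) := (hid_finite hsys G k).toFinset

lemma mem_hidFin {hsys : IsBoxSystem X P} {G : Set (∀ i, Set (X i))} {k : Fin d}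
    {ρ : Set (Set (X k))} : ρ ∈ hidFin hsys G k ↔ HiddenIn P G k ρ := by
  simp [hidFin, hiddenSet]

lemma card_hidFin (hsys : IsBoxSystem X P) (G : Set (∀ i, Set (X i))) (k : Fin d) :
    (hiddenSet P G k).ncard = (hidFin hsys G k).card :=
  Set.ncard_eq_toFinset_card _ _

lemma mp_of_eq (hsys : IsBoxSystem X P) (n : ℕ) (hn : 2 ≤ n)
    (hcard : ∀ i, ∀ π ∈ P i, π ≠ {Set.univ} → π.ncard = n) (m : ℕ) :
    ∀ G : Set (∀ i, Set (X i)), G.ncard = m → IsKellerFamily P G →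
      (n - 1) * hc P G + 1 = G.ncard → IsMultipile P G := by
  induction m using Nat.strong_induction_on with
  | _ m ih =>
    intro G hm hG heq
    rcases (mainS hsys n hn hcard hG).2 heq with ⟨K, rfl⟩ | ⟨i, π, hh, hlam⟩
    · exact IsMultipile.single K (hG.2.1 K rfl)
    have hp : Pile P G i π := ⟨hh.1, hh.2.1, hG, hlam, by have := hh.2.2.2; rwa [hlam] at this⟩
    set T := (hsys.2.2.1 i π hp.hπ).toFinset with hT
    have hTm : ∀ A, A ∈ T ↔ A ∈ π := fun A => by simp [hT]
    have hTc : T.card = n := by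
      rw [← hcard i π hp.hπ hp.hnt, Set.ncard_eq_toFinset_card _ (hsys.2.2.1 i π hp.hπ)]
    have hle : ∀ A ∈ T, (n - 1) * hc P (restrictFam G i {A}) + 1 ≤ (restrictFam G i {A}).ncard :=
      fun A hA => (mainS hsys n hn hcard (hp.sub_keller hsys ((hTm A).1 hA))).1
    have hcardG := hp.ncard_eq hsys
    rw [← hT] at hcardG
    have hsub : ∀ k ∈ Finset.univ.erase i, hidFin hsys G k ⊆
        T.biUnion fun A => hidFin hsys (restrictFam G i {A}) k := by
      intro k hk ρ hρ
      obtain ⟨A, hA, h⟩ := hp.hid_k hsys (Finset.ne_of_mem_erase hk) (mem_hidFin.1 hρ)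
      exact Finset.mem_biUnion.2 ⟨A, (hTm A).2 hA, mem_hidFin.2 h⟩
    have hk1 : ∀ k ∈ Finset.univ.erase i, (hiddenSet P G k).ncard ≤
        ∑ A ∈ T, (hiddenSet P (restrictFam G i {A}) k).ncard := by
      intro k hk
      simp_rw [card_hidFin hsys]
      exact (Finset.card_le_card (hsub k hk)).trans Finset.card_biUnion_le
    have e1 := hp.hc_eq hsys
    have e2 := hp.sum_hc_sub hsys
    rw [← hT] at e2
    have e3 := Finset.sum_le_sum hk1
    rw [← e2] at e3
    have e4 := Finset.sum_le_sum hle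
    rw [← hcardG, Finset.sum_add_distrib, ← Finset.mul_sum, Finset.sum_const, hTc, smul_eq_mul,
      mul_one] at e4
    set s := ∑ A ∈ T, hc P (restrictFam G i {A}) with hs
    set t := ∑ k ∈ Finset.univ.erase i, (hiddenSet P G k).ncard with ht
    have hts : t = s := by
      have : (n - 1) * s ≤ (n - 1) * t := by
        rw [e1, mul_add] at heq
        omega
      exact le_antisymm e3 (Nat.le_of_mul_le_mul_left this (by omega))
    have heach : ∀ A ∈ T, (n - 1) * hc P (restrictFam G i {A}) + 1
        = (restrictFam G i {A}).ncard := by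
      refine (Finset.sum_eq_sum_iff_of_le hle).1 ?_
      rw [← hcardG, Finset.sum_add_distrib, ← Finset.mul_sum, Finset.sum_const, hTc, smul_eq_mul,
        mul_one, ← hs, ← heq, e1, hts, mul_add]
      omega
    have hkeach := (Finset.sum_eq_sum_iff_of_le hk1).1 (by rw [← e2, ← ht, hts])
    refine IsMultipile.pile G i π hp.hπ hp.hnt hG hlam hp.hcyl ?_ ?_
    · intro A hA
      refine ih _ ?_ _ rfl (hp.sub_keller hsys hA) (heach A ((hTm A).2 hA))
      rw [← hm]
      refine Set.ncard_lt_ncard ?_ (fin_of_boxes hsys hG.2.1)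
      refine ⟨restrict_sub _ _ _, fun hcon => ?_⟩
      obtain ⟨B, hB, hne⟩ := Set.exists_ne_of_one_lt_ncard (s := π)
        (by rw [hcard i π hp.hπ hp.hnt]; omega) A
      obtain ⟨L, hL⟩ := hp.ne hsys hB
      have h1 : L i = A := (hcon hL.1).2
      have h2 : L i = B := hL.2
      exact hne (h2.symm.trans h1)
    · rintro k hk A hA B hB hAB ρ ⟨hρA, hρB⟩
      have hk' : k ∈ Finset.univ.erase i := Finset.mem_erase.2 ⟨hk, Finset.mem_univ _⟩
      have h1 := hkeach k hk'
      simp_rw [card_hidFin hsys] at h1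
      have h2 := Finset.card_le_card (hsub k hk')
      have h3 := card_biUnion_lt T (fun A => hidFin hsys (restrictFam G i {A}) k)
        ((hTm A).2 hA) ((hTm B).2 hB) hAB (mem_hidFin.2 hρA) (mem_hidFin.2 hρB)
      omega

lemma cyl_univ {G : Set (∀ i, Set (X i))} {M : ∀ i, Set (X i)}
    (hM : polyUnion G = boxSet M) {H : Set (∀ i, Set (X i))} (hH : H ⊆ G) {k : Fin d}
    (hcyl : IsCylinder k (polyUnion H)) {x : ∀ i, X i} (hx : x ∈ polyUnion H) :
    M k = Set.univ := by
  rw [Set.eq_univ_iff_forall]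
  intro y
  obtain ⟨L, hL, hl⟩ := mem_poly.1 (hcyl x hx y)
  have : Function.update x k y ∈ boxSet M := hM ▸ mem_poly.2 ⟨L, hH hL, hl⟩
  simpa using this k trivial

lemma hid_univ (hsys : IsBoxSystem X P) {G : Set (∀ i, Set (X i))} {M : ∀ i, Set (X i)}
    (hM : polyUnion G = boxSet M) {k : Fin d} {ρ : Set (Set (X k))} (h : HiddenIn P G k ρ) :
    M k = Set.univ := by
  obtain ⟨K, hK⟩ := h.2.2.1.1
  obtain ⟨x, hx⟩ := box_point hsys (h.2.2.1.2.1 K hK)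
  exact cyl_univ hM (restrict_sub _ _ _) h.2.2.2 (mem_poly.2 ⟨K, hK, hx⟩)

lemma poly_single (K : ∀ i, Set (X i)) : polyUnion {K} = boxSet K := by
  simp [polyUnion]

lemma eq_of_mp (hsys : IsBoxSystem X P) (n : ℕ) (hn : 2 ≤ n)
    (hcard : ∀ i, ∀ π ∈ P i, π ≠ {Set.univ} → π.ncard = n)
    {G : Set (∀ i, Set (X i))} (h : IsMultipile P G) :
    ∀ M : ∀ i, Set (X i), polyUnion G = boxSet M → (∀ K ∈ G, ∀ i, K i ≠ Set.univ) →
      G.ncard = n ^ (Finset.univ.filter fun j => M j = Set.univ).card ∧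
      (n - 1) * hc P G + 1 = G.ncard ∧
      ∀ k, M k = Set.univ → ∀ ρ ∈ P k, ρ ≠ {Set.univ} → PresentIn G k ρ → HiddenIn P G k ρ := by
  induction h with
  | single K hK =>
    intro M hM hpr
    have hne : ∀ k, M k ≠ Set.univ := by
      intro k hk
      apply hpr K rfl k
      rw [Set.eq_univ_iff_forall]
      intro y
      obtain ⟨x, hx⟩ := box_point hsys hK
      rw [poly_single] at hM
      have hxM : x ∈ boxSet M := hM ▸ fun j _ => hx j
      have : Function.update x k y ∈ boxSet K := by
        rw [hM]
        intro j _
        by_cases hj : j = k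
        · subst hj; rw [hk]; trivial
        · rw [Function.update_of_ne hj]; exact hxM j trivial
      simpa using this k trivial
    have h0 : hc P {K} = 0 := by
      rw [hc]
      refine Finset.sum_eq_zero fun k _ => ?_
      have : hiddenSet P {K} k = ∅ := by
        rw [Set.eq_empty_iff_forall_notMem]
        intro ρ hρ
        exact hne k (hid_univ hsys hM hρ)
      rw [this, Set.ncard_empty]
    refine ⟨?_, ?_, fun k hk => absurd hk (hne k)⟩
    · simp [hne]
    · simp [h0]
  | pile G i π hπ hnt hK hlam hcyl hsub hdis ih =>
    intro M hM hpr
    have hp : Pile P G i π := ⟨hπ, hnt, hK, hlam, hcyl⟩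
    have hpart := hsys.2.2.2.1 i π hπ
    have hMi : M i = Set.univ := by
      obtain ⟨K, hKG⟩ := hK.1
      obtain ⟨x, hx⟩ := box_point hsys (hK.2.1 K hKG)
      exact cyl_univ hM subset_rfl hcyl (mem_poly.2 ⟨K, hKG, hx⟩)
    have hMA : ∀ A ∈ π, polyUnion (restrictFam G i {A}) = boxSet (Function.update M i A) := by
      intro A hA
      ext x
      rw [mem_poly]
      constructor
      · rintro ⟨L, hL, hl⟩ j -
        have hxM : x ∈ boxSet M := hM ▸ mem_poly.2 ⟨L, hL.1, hl⟩
        by_cases hj : j = i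
        · subst hj
          have e : L j = A := hL.2
          rw [Function.update_self, ← e]
          exact hl j
        · rw [Function.update_of_ne hj]; exact hxM j trivial
      · intro hx
        have hxi : x i ∈ A := by simpa using hx i trivial
        have hxM : x ∈ boxSet M := by
          intro j _
          by_cases hj : j = i
          · subst hj; rw [hMi]; trivial
          · have := hx j trivial
            rwa [Function.update_of_ne hj] at this
        rw [← hM] at hxM
        obtain ⟨L, hL, hl⟩ := mem_poly.1 hxM
        exact ⟨L, ⟨hL, part_eq hpart (hp.mem hL) hA (hl i) hxi⟩, hl⟩
    have IH := fun A hA => ih A hA (Function.update M i A) (hMA A hA)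
      (fun K hK => hpr K hK.1)
    have hthird : ∀ k, k ≠ i → M k = Set.univ → ∀ ρ ∈ P k, ρ ≠ {Set.univ} → PresentIn G k ρ →
        HiddenIn P G k ρ := by
      intro k hk hMk ρ hρ hρn hpres
      refine hp.hid_of_sub hρ hρn hpres fun A hA hpA => ?_
      exact (IH A hA).2.2 k (by rw [Function.update_of_ne hk]; exact hMk) ρ hρ hρn hpA
    set T := (hsys.2.2.1 i π hp.hπ).toFinset with hT
    have hTm : ∀ A, A ∈ T ↔ A ∈ π := fun A => by simp [hT]
    have hTc : T.card = n := by
      rw [← hcard i π hp.hπ hp.hnt, Set.ncard_eq_toFinset_card _ (hsys.2.2.1 i π hp.hπ)]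
    have hcardG := hp.ncard_eq hsys
    rw [← hT] at hcardG
    refine ⟨?_, ?_, ?_⟩
    · have e : ∀ A ∈ T, (restrictFam G i {A}).ncard
          = n ^ ((Finset.univ.filter fun j => M j = Set.univ).card - 1) := by
        intro A hA
        rw [(IH A ((hTm A).1 hA)).1]
        congr 1
        rw [← Finset.card_erase_of_mem (a := i) (by simp [hMi])]
        congr 1
        ext j
        by_cases hj : j = i
        · subst hj
          simp [hp.ne_univ hsys ((hTm A).1 hA)]
        · simp [hj]
      rw [hcardG, Finset.sum_congr rfl e, Finset.sum_const, hTc, smul_eq_mul, ← pow_succ',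
        Nat.sub_add_cancel]
      exact Finset.card_pos.2 ⟨i, by simp [hMi]⟩
    · have hk1 : ∀ k ∈ Finset.univ.erase i, (hiddenSet P G k).ncard =
          ∑ A ∈ T, (hiddenSet P (restrictFam G i {A}) k).ncard := by
        intro k hk
        have hki := Finset.ne_of_mem_erase hk
        simp_rw [card_hidFin hsys]
        rw [← Finset.card_biUnion]
        · congr 1
          ext ρ
          rw [Finset.mem_biUnion, mem_hidFin]
          constructor
          · intro hρ
            obtain ⟨A, hA, h⟩ := hp.hid_k hsys hki hρ
            exact ⟨A, (hTm A).2 hA, mem_hidFin.2 h⟩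
          · rintro ⟨A, hA, hρ⟩
            have hρ := mem_hidFin.1 hρ
            have hu := hid_univ hsys (hMA A ((hTm A).1 hA)) hρ
            rw [Function.update_of_ne hki] at hu
            obtain ⟨K, hK⟩ := hρ.2.2.1.1
            exact hthird k hki hu ρ hρ.1 hρ.2.1 ⟨K, hK.1.1, hK.2⟩
        · intro A hA B hB hAB
          rw [Function.onFun, Finset.disjoint_left]
          intro ρ h1 h2
          exact hdis k hki A ((hTm A).1 hA) B ((hTm B).1 hB) hAB ρ
            ⟨mem_hidFin.1 h1, mem_hidFin.1 h2⟩
      have e1 := hp.hc_eq hsys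
      have e2 := hp.sum_hc_sub hsys
      rw [← hT] at e2
      rw [Finset.sum_congr rfl hk1, ← e2] at e1
      rw [hcardG, Finset.sum_congr rfl fun A hA => ((IH A ((hTm A).1 hA)).2.1).symm,
        Finset.sum_add_distrib, ← Finset.mul_sum, Finset.sum_const, hTc, smul_eq_mul, mul_one, e1,
        mul_add]
      omega
    · intro k hMk ρ hρ hρn hpres
      by_cases hk : k = i
      · subst hk
        obtain ⟨K, hKG, hKρ⟩ := hpres
        rw [part_unique hsys hρ hπ hKρ (hp.mem hKG)]
        exact hp.hidden
      · exact hthird k hk hMk ρ hρ hρn hpres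

end sys
end HidPf

theorem stmt_10 {d : ℕ} {X : Fin d → Type*} (P : ∀ i, Set (Set (Set (X i))))
    (hsys : IsBoxSystem X P) (n : ℕ) (hn : 2 ≤ n)
    (hcard : ∀ i, ∀ π ∈ P i, π ≠ {Set.univ} → π.ncard = n)
    (G : Set (∀ i, Set (X i))) (hG : IsKellerFamily P G)
    (hproper : ∀ K ∈ G, ∀ i, K i ≠ Set.univ)
    (hcover : polyUnion G = Set.univ) :
    ∑ i, (hiddenSet P G i).ncard ≤ (n ^ d - 1) / (n - 1) ∧
      (∑ i, (hiddenSet P G i).ncard = (n ^ d - 1) / (n - 1) ↔ IsMultipile P G) := by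
  change HidPf.hc P G ≤ _ ∧ (HidPf.hc P G = _ ↔ _)
  have hN : (n - 1) * ((n ^ d - 1) / (n - 1)) = n ^ d - 1 := by
    apply Nat.mul_div_cancel'
    simpa using Nat.sub_dvd_pow_sub_pow n 1 d
  have hpos : 1 ≤ n ^ d := Nat.one_le_pow _ _ (by omega)
  have h1 := (HidPf.mainS hsys n hn hcard hG).1
  have h2 := HidPf.card_le hsys n hn hcard hG hproper
  set N := (n ^ d - 1) / (n - 1) with hNd
  refine ⟨?_, ?_, ?_⟩
  · exact Nat.le_of_mul_le_mul_left
      (show (n - 1) * HidPf.hc P G ≤ (n - 1) * N by omega) (by omega)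
  · intro h
    refine HidPf.mp_of_eq hsys n hn hcard _ G rfl hG ?_
    rw [h] at h1 ⊢
    omega
  · intro h
    obtain ⟨e1, e2, -⟩ := HidPf.eq_of_mp hsys n hn hcard h (fun _ => Set.univ)
      (by rw [hcover]; ext x; simp [boxSet]) hproper
    simp only [Finset.filter_true, Finset.card_univ, Fintype.card_fin] at e1
    exact Nat.eq_of_mul_eq_mul_left (show 0 < n - 1 by omega)
      (show (n - 1) * HidPf.hc P G = (n - 1) * N by omega)
end

section
/- Let (X, Π, 𝓑) be a system of d-boxes and suppose there is an integer n ≥ 2 such that for every i ∈ {1,…,d} every nontrivial partition belonging to Π_i has exactly n parts. If 𝓖 ⊆ 𝓑 is a Keller family that is a partition of X and consists of proper boxes, then |𝓖| = n^d. -/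
open Set

theorem part_unique {α : Type*} {π ρ : Set (Set α)} (hπ : IsPartition π) (hρ : IsPartition ρ)
    (hind : π ≠ ρ → IndepPartitions π ρ) {A : Set α} (h1 : A ∈ π) (h2 : A ∈ ρ)
    (hA : A ≠ Set.univ) : π = ρ := by
  by_contra hne
  have hco : ∀ σ : Set (Set α), IsPartition σ → A ∈ σ → Coarser σ {A, Aᶜ} := by
    intro σ hσ hAσ B hB
    by_cases hBA : B = A
    · exact ⟨A, by simp, hBA.le⟩
    · exact ⟨Aᶜ, by simp, (hσ.2.1 hB hAσ hBA).subset_compl_right⟩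
  have := hind hne {A, Aᶜ} ⟨?_, ?_, ?_⟩ (hco π hπ h1) (hco ρ hρ h2)
  · have hm : A ∈ ({A, Aᶜ} : Set (Set α)) := by simp
    rw [this] at hm
    exact hA hm
  · rintro B (rfl | rfl)
    · exact hπ.1 _ h1
    · exact Set.nonempty_compl.2 hA
  · rintro B (rfl | rfl) C (rfl | rfl) h
    · exact absurd rfl h
    · exact disjoint_compl_right
    · exact disjoint_compl_left
    · exact absurd rfl h
  · simp

theorem part_eq {α : Type*} {π : Set (Set α)} (hπ : IsPartition π) {A B : Set α}
    (h1 : A ∈ π) (h2 : B ∈ π) {z : α} (hA : z ∈ A) (hB : z ∈ B) : A = B := by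
  by_contra h
  exact Set.disjoint_left.1 (hπ.2.1 h1 h2 h) hA hB

/-- The lifted family still covers: replace coordinates one at a time. -/
theorem lift_cover {d : ℕ} {X : Fin d → Type*} (P : ∀ i, Set (Set (Set (X i))))
    (hsys : IsBoxSystem X P)
    (G : Set (∀ i, Set (X i))) (hG : IsKellerFamily P G)
    (hproper : ∀ K ∈ G, ∀ i, K i ≠ Set.univ)
    (hcover : polyUnion G = Set.univ)
    (f : ∀ i, ∀ π : P i, π.1) (S : Finset (Fin d)) :
    ∀ x : ∀ i, X i, ∃ K ∈ G, (∀ i ∈ S, ∀ π : P i, K i ∈ π.1 → (f i π).1 = K i) ∧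
      ∀ i, i ∉ S → x i ∈ K i := by
  obtain ⟨-, -, -, hpart, hind⟩ := hsys
  obtain ⟨-, hbox, hK⟩ := hG
  induction S using Finset.induction_on with
  | empty =>
    intro x
    have hx : x ∈ polyUnion G := by rw [hcover]; trivial
    simp only [polyUnion, boxSet, Set.mem_iUnion, Set.mem_pi] at hx
    obtain ⟨K, hKG, h⟩ := hx
    exact ⟨K, hKG, by simp, fun i _ => h i trivial⟩
  | insert i S hi ih =>
    intro x
    obtain ⟨K₀, hK₀, a₀, b₀⟩ := ih x
    obtain ⟨π, hπ, hKπ⟩ := hbox K₀ hK₀ i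
    obtain ⟨z, hz⟩ := (hpart i π hπ).1 _ (f i ⟨π, hπ⟩).2
    obtain ⟨L, hL, a, b⟩ := ih (Function.update x i z)
    have hzL : z ∈ L i := by simpa using b i hi
    have hb : ∀ j, j ≠ i → j ∉ S → x j ∈ L j := by
      intro j hj hjS
      simpa [Function.update_of_ne hj] using b j hjS
    have hLπ : L i ∈ π := by
      by_cases hKL : K₀ = L
      · exact hKL ▸ hKπ
      obtain ⟨j, ρ, hρ, h1, h2, h3⟩ := hK K₀ hK₀ L hL hKL
      by_cases hj : j = i
      · subst hj
        have := part_unique (hpart j π hπ) (hpart j ρ hρ) (hind j π hπ ρ hρ) hKπ h1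
          (hproper _ hK₀ j)
        exact this ▸ h2
      · exfalso
        by_cases hjS : j ∈ S
        · exact h3 ((a₀ j hjS ⟨ρ, hρ⟩ h1).symm.trans (a j hjS ⟨ρ, hρ⟩ h2))
        · exact h3 (part_eq (hpart j ρ hρ) h1 h2 (b₀ j hjS) (hb j hj hjS))
    refine ⟨L, hL, ?_, ?_⟩
    · intro j hj ρ hρ
      rcases Finset.mem_insert.1 hj with rfl | hj
      · have : π = ρ.1 := part_unique (hpart j π hπ) (hpart j _ ρ.2)
          (hind j π hπ _ ρ.2) hLπ hρ (hproper _ hL j)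
        obtain ⟨ρ, hρ'⟩ := ρ
        subst this
        exact part_eq (hpart j π hπ) (f j ⟨π, hρ'⟩).2 hLπ hz hzL
      · exact a j hj ρ hρ
    · intro j hj
      rw [Finset.mem_insert, not_or] at hj
      exact hb j hj.1 hj.2

theorem stmt_11 {d : ℕ} {X : Fin d → Type*} (P : ∀ i, Set (Set (Set (X i))))
    (hsys : IsBoxSystem X P) (n : ℕ) (hn : 2 ≤ n)
    (hcard : ∀ i, ∀ π ∈ P i, π ≠ {Set.univ} → π.ncard = n)
    (G : Set (∀ i, Set (X i))) (hG : IsKellerFamily P G)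
    (hproper : ∀ K ∈ G, ∀ i, K i ≠ Set.univ)
    (hcover : polyUnion G = Set.univ) :
    G.ncard = n ^ d := by
  classical
  have hsys' := hsys
  obtain ⟨hnt, hfin, hpfin, hpart, hind⟩ := hsys'
  obtain ⟨-, hbox, hK⟩ := id hG
  have hne : ∀ K ∈ G, ∀ i, ∀ π ∈ P i, K i ∈ π → π.ncard = n := by
    intro K hKG i π hπ hKπ
    refine hcard i π hπ ?_
    rintro rfl
    exact hproper K hKG i hKπ
  have : ∀ i, Fintype (P i) := fun i => (hfin i).fintype
  have : ∀ i, ∀ π : P i, Fintype π.1 := fun i π => (hpfin i π.1 π.2).fintype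
  have hGfin : G.Finite := by
    have : (Set.univ.pi (fun i => ⋃₀ P i)).Finite :=
      Set.Finite.pi' (fun i => (hfin i).sUnion (hpfin i)) |>.subset (by intro K h i; exact h i trivial)
    refine this.subset ?_
    intro K hKG i _
    exact hbox K hKG i
  set F := ∀ i, ∀ π : P i, π.1 with hF
  let H : (∀ i, Set (X i)) → Finset F := fun K =>
    Finset.univ.filter fun f => ∀ i, ∀ π : P i, K i ∈ π.1 → (f i π).1 = K i
  have hHcard : ∀ K ∈ G, n ^ d * (H K).card = Fintype.card F := by
    intro K hKG
    have hHK : H K = Fintype.piFinset (fun i => Fintype.piFinset fun π : P i =>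
        Finset.univ.filter (fun A : π.1 => K i ∈ π.1 → A.1 = K i)) := by
      ext f
      have e1 : f ∈ H K ↔ ∀ i, ∀ π : P i, K i ∈ π.1 → (f i π).1 = K i := by
        simp only [H, Finset.mem_filter, Finset.mem_univ, true_and]
      rw [e1]
      refine Iff.trans (forall_congr' fun i => ?_) Fintype.mem_piFinset.symm
      refine Iff.trans (forall_congr' fun π => ?_) Fintype.mem_piFinset.symm
      simp only [Finset.mem_filter, Finset.mem_univ, true_and]
    have key : ∀ i, n * ∏ π : P i, (Finset.univ.filter
        (fun A : π.1 => K i ∈ π.1 → A.1 = K i)).card = ∏ π : P i, Fintype.card π.1 := by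
      intro i
      obtain ⟨ρ, hρ, hKρ⟩ := hbox K hKG i
      have h1 : n = ∏ π : P i, if π = ⟨ρ, hρ⟩ then n else 1 := by simp
      nth_rewrite 1 [h1]
      rw [← Finset.prod_mul_distrib]
      refine Finset.prod_congr rfl fun π _ => ?_
      split_ifs with h
      · have hKπ : K i ∈ π.1 := by rw [h]; exact hKρ
        have h3 : (Finset.univ.filter (fun A : π.1 => K i ∈ π.1 → A.1 = K i)) = {⟨K i, hKπ⟩} := by
          ext A
          simp [hKπ, Subtype.ext_iff]
        have h2 := hne K hKG i π.1 π.2 hKπ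
        rw [← Nat.card_coe_set_eq, Nat.card_eq_fintype_card] at h2
        rw [h3, Finset.card_singleton, mul_one, h2]
      · have hn' : K i ∉ π.1 := fun h' => h (Subtype.ext (part_unique (hpart i _ π.2)
          (hpart i ρ hρ) (hind i _ π.2 ρ hρ) h' hKρ (hproper K hKG i)))
        simp [hn']
    rw [hHK, Fintype.card_piFinset]
    simp only [Fintype.card_piFinset]
    have : n ^ d = ∏ i : Fin d, n := by simp
    rw [this, ← Finset.prod_mul_distrib, Finset.prod_congr rfl fun i _ => key i]
    simp [F, Fintype.card_pi]
  have hsum : ∑ K ∈ hGfin.toFinset, (H K).card = Fintype.card F := by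
    rw [← Finset.card_biUnion, ← Finset.card_univ]
    · congr 1
      ext f
      simp only [Finset.mem_biUnion, Set.Finite.mem_toFinset, Finset.mem_univ, iff_true]
      have x : ∀ i, X i := fun i => Classical.choice (hnt i).to_nonempty
      obtain ⟨K, hKG, h, -⟩ := lift_cover P hsys G hG hproper hcover f Finset.univ x
      exact ⟨K, hKG, by simpa [H] using h⟩
    · intro K hKG L hLG hKL
      rw [Function.onFun, Finset.disjoint_left]
      intro f h1 h2
      simp only [H, Finset.mem_filter, Finset.mem_univ, true_and] at h1 h2
      obtain ⟨i, π, hπ, a, b, c⟩ := hK K (by simpa using hKG) L (by simpa using hLG) hKL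
      exact c ((h1 i ⟨π, hπ⟩ a).symm.trans (h2 i ⟨π, hπ⟩ b))
  have hpos : 0 < Fintype.card F := by
    rw [Fintype.card_pos_iff]
    refine ⟨fun i π => Classical.choice ?_⟩
    obtain ⟨x⟩ := (hnt i).to_nonempty
    have hx : x ∈ ⋃₀ π.1 := by rw [(hpart i _ π.2).2.2]; trivial
    obtain ⟨A, hA, -⟩ := hx
    exact ⟨⟨A, hA⟩⟩
  have h := congrArg (n ^ d * ·) hsum
  simp only [Finset.mul_sum] at h
  rw [Finset.sum_congr rfl fun K hKG => hHcard K (by simpa using hKG), Finset.sum_const,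
    smul_eq_mul] at h
  rw [Set.ncard_eq_toFinset_card G hGfin]
  exact Nat.eq_of_mul_eq_mul_right hpos h
end

section
/- Let (X, Π, 𝓑) be a system of d-boxes with each Π_i unital. For every pair of distinct boxes C, D ∈ 𝓑, the pair {C, D} satisfies Keller's condition if and only if the sets Ĉ and D̂ are disjoint. -/
open Set

/-- `Y_i = Π_{π ∈ P} π`: functions assigning to each partition of the family one of
its parts. -/
abbrev YSpace {α : Type*} (P : Set (Set (Set α))) : Type _ :=
  ∀ π : P, {A : Set α // A ∈ π.1}

/-- The hat of a part `A`: the set of all choice functions that pick `A` at every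
partition containing `A` (and are arbitrary elsewhere). -/
def hatPart {α : Type*} (P : Set (Set (Set α))) (A : Set α) : Set (YSpace P) :=
  {y | ∀ π : P, A ∈ π.1 → (y π).1 = A}

/-- The hat of a box. -/
def hatBox {d : ℕ} {X : Fin d → Type*} (P : ∀ i, Set (Set (Set (X i))))
    (C : ∀ i, Set (X i)) : Set (∀ i, YSpace (P i)) :=
  Set.univ.pi fun i => hatPart (P i) (C i)

theorem stmt_12 {d : ℕ} {X : Fin d → Type*} (P : ∀ i, Set (Set (Set (X i))))
    (hsys : IsBoxSystem X P) (hunital : ∀ i, {Set.univ} ∈ P i)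
    (C D : ∀ i, Set (X i)) (hC : IsBox P C) (hD : IsBox P D) (hne : C ≠ D) :
    KellerPair P C D ↔ Disjoint (hatBox P C) (hatBox P D) := by
  obtain ⟨hnt, -, -, hpart, -⟩ := hsys
  constructor
  · rintro ⟨i, π, hπ, h1, h2, h3⟩
    rw [Set.disjoint_left]
    intro y hy1 hy2
    have e1 := hy1 i (Set.mem_univ i) ⟨π, hπ⟩ h1
    have e2 := hy2 i (Set.mem_univ i) ⟨π, hπ⟩ h2
    exact h3 (e1.symm.trans e2)
  · intro hdis
    by_contra hK
    have key : ∀ i, ∀ π : P i, ∃ A : {A : Set (X i) // A ∈ π.1},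
        (C i ∈ π.1 → A.1 = C i) ∧ (D i ∈ π.1 → A.1 = D i) := by
      intro i π
      by_cases h1 : C i ∈ π.1
      · refine ⟨⟨C i, h1⟩, fun _ => rfl, fun h2 => ?_⟩
        by_contra h3
        exact hK ⟨i, π.1, π.2, h1, h2, h3⟩
      · by_cases h2 : D i ∈ π.1
        · exact ⟨⟨D i, h2⟩, fun h => absurd h h1, fun _ => rfl⟩
        · obtain ⟨x, -⟩ := (hnt i).exists_pair_ne
          have hx : x ∈ ⋃₀ π.1 := by
            rw [(hpart i π.1 π.2).2.2]
            exact Set.mem_univ x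
          obtain ⟨A, hA, -⟩ := hx
          exact ⟨⟨A, hA⟩, fun h => absurd h h1, fun h => absurd h h2⟩
    choose y hy using key
    exact (Set.disjoint_left.mp hdis : ∀ ⦃a⦄, a ∈ hatBox P C → a ∉ hatBox P D) (a := y) (fun i _ π h => (hy i π).1 h)
      (fun i _ π h => (hy i π).2 h)
end

section
/- Let (X, Π, 𝓑) be a system of d-boxes with each Π_i unital. If 𝓖₁ and 𝓖₂ are two suits for the same polybox G, then 𝓖̂₁ and 𝓖̂₂ are suits for the same polybox Ĝ in the system of d-boxes (Y, Π̂, 𝓑̂); that is, the union of the members of 𝓖̂₁ equals the union of the members of 𝓖̂₂. -/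
open Set

theorem aux_sat {α : Type*} {π π' : Set (Set α)} (h : IndepPartitions π π') (S : Set α)
    (hS : S.Nonempty) (h1 : ∀ A ∈ π, A ⊆ S ∨ A ⊆ Sᶜ) (h2 : ∀ A ∈ π', A ⊆ S ∨ A ⊆ Sᶜ) :
    S = Set.univ := by
  by_contra hne
  have hc : Sᶜ.Nonempty := Set.nonempty_compl.mpr hne
  have key : ({S, Sᶜ} : Set (Set α)) = {Set.univ} := by
    apply h
    · refine ⟨?_, ?_, ?_⟩
      · rintro A (rfl | rfl)
        · exact hS
        · exact hc
      · rintro A (rfl | rfl) B (rfl | rfl) hAB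
        · exact absurd rfl hAB
        · exact disjoint_compl_right
        · exact disjoint_compl_left
        · exact absurd rfl hAB
      · simp
    · intro A hA
      rcases h1 A hA with h | h
      · exact ⟨S, by simp, h⟩
      · exact ⟨Sᶜ, by simp, h⟩
    · intro A hA
      rcases h2 A hA with h | h
      · exact ⟨S, by simp, h⟩
      · exact ⟨Sᶜ, by simp, h⟩
  have : S ∈ ({Set.univ} : Set (Set α)) := by rw [← key]; simp
  exact hne this

theorem aux_eq {α : Type*} {π : Set (Set α)} (h : IsPartition π) {A B : Set α} (hA : A ∈ π)
    (hB : B ∈ π) {x : α} (hxA : x ∈ A) (hxB : x ∈ B) : A = B := by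
  by_contra hne
  exact Set.disjoint_left.mp (h.2.1 hA hB hne) hxA hxB

theorem aux_sUnion {α : Type*} {π H : Set (Set α)} (h : IsPartition π) (hH : H ⊆ π) :
    ∀ A ∈ π, A ⊆ ⋃₀ H ∨ A ⊆ (⋃₀ H)ᶜ := by
  intro A hA
  by_cases hAH : A ∈ H
  · exact Or.inl (Set.subset_sUnion_of_mem hAH)
  · right
    rintro x hx ⟨B, hB, hxB⟩
    exact hAH (aux_eq h hA (hH hB) hx hxB ▸ hB)

theorem aux_univ {α : Type*} {π : Set (Set α)} (h : IsPartition π) (hu : Set.univ ∈ π) :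
    π = {Set.univ} := by
  ext A
  constructor
  · intro hA
    obtain ⟨x, hx⟩ := h.1 A hA
    exact aux_eq h hA hu hx trivial
  · rintro rfl
    exact hu

theorem aux_unique {α : Type*} {P : Set (Set (Set α))} (hp : ∀ π ∈ P, IsPartition π)
    (hi : ∀ π ∈ P, ∀ π' ∈ P, π ≠ π' → IndepPartitions π π') {π π' : Set (Set α)}
    (hπ : π ∈ P) (hπ' : π' ∈ P) {A : Set α} (hA : A ∈ π) (hA' : A ∈ π') : π = π' := by
  by_contra hne
  have hAu : A = Set.univ := by
    have e : A = ⋃₀ {A} := by simp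
    apply aux_sat (hi π hπ π' hπ' hne) A ((hp π hπ).1 A hA)
    · rw [e]; exact aux_sUnion (hp π hπ) (by simpa using hA)
    · rw [e]; exact aux_sUnion (hp π' hπ') (by simpa using hA')
  subst hAu
  exact hne ((aux_univ (hp π hπ) hA).trans (aux_univ (hp π' hπ') hA').symm)

theorem aux_one {α : Type*} {P : Set (Set (Set α))} (hp : ∀ π ∈ P, IsPartition π)
    (hi : ∀ π ∈ P, ∀ π' ∈ P, π ≠ π' → IndepPartitions π π') (H₁ H₂ : Set (Set α))
    (b₁ : ∀ A ∈ H₁, ∃ π ∈ P, A ∈ π) (b₂ : ∀ A ∈ H₂, ∃ π ∈ P, A ∈ π)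
    (k₁ : ∀ A ∈ H₁, ∀ B ∈ H₁, A ≠ B → ∃ π ∈ P, A ∈ π ∧ B ∈ π)
    (k₂ : ∀ A ∈ H₂, ∀ B ∈ H₂, A ≠ B → ∃ π ∈ P, A ∈ π ∧ B ∈ π)
    (hU : ⋃₀ H₁ = ⋃₀ H₂) (y : YSpace P) (hy : ∃ A ∈ H₁, y ∈ hatPart P A) :
    ∃ A ∈ H₂, y ∈ hatPart P A := by
  have sub : ∀ H : Set (Set α), (∀ A ∈ H, ∀ B ∈ H, A ≠ B → ∃ π ∈ P, A ∈ π ∧ B ∈ π) →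
      ∀ A ∈ H, ∀ π ∈ P, A ∈ π → H ⊆ π := by
    intro H k A hA π hπ hAπ B hB
    by_cases hAB : A = B
    · exact hAB ▸ hAπ
    · obtain ⟨ρ, hρ, hAρ, hBρ⟩ := k A hA B hB hAB
      rw [aux_unique hp hi hπ hρ hAπ hAρ]
      exact hBρ
  obtain ⟨A, hA, hyA⟩ := hy
  obtain ⟨π₁, hπ₁, hAπ₁⟩ := b₁ A hA
  have s₁ := sub H₁ k₁ A hA π₁ hπ₁ hAπ₁
  obtain ⟨a, ha⟩ := (hp π₁ hπ₁).1 A hAπ₁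
  have haU : a ∈ ⋃₀ H₁ := ⟨A, hA, ha⟩
  obtain ⟨C, hC, haC⟩ : a ∈ ⋃₀ H₂ := hU ▸ haU
  obtain ⟨π₂, hπ₂, hCπ₂⟩ := b₂ C hC
  have s₂ := sub H₂ k₂ C hC π₂ hπ₂ hCπ₂
  by_cases hππ : π₁ = π₂
  · subst hππ
    have : A = C := aux_eq (hp _ hπ₁) hAπ₁ hCπ₂ ha haC
    subst this
    exact ⟨A, hC, hyA⟩
  · have hS : ⋃₀ H₂ = Set.univ := by
      apply aux_sat (hi π₁ hπ₁ π₂ hπ₂ hππ) (⋃₀ H₂) ⟨a, C, hC, haC⟩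
      · rw [← hU]; exact aux_sUnion (hp _ hπ₁) s₁
      · exact aux_sUnion (hp _ hπ₂) s₂
    have hB := (y ⟨π₂, hπ₂⟩).2
    obtain ⟨b, hb⟩ := (hp π₂ hπ₂).1 _ hB
    obtain ⟨D, hD, hbD⟩ : b ∈ ⋃₀ H₂ := hS ▸ trivial
    have hDB := aux_eq (hp _ hπ₂) (s₂ hD) hB hbD hb
    refine ⟨D, hD, ?_⟩
    rintro ⟨ρ, hρ⟩ hDρ
    obtain rfl := aux_unique hp hi hπ₂ hρ (s₂ hD) hDρ
    exact hDB.symm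

/-- Mixed condition: coordinates in `S` are hatted, the others are not. -/
def mixCond {d : ℕ} {X : Fin d → Type*} (P : ∀ i, Set (Set (Set (X i))))
    (S : Finset (Fin d)) (x : ∀ i, X i) (y : ∀ i, YSpace (P i)) (K : ∀ i, Set (X i))
    (j : Fin d) : Prop :=
  (j ∈ S → y j ∈ hatPart (P j) (K j)) ∧ (j ∉ S → x j ∈ K j)

theorem aux_step {d : ℕ} {X : Fin d → Type*} (P : ∀ i, Set (Set (Set (X i))))
    (hsys : IsBoxSystem X P) (G₁ G₂ : Set (∀ i, Set (X i)))
    (hG₁ : IsKellerFamily P G₁) (hG₂ : IsKellerFamily P G₂) (S : Finset (Fin d))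
    (y : ∀ i, YSpace (P i)) (i : Fin d) (hiS : i ∉ S)
    (ih : ∀ x, (∃ K ∈ G₁, ∀ j, mixCond P S x y K j) ↔ (∃ K ∈ G₂, ∀ j, mixCond P S x y K j))
    (x : ∀ i, X i) (h : ∃ K ∈ G₁, ∀ j, mixCond P (insert i S) x y K j) :
    ∃ K ∈ G₂, ∀ j, mixCond P (insert i S) x y K j := by
  obtain ⟨-, -, -, hp, hi⟩ := hsys
  let H : Set (∀ i, Set (X i)) → Set (Set (X i)) := fun G =>
    {A | ∃ K ∈ G, (∀ j, j ≠ i → mixCond P S x y K j) ∧ K i = A}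
  have b : ∀ G, IsKellerFamily P G → ∀ A ∈ H G, ∃ π ∈ P i, A ∈ π := by
    rintro G hG A ⟨K, hK, -, rfl⟩
    exact hG.2.1 K hK i
  have k : ∀ G, IsKellerFamily P G → ∀ A ∈ H G, ∀ B ∈ H G, A ≠ B →
      ∃ π ∈ P i, A ∈ π ∧ B ∈ π := by
    rintro G hG A ⟨K, hK, cK, rfl⟩ B ⟨L, hL, cL, rfl⟩ hne
    have hKL : K ≠ L := by rintro rfl; exact hne rfl
    obtain ⟨j, π, hπ, hKπ, hLπ, hd⟩ := hG.2.2 K hK L hL hKL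
    by_cases hj : j = i
    · subst hj
      exact ⟨π, hπ, hKπ, hLπ⟩
    · exfalso
      apply hd
      by_cases hjS : j ∈ S
      · exact ((cK j hj).1 hjS ⟨π, hπ⟩ hKπ).symm.trans ((cL j hj).1 hjS ⟨π, hπ⟩ hLπ)
      · exact aux_eq (hp j π hπ) hKπ hLπ ((cK j hj).2 hjS) ((cL j hj).2 hjS)
  have u : ∀ G t, t ∈ ⋃₀ H G ↔ ∃ K ∈ G, ∀ j, mixCond P S (Function.update x i t) y K j := by
    intro G t
    constructor
    · rintro ⟨A, ⟨K, hK, cK, rfl⟩, ht⟩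
      refine ⟨K, hK, fun j => ?_⟩
      by_cases hj : j = i
      · subst hj
        exact ⟨fun h => absurd h hiS, fun _ => by simpa using ht⟩
      · refine ⟨(cK j hj).1, fun h => ?_⟩
        rw [Function.update_of_ne hj]
        exact (cK j hj).2 h
    · rintro ⟨K, hK, cK⟩
      refine ⟨K i, ⟨K, hK, fun j hj => ⟨(cK j).1, fun h => ?_⟩, rfl⟩, ?_⟩
      · have := (cK j).2 h
        rwa [Function.update_of_ne hj] at this
      · simpa using (cK i).2 hiS
  have v : ∀ G, (∃ A ∈ H G, y i ∈ hatPart (P i) A) ↔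
      ∃ K ∈ G, ∀ j, mixCond P (insert i S) x y K j := by
    intro G
    constructor
    · rintro ⟨A, ⟨K, hK, cK, rfl⟩, ht⟩
      refine ⟨K, hK, fun j => ?_⟩
      by_cases hj : j = i
      · subst hj
        exact ⟨fun _ => ht, fun h => absurd (Finset.mem_insert_self _ _) h⟩
      · simpa [mixCond, hj] using cK j hj
    · rintro ⟨K, hK, cK⟩
      refine ⟨K i, ⟨K, hK, fun j hj => ?_, rfl⟩, (cK i).1 (Finset.mem_insert_self _ _)⟩
      simpa [mixCond, hj] using cK j
  rw [← v] at h ⊢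
  refine aux_one (hp i) (hi i) (H G₁) (H G₂) (b _ hG₁) (b _ hG₂) (k _ hG₁) (k _ hG₂) ?_ (y i) h
  ext t
  rw [u, u]
  exact ih _

theorem stmt_13 {d : ℕ} {X : Fin d → Type*} (P : ∀ i, Set (Set (Set (X i))))
    (hsys : IsBoxSystem X P) (hunital : ∀ i, {Set.univ} ∈ P i)
    (G₁ G₂ : Set (∀ i, Set (X i)))
    (hG₁ : IsKellerFamily P G₁) (hG₂ : IsKellerFamily P G₂)
    (hsame : polyUnion G₁ = polyUnion G₂) :
    ⋃ C ∈ G₁, hatBox P C = ⋃ C ∈ G₂, hatBox P C := by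
  have main : ∀ (y : ∀ i, YSpace (P i)) (S : Finset (Fin d)) (x : ∀ i, X i),
      (∃ K ∈ G₁, ∀ j, mixCond P S x y K j) ↔ (∃ K ∈ G₂, ∀ j, mixCond P S x y K j) := by
    intro y S
    induction S using Finset.induction_on with
    | empty =>
      intro x
      have := Set.ext_iff.mp hsame x
      simpa [polyUnion, boxSet, mixCond] using this
    | insert i S hiS ih =>
      intro x
      exact ⟨aux_step P hsys G₁ G₂ hG₁ hG₂ S y i hiS ih x,
        aux_step P hsys G₂ G₁ hG₂ hG₁ S y i hiS (fun x => (ih x).symm) x⟩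
  ext y
  have hne : ∀ i, Nonempty (X i) := fun i => (hsys.1 i).to_nonempty
  have := main y Finset.univ (fun i => (hne i).some)
  simpa [hatBox, mixCond] using this
end

section
/- Let X_i be a set with at least two elements, let Π_i be a finite family of pairwise independent finite partitions of X_i containing {X_i}, and let Y_i = Π_{π ∈ Π_i} π. Then: (1) for every π ∈ Π_i, the family π̂ = {Â : A ∈ π} is a partition of Y_i; (2) the family Π̂_i = {π̂ : π ∈ Π_i} is pairwise independent; and (3) Π̂_i is complete, i.e., every partition of Y_i all of whose parts are of the form Â with A ∈ ⋃Π_i belongs to Π̂_i. -/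
open Set

theorem part_unique_s14 {α : Type*} {π π' : Set (Set α)}
    (h : IsPartition π) (h' : IsPartition π') (hi : π ≠ π' → IndepPartitions π π')
    {A : Set α} (hA : A ∈ π) (hA' : A ∈ π') : π = π' := by
  by_contra hne
  have key : ∀ σ : Set (Set α), IsPartition σ → A ∈ σ → ∀ B ∈ σ, B ≠ A → B ⊆ Aᶜ := by
    intro σ hσ hAσ B hB hBA
    exact (hσ.2.1 hB hAσ hBA).subset_compl_right
  by_cases hu : A = Set.univ
  · have key2 : ∀ σ : Set (Set α), IsPartition σ → A ∈ σ → σ = {Set.univ} := by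
      intro σ hσ hAσ
      ext B
      constructor
      · intro hB
        by_contra hBA
        have h1 := key σ hσ hAσ B hB (by rw [hu]; exact hBA)
        obtain ⟨x, hx⟩ := hσ.1 B hB
        exact h1 hx (by rw [hu]; trivial)
      · intro hB
        rw [Set.mem_singleton_iff] at hB
        rw [hB, ← hu]; exact hAσ
    exact hne ((key2 π h hA).trans (key2 π' h' hA').symm)
  · have hc : ∀ σ : Set (Set α), IsPartition σ → A ∈ σ → Coarser σ {A, Aᶜ} := by
      intro σ hσ hAσ B hB
      by_cases hBA : B = A
      · exact ⟨A, by simp, hBA.subset⟩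
      · exact ⟨Aᶜ, by simp, key σ hσ hAσ B hB hBA⟩
    have hp : IsPartition ({A, Aᶜ} : Set (Set α)) := by
      refine ⟨?_, ?_, ?_⟩
      · rintro B (rfl | rfl)
        · exact h.1 _ hA
        · exact Set.nonempty_compl.2 hu
      · rintro B (rfl | rfl) C (rfl | rfl) hBC
        · exact absurd rfl hBC
        · exact disjoint_compl_right
        · exact disjoint_compl_left
        · exact absurd rfl hBC
      · simp
    have := hi hne _ hp (hc π h hA) (hc π' h' hA')
    have hm : A ∈ ({A, Aᶜ} : Set (Set α)) := by simp
    rw [this] at hm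
    exact hu hm

theorem stmt_14 {α : Type*} [Nontrivial α] (P : Set (Set (Set α)))
    (hfin : P.Finite) (hparfin : ∀ π ∈ P, π.Finite)
    (hpart : ∀ π ∈ P, IsPartition π)
    (hind : ∀ π ∈ P, ∀ π' ∈ P, π ≠ π' → IndepPartitions π π')
    (hunital : {Set.univ} ∈ P) :
    (∀ π ∈ P, IsPartition (hatPart P '' π)) ∧
      (∀ π ∈ P, ∀ π' ∈ P, hatPart P '' π ≠ hatPart P '' π' →
        IndepPartitions (hatPart P '' π) (hatPart P '' π')) ∧
      (∀ ρ : Set (Set (YSpace P)), IsPartition ρ →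
        (∀ S ∈ ρ, ∃ A : Set α, (∃ π ∈ P, A ∈ π) ∧ S = hatPart P A) →
        ∃ π ∈ P, ρ = hatPart P '' π) := by
  classical
  have huniq : ∀ π ∈ P, ∀ π' ∈ P, ∀ A, A ∈ π → A ∈ π' → π = π' := fun π h π' h' A hA hA' =>
    part_unique_s14 (hpart π h) (hpart π' h') (hind π h π' h') hA hA'
  have hmem : ∀ (π) (h : π ∈ P), ∀ A ∈ π, ∀ y : YSpace P,
      y ∈ hatPart P A ↔ (y ⟨π, h⟩).1 = A := by
    intro π h A hA y
    constructor
    · intro hy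
      exact hy ⟨π, h⟩ hA
    · rintro hy ⟨π', h'⟩ hA'
      obtain rfl := huniq π h π' h' A hA hA'
      exact hy
  have hne : Nonempty (YSpace P) := by
    refine ⟨fun π => ?_⟩
    have h := (hpart π.1 π.2).2.2
    have : ∃ A, A ∈ π.1 := by
      obtain ⟨x⟩ : Nonempty α := inferInstance
      have hx : x ∈ ⋃₀ π.1 := by rw [h]; trivial
      obtain ⟨A, hA, _⟩ := hx
      exact ⟨A, hA⟩
    exact ⟨this.choose, this.choose_spec⟩
  obtain ⟨y0⟩ := hne
  have h1 : ∀ π ∈ P, IsPartition (hatPart P '' π) := by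
    intro π h
    refine ⟨?_, ?_, ?_⟩
    · rintro _ ⟨A, hA, rfl⟩
      refine ⟨Function.update y0 ⟨π, h⟩ ⟨A, hA⟩, ?_⟩
      rw [hmem π h A hA]
      simp
    · rintro _ ⟨A, hA, rfl⟩ _ ⟨B, hB, rfl⟩ hAB
      refine Set.disjoint_left.2 fun y hy hy' => hAB ?_
      have e1 := (hmem π h A hA y).1 hy
      have e2 := (hmem π h B hB y).1 hy'
      rw [← e1, ← e2]
    · refine Set.eq_univ_of_forall fun y => ?_
      exact ⟨_, ⟨(y ⟨π, h⟩).1, (y ⟨π, h⟩).2, rfl⟩, (hmem π h _ (y ⟨π, h⟩).2 y).2 rfl⟩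
  have hmix : ∀ π ∈ P, ∀ π' ∈ P, π ≠ π' → ∀ A ∈ π, ∀ B ∈ π',
      ∃ w, w ∈ hatPart P A ∧ w ∈ hatPart P B := by
    intro π h π' h' hn A hA B hB
    refine ⟨Function.update (Function.update y0 ⟨π', h'⟩ ⟨B, hB⟩) ⟨π, h⟩ ⟨A, hA⟩, ?_, ?_⟩
    · rw [hmem π h A hA]
      simp
    · rw [hmem π' h' B hB, Function.update_of_ne (by simpa using hn.symm)]
      simp
  refine ⟨h1, ?_, ?_⟩
  · intro π h π' h' hn ρ hρ hc hc'
    have hn' : π ≠ π' := fun e => hn (by rw [e])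
    have hall : ∀ S ∈ ρ, S = Set.univ := by
      intro S hS
      obtain ⟨y, hy⟩ := hρ.1 S hS
      have heq : ∀ U ∈ ρ, ∀ V ∈ ρ, ∀ x, x ∈ U → x ∈ V → U = V := by
        intro U hU V hV x hx hx'
        by_contra hUV
        exact Set.disjoint_left.1 (hρ.2.1 hU hV hUV) hx hx'
      refine Set.eq_univ_of_forall fun z => ?_
      obtain ⟨w, hw, hw'⟩ := hmix π h π' h' hn' _ (y ⟨π, h⟩).2 _ (z ⟨π', h'⟩).2
      obtain ⟨U, hU, hUs⟩ := hc _ ⟨_, (y ⟨π, h⟩).2, rfl⟩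
      obtain ⟨V, hV, hVs⟩ := hc' _ ⟨_, (z ⟨π', h'⟩).2, rfl⟩
      have e1 : S = U := heq S hS U hU y hy (hUs ((hmem π h _ (y ⟨π, h⟩).2 y).2 rfl))
      have e2 : U = V := heq U hU V hV w (hUs hw) (hVs hw')
      rw [e1, e2]
      exact hVs ((hmem π' h' _ (z ⟨π', h'⟩).2 z).2 rfl)
    have hy0 : y0 ∈ ⋃₀ ρ := by rw [hρ.2.2]; trivial
    obtain ⟨S, hS, _⟩ := hy0
    ext T
    constructor
    · exact fun hT => hall T hT
    · intro hT
      rw [Set.mem_singleton_iff] at hT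
      rw [hT, ← hall S hS]
      exact hS
  · intro ρ hρ hhat
    have hy0 : y0 ∈ ⋃₀ ρ := by rw [hρ.2.2]; trivial
    obtain ⟨S, hS, _⟩ := hy0
    obtain ⟨A, ⟨π, h, hA⟩, hSA⟩ := hhat S hS
    have hsub : ρ ⊆ hatPart P '' π := by
      intro T hT
      obtain ⟨B, ⟨π', h', hB⟩, hTB⟩ := hhat T hT
      by_cases hn : π = π'
      · subst hn
        exact ⟨B, hB, hTB.symm⟩
      · obtain ⟨w, hw, hw'⟩ := hmix π h π' h' hn A hA B hB
        rw [← hSA] at hw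
        rw [← hTB] at hw'
        have e : S = T := by
          by_contra hST
          exact Set.disjoint_left.1 (hρ.2.1 hS hT hST) hw hw'
        exact ⟨A, hA, by rw [← hSA, e]⟩
    refine ⟨π, h, hsub.antisymm ?_⟩
    intro T hT
    obtain ⟨y, hy⟩ := (h1 π h).1 T hT
    have hyU : y ∈ ⋃₀ ρ := by rw [hρ.2.2]; trivial
    obtain ⟨U, hU, hyU⟩ := hyU
    have e : T = U := by
      by_contra hTU
      exact Set.disjoint_left.1 ((h1 π h).2.1 hT (hsub hU) hTU) hy hyU
    rw [e]
    exact hU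
end
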